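/- Let q ≥ 2 be an integer, K ⊂ ℚ̄ a number field, α ∈ K with 0 < |α| < 1, and let w_1, …, w_d be a basis of K as a ℚ(α)-vector space. Then M_{q,α,K} = w_1 M_{q,α,ℚ(α)} ⊕ ⋯ ⊕ w_d M_{q,α,ℚ(α)}; that is, every element ξ of M_{q,α,K} can be written uniquely as ξ = w_1 ξ_1 + ⋯ + w_d ξ_d with ξ_1, …, ξ_d ∈ M_{q,α,ℚ(α)}. -/

import Mathlib

noncomputable section

/-- The derivative `d/dz` of a formal power series over `ℂ`. -/
def psD (f : PowerSeries ℂ) : PowerSeries ℂ :=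
  PowerSeries.mk fun n => ((n : ℂ) + 1) * PowerSeries.coeff (n + 1) f

/-- The Mahler operator `σ_q : f(z) ↦ f(z^q)` on formal power series over `ℂ`. -/
def psSigma (q : ℕ) (f : PowerSeries ℂ) : PowerSeries ℂ :=
  PowerSeries.mk fun n => if q ∣ n then PowerSeries.coeff (n / q) f else 0

/-- The canonical embedding of polynomials into power series. -/
def polyPS : Polynomial ℂ →+* PowerSeries ℂ := Polynomial.coeToPowerSeries.ringHom

/-- The power series `∑ (a n / n!) zⁿ` attached to a sequence `a` of coefficients. -/
def ePS (a : ℕ → ℂ) : PowerSeries ℂ := PowerSeries.mk fun n => a n / (n.factorial : ℂ)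

/-- `IsE a` : the power series `∑ (a n / n!) zⁿ` is an E-function: its coefficients are
algebraic, it satisfies a nonzero linear differential equation over `ℚ̄[z]`, and the size of
the conjugates of the `a n` as well as their common denominators grow at most geometrically. -/
def IsE (a : ℕ → ℂ) : Prop :=
  (∀ n, IsAlgebraic ℚ (a n)) ∧
  (∃ (m : ℕ) (p : ℕ → Polynomial ℂ),
      (∀ i k, IsAlgebraic ℚ ((p i).coeff k)) ∧ (∃ i, i ≤ m ∧ p i ≠ 0) ∧
      ∑ i ∈ Finset.range (m + 1), polyPS (p i) * psD^[i] (ePS a) = 0) ∧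
  (∃ C : ℝ, 0 < C ∧ ∃ d : ℕ → ℕ, ∀ n : ℕ, 1 ≤ n →
      1 ≤ d n ∧ (d n : ℝ) ≤ C ^ n ∧
      (∀ σ : (integralClosure ℚ ℂ) →+* ℂ, ∀ h : a n ∈ integralClosure ℚ ℂ,
        ‖σ ⟨a n, h⟩‖ ≤ C ^ n) ∧
      (∀ i, 1 ≤ i → i ≤ n → IsIntegral ℤ ((d n : ℂ) * a i)))

/-- The value at `α` of the E-function with coefficient sequence `a`
(E-functions are entire, so this series converges for all `α`). -/
def evalE (a : ℕ → ℂ) (α : ℂ) : ℂ := ∑' n : ℕ, a n / (n.factorial : ℂ) * α ^ n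

/-- `IsM q f` : the formal power series `f` is an M_q-function, i.e. it has algebraic
coefficients and satisfies a linear `σ_q`-difference equation over `ℚ̄[z]` with
not-all-zero polynomial coefficients. -/
def IsM (q : ℕ) (f : PowerSeries ℂ) : Prop :=
  (∀ n, IsAlgebraic ℚ (PowerSeries.coeff n f)) ∧
  ∃ (m : ℕ) (p : ℕ → Polynomial ℂ),
    (∀ i k, IsAlgebraic ℚ ((p i).coeff k)) ∧ (∃ i, i ≤ m ∧ p i ≠ 0) ∧
    ∑ i ∈ Finset.range (m + 1), polyPS (p i) * (psSigma q)^[i] f = 0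

/-- `MahlerValue f α v` : the meromorphic extension of (the sum of) the power series `f`
to the open unit disk has no pole at `α` and takes the value `v` there. -/
def MahlerValue (f : PowerSeries ℂ) (α v : ℂ) : Prop :=
  ∃ F : ℂ → ℂ, MeromorphicOn F (Metric.ball (0 : ℂ) 1) ∧
    (∀ᶠ z in nhds (0 : ℂ), HasSum (fun n => PowerSeries.coeff n f * z ^ n) (F z)) ∧
    AnalyticAt ℂ F α ∧ F α = v

/-- The power series `f` converges (hence defines an analytic function) on the open
disk `D(0,R)`. -/
def AnOnBall (f : PowerSeries ℂ) (R : ℝ) : Prop :=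
  ∀ z : ℂ, ‖z‖ < R → Summable fun n => PowerSeries.coeff n f * z ^ n

/-- The value at `z` of (the sum of) the power series `f`. -/
def psEval (f : PowerSeries ℂ) (z : ℂ) : ℂ := ∑' n : ℕ, PowerSeries.coeff n f * z ^ n

/-- `Banal fv α P` : the homogeneous algebraic relation `P` among the values at `α` of the
power series `fv 1, …, fv r` is banal: it is the specialization at `z = α` of some
`Q ∈ ℚ̄[z, X₁, …, X_r]`, homogeneous in `X₁, …, X_r`, with `Q(z, fv 1, …, fv r) = 0`. -/
def Banal {r : ℕ} (fv : Fin r → PowerSeries ℂ) (α : ℂ) (P : MvPolynomial (Fin r) ℂ) : Prop :=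
  ∃ Q : MvPolynomial (Fin r) (Polynomial ℂ),
    (∀ v k, IsAlgebraic ℚ ((MvPolynomial.coeff v Q).coeff k)) ∧
    (∃ e, Q.IsHomogeneous e) ∧
    MvPolynomial.eval₂ polyPS fv Q = 0 ∧
    MvPolynomial.map (Polynomial.evalRingHom α) Q = P

/-- `Eset S` : the set of values at `z = 1` of all E-functions with coefficients in `S`. -/
def Eset (S : Set ℂ) : Set ℂ :=
  {x | ∃ a : ℕ → ℂ, IsE a ∧ (∀ n, a n ∈ S) ∧ x = evalE a 1}

/-- `Mset q α S` : the set of values at `α` of all M_q-functions with coefficients in `S`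
having no pole at `α`. -/
def Mset (q : ℕ) (α : ℂ) (S : Set ℂ) : Set ℂ :=
  {x | ∃ f : PowerSeries ℂ, IsM q f ∧ (∀ n, PowerSeries.coeff n f ∈ S) ∧ MahlerValue f α x}

set_option linter.unusedSectionVars false

namespace MahlerLift

open Polynomial
open scoped TensorProduct

section Operators

variable {K : Type*} [Field K] (q : ℕ) [NeZero q]

/-- The Mahler operator `f(z) ↦ f(z^q)` on formal power series. -/
def sg : PowerSeries K →+* PowerSeries K :=
  (PowerSeries.expand q (NeZero.ne q)).toRingHom

/-- The `r`-th section (Cartier) operator `∑ aₙ zⁿ ↦ ∑ a_{qn+r} zⁿ`. -/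
def cart (r : ℕ) : PowerSeries K →ₗ[K] PowerSeries K where
  toFun f := PowerSeries.mk fun n => PowerSeries.coeff (q * n + r) f
  map_add' f g := by ext n; simp
  map_smul' c f := by ext n; simp

/-- The Euler derivation `z d/dz` on formal power series. -/
def theta : Derivation K (PowerSeries K) (PowerSeries K) :=
  (PowerSeries.X : PowerSeries K) • PowerSeries.derivative K

@[simp] lemma coeff_cart (r n : ℕ) (f : PowerSeries K) :
    PowerSeries.coeff n (cart q r f) = PowerSeries.coeff (q * n + r) f := by
  simp [cart]

@[simp] lemma coeff_theta (n : ℕ) (f : PowerSeries K) :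
    PowerSeries.coeff n (theta f) = n * PowerSeries.coeff n f := by
  cases n with
  | zero => simp [theta]
  | succ n =>
    simp [theta, PowerSeries.coeff_succ_X_mul, PowerSeries.coeff_derivative]
    ring

lemma coeff_sg (n : ℕ) (f : PowerSeries K) :
    PowerSeries.coeff n (sg q f) = if q ∣ n then PowerSeries.coeff (n / q) f else 0 := by
  exact PowerSeries.coeff_expand _ _ _

lemma coeff_sg_mul (n : ℕ) (f : PowerSeries K) :
    PowerSeries.coeff (q * n) (sg q f) = PowerSeries.coeff n f := by
  exact PowerSeries.coeff_expand_mul _ _ _ _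

lemma sg_injective : Function.Injective (sg q : PowerSeries K →+* PowerSeries K) := by
  intro f g h
  ext n
  rw [← coeff_sg_mul q n f, h, coeff_sg_mul]

lemma algebraMap_eq_coe (p : K[X]) : algebraMap K[X] (PowerSeries K) p = (p : PowerSeries K) := by
  simp [PowerSeries.algebraMap_apply']

@[simp] lemma coeff_algebraMap_polynomial (p : K[X]) (n : ℕ) :
    PowerSeries.coeff n (algebraMap K[X] (PowerSeries K) p) = p.coeff n := by
  simp [algebraMap_eq_coe]

@[simp] lemma algebraMap_X : algebraMap K[X] (PowerSeries K) X = PowerSeries.X := by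
  simp [algebraMap_eq_coe]

lemma sg_algebraMap (p : K[X]) :
    sg q (algebraMap K[X] (PowerSeries K) p) =
      algebraMap K[X] (PowerSeries K) (Polynomial.expand K q p) := by
  ext n
  rw [coeff_sg]
  simp [Polynomial.coeff_expand (NeZero.pos q)]

lemma coeff_X_pow_mul_sg {r s : ℕ} (hr : r < q) (hs : s < q) (n : ℕ) (f : PowerSeries K) :
    PowerSeries.coeff (q * n + r) (PowerSeries.X ^ s * sg q f) =
      if r = s then PowerSeries.coeff n f else 0 := by
  rw [PowerSeries.coeff_X_pow_mul']
  split_ifs with h1 h2 h2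
  · subst h2
    rw [Nat.add_sub_cancel, coeff_sg_mul]
  · rw [coeff_sg, if_neg]
    rintro ⟨c, hc⟩
    have h3 : q * n + r = q * c + s := by omega
    apply h2
    have := congrArg (· % q) h3
    simpa [Nat.mul_add_mod, Nat.mod_eq_of_lt hr, Nat.mod_eq_of_lt hs] using this
  · omega
  · rfl

lemma cart_X_pow_mul_sg {r s : ℕ} (hr : r < q) (hs : s < q) (f : PowerSeries K) :
    cart q r (PowerSeries.X ^ s * sg q f) = if r = s then f else 0 := by
  ext n
  rw [coeff_cart, coeff_X_pow_mul_sg q hr hs]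
  split_ifs <;> simp

lemma sum_X_pow_mul_sg_cart (f : PowerSeries K) :
    ∑ s ∈ Finset.range q, PowerSeries.X ^ s * sg q (cart q s f) = f := by
  ext n
  have hr : n % q < q := Nat.mod_lt _ (NeZero.pos q)
  conv_lhs => rw [← Nat.div_add_mod n q]
  rw [map_sum, Finset.sum_congr rfl fun s hs =>
    coeff_X_pow_mul_sg q hr (Finset.mem_range.mp hs) (n / q) (cart q s f)]
  simp [hr, Nat.div_add_mod]

lemma cart_mul_sg {r : ℕ} (hr : r < q) (f g : PowerSeries K) :
    cart q r (f * sg q g) = cart q r f * g := by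
  conv_lhs => rw [← sum_X_pow_mul_sg_cart q f]
  rw [Finset.sum_mul, map_sum]
  simp_rw [mul_assoc, ← map_mul]
  rw [Finset.sum_congr rfl fun s hs =>
    cart_X_pow_mul_sg q hr (Finset.mem_range.mp hs) (cart q s f * g)]
  simp [hr]

lemma cart_theta (r : ℕ) (f : PowerSeries K) :
    cart q r (theta f) = (q : K) • theta (cart q r f) + (r : K) • cart q r f := by
  ext n
  simp
  ring

lemma theta_sg (f : PowerSeries K) : theta (sg q f) = (q : K) • sg q (theta f) := by
  ext n
  rw [coeff_theta, PowerSeries.coeff_smul, coeff_sg, coeff_sg]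
  split_ifs with h
  · obtain ⟨c, rfl⟩ := h
    rw [Nat.mul_div_cancel_left _ (NeZero.pos q)]
    simp
    ring
  · simp

/-- The `r`-th section operator on polynomials. -/
lemma exists_cart_algebraMap (r : ℕ) (p : K[X]) :
    ∃ p' : K[X], cart q r (algebraMap K[X] (PowerSeries K) p) =
      algebraMap K[X] (PowerSeries K) p' ∧ q * p'.natDegree ≤ p.natDegree := by
  refine ⟨∑ n ∈ Finset.range (p.natDegree + 1), Polynomial.monomial n (p.coeff (q * n + r)), ?_, ?_⟩
  · ext n
    simp [Polynomial.coeff_monomial]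
    intro h
    apply Polynomial.coeff_eq_zero_of_natDegree_lt
    have : n ≤ q * n := Nat.le_mul_of_pos_left n (NeZero.pos q)
    omega
  · have : (∑ n ∈ Finset.range (p.natDegree + 1),
        Polynomial.monomial n (p.coeff (q * n + r))).natDegree ≤ p.natDegree / q := by
      apply Polynomial.natDegree_sum_le_of_forall_le
      intro n _
      by_cases h : p.coeff (q * n + r) = 0
      · simp [h]
      · refine (Polynomial.natDegree_monomial_le _).trans ?_
        have := Polynomial.le_natDegree_of_ne_zero h
        rw [Nat.le_div_iff_mul_le (NeZero.pos q)]
        rw [mul_comm] at this ⊢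
        linarith
    calc _ ≤ q * (p.natDegree / q) := Nat.mul_le_mul_left _ this
      _ ≤ _ := Nat.mul_div_le _ _

end Operators

section Attractor

variable {K : Type*} [Field K] (q : ℕ) [NeZero q]

/-- The series all of whose `j`-fold sections lie in `V`. -/
def attr (V : Submodule K (PowerSeries K)) : ℕ → Submodule K (PowerSeries K)
  | 0 => V
  | j + 1 => ⨅ r : Fin q, (attr V j).comap (cart q r)

lemma mem_attr_succ {V : Submodule K (PowerSeries K)} {j : ℕ} {u : PowerSeries K} :
    u ∈ attr q V (j + 1) ↔ ∀ r < q, cart q r u ∈ attr q V j := by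
  simp only [attr, Submodule.mem_iInf, Submodule.mem_comap]
  exact ⟨fun h r hr => h ⟨r, hr⟩, fun h r => h r r.2⟩

lemma attr_le_succ {V : Submodule K (PowerSeries K)}
    (hV : ∀ u ∈ V, ∀ r < q, cart q r u ∈ V) (j : ℕ) : attr q V j ≤ attr q V (j + 1) := by
  induction j with
  | zero => exact fun u hu => (mem_attr_succ q).2 fun r hr => hV u hu r hr
  | succ j ih => exact fun u hu => (mem_attr_succ q).2 fun r hr => ih ((mem_attr_succ q).1 hu r hr)

lemma attr_mono {V : Submodule K (PowerSeries K)}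
    (hV : ∀ u ∈ V, ∀ r < q, cart q r u ∈ V) : Monotone (attr q V) :=
  monotone_nat_of_le_succ (attr_le_succ q hV)

lemma eq_polynomial_of_mem_attr {V : Submodule K (PowerSeries K)}
    (hV : ∀ u ∈ V, ∃ p : K[X], u = algebraMap K[X] (PowerSeries K) p) (j : ℕ) :
    ∀ u ∈ attr q V j, ∃ p : K[X], u = algebraMap K[X] (PowerSeries K) p := by
  induction j with
  | zero => exact hV
  | succ j ih =>
    intro u hu
    have h : ∀ r : ℕ, ∃ p : K[X], r < q → cart q r u = algebraMap K[X] (PowerSeries K) p := by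
      intro r
      by_cases hr : r < q
      · obtain ⟨p, hp⟩ := ih _ ((mem_attr_succ q).1 hu r hr)
        exact ⟨p, fun _ => hp⟩
      · exact ⟨0, fun h => absurd h hr⟩
    choose p hp using h
    refine ⟨∑ s ∈ Finset.range q, X ^ s * Polynomial.expand K q (p s), ?_⟩
    conv_lhs => rw [← sum_X_pow_mul_sg_cart q u]
    rw [map_sum]
    refine Finset.sum_congr rfl fun s hs => ?_
    rw [hp s (Finset.mem_range.mp hs), sg_algebraMap, map_mul, map_pow]
    simp

/-- A finite-dimensional space of power series that is stable under `z d/dz` consists of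
polynomials. -/
lemma eq_polynomial_of_theta_stable [CharZero K] (V : Submodule K (PowerSeries K))
    [FiniteDimensional K V] (hV : ∀ u ∈ V, theta u ∈ V) :
    ∀ u ∈ V, ∃ p : K[X], u = algebraMap K[X] (PowerSeries K) p := by
  intro u hu
  let T : V →ₗ[K] V := (theta : Derivation K _ _).toLinearMap.restrict hV
  have hT : ∀ (P : K[X]) (v : V) (n : ℕ), PowerSeries.coeff n ((aeval T P v : V) : PowerSeries K) =
      P.eval (n : K) * PowerSeries.coeff n (v : PowerSeries K) := by
    intro P
    induction P using Polynomial.induction_on' with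
    | add a b ha hb => intro v n; simp [ha, hb, add_mul]
    | monomial m a =>
      intro v n
      rw [aeval_monomial, Module.End.mul_apply, Module.algebraMap_end_apply, eval_monomial]
      have : ∀ m, PowerSeries.coeff n (((T ^ m) v : V) : PowerSeries K) =
          (n : K) ^ m * PowerSeries.coeff n (v : PowerSeries K) := by
        intro m
        induction m with
        | zero => simp
        | succ m ih =>
          rw [pow_succ', Module.End.mul_apply]
          have : ((T ((T ^ m) v) : V) : PowerSeries K) = theta (((T ^ m) v : V) : PowerSeries K) := rfl
          rw [this, coeff_theta, ih]
          ring
      simp [this, mul_assoc]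
  set P := minpoly K T
  have hP : P ≠ 0 := minpoly.ne_zero (Algebra.IsIntegral.isIntegral T)
  have h0 : ∀ n : ℕ, P.eval (n : K) * PowerSeries.coeff n u = 0 := by
    intro n
    rw [← hT P ⟨u, hu⟩ n, show aeval T P = 0 from minpoly.aeval K T]
    simp
  have hfin : {n : ℕ | P.eval (n : K) = 0}.Finite := by
    have : (P.rootSet K).Finite := Polynomial.rootSet_finite P K
    refine (this.preimage (f := fun n : ℕ => (n : K)) (Nat.cast_injective.injOn)).subset ?_
    intro n hn
    simp only [Set.mem_preimage, Polynomial.mem_rootSet]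
    exact ⟨hP, by simpa using hn⟩
  obtain ⟨N, hN⟩ := hfin.bddAbove
  refine ⟨PowerSeries.trunc (N + 1) u, ?_⟩
  ext n
  rw [coeff_algebraMap_polynomial, PowerSeries.coeff_trunc]
  split_ifs with h
  · rfl
  · have := h0 n
    rcases mul_eq_zero.1 this with h1 | h1
    · have := hN (show n ∈ {n : ℕ | P.eval (n : K) = 0} from h1)
      omega
    · exact h1

/-- If a `θ`-stable space of series is attracted by the sections to a finite-dimensional stable
space, then it consists of polynomials. -/
lemma eq_polynomial_of_attracted [CharZero K] (R : Set (PowerSeries K))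
    (hRθ : ∀ u ∈ R, theta u ∈ R)
    (V₀ : Submodule K (PowerSeries K)) [FiniteDimensional K V₀]
    (hV₀ : ∀ u ∈ V₀, ∀ r < q, cart q r u ∈ V₀) (hR : ∀ u ∈ R, ∃ j, u ∈ attr q V₀ j) :
    ∀ u ∈ R, ∃ p : K[X], u = algebraMap K[X] (PowerSeries K) p := by
  classical
  let good : ℕ → Prop := fun d => ∃ V : Submodule K (PowerSeries K), FiniteDimensional K V ∧
    Module.finrank K V = d ∧ (∀ u ∈ V, ∀ r < q, cart q r u ∈ V) ∧ ∀ u ∈ R, ∃ j, u ∈ attr q V j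
  have hex : ∃ d, good d := ⟨_, V₀, inferInstance, rfl, hV₀, hR⟩
  obtain ⟨V, hfd, hd, hVΛ, hVR⟩ := Nat.find_spec hex
  have hq0 : (q : K) ≠ 0 := Nat.cast_ne_zero.2 (NeZero.ne q)
  let V' : Submodule K (PowerSeries K) := V ⊓ V.comap (theta : Derivation K _ _).toLinearMap
  have hcomm : ∀ (U : Submodule K (PowerSeries K)) (u : PowerSeries K) (r : ℕ), cart q r u ∈ U →
      cart q r (theta u) ∈ U → theta (cart q r u) ∈ U := by
    intro U u r h1 h2
    rw [cart_theta] at h2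
    have := U.sub_mem h2 (U.smul_mem (r : K) h1)
    rw [add_sub_cancel_right] at this
    have := U.smul_mem ((q : K)⁻¹) this
    rwa [smul_smul, inv_mul_cancel₀ hq0, one_smul] at this
  have hV'Λ : ∀ u ∈ V', ∀ r < q, cart q r u ∈ V' := by
    intro u hu r hr
    exact ⟨hVΛ u hu.1 r hr, hcomm V u r (hVΛ u hu.1 r hr) (hVΛ _ hu.2 r hr)⟩
  have hatt : ∀ j, ∀ u, u ∈ attr q V j → theta u ∈ attr q V j → u ∈ attr q V' j := by
    intro j
    induction j with
    | zero => exact fun u h1 h2 => ⟨h1, h2⟩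
    | succ j ih =>
      intro u h1 h2
      rw [mem_attr_succ] at h1 h2 ⊢
      exact fun r hr => ih _ (h1 r hr) (hcomm _ u r (h1 r hr) (h2 r hr))
  have hle : V' ≤ V := inf_le_left
  have hfd' : FiniteDimensional K V' := Submodule.finiteDimensional_of_le hle
  have hgood : good (Module.finrank K V') := by
    refine ⟨V', hfd', rfl, hV'Λ, fun u hu => ?_⟩
    obtain ⟨j, hj⟩ := hVR u hu
    obtain ⟨i, hi⟩ := hVR _ (hRθ u hu)
    exact ⟨max i j, hatt _ u (attr_mono q hVΛ (le_max_right i j) hj)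
      (attr_mono q hVΛ (le_max_left i j) hi)⟩
  have hmin := Nat.find_min' hex hgood
  have heq : V' = V := Submodule.eq_of_le_of_finrank_le hle (hd.le.trans hmin)
  have hstab : ∀ u ∈ V, theta u ∈ V := fun u hu => by
    rw [← heq] at hu
    exact hu.2
  intro u hu
  obtain ⟨j, hj⟩ := hVR u hu
  exact eq_polynomial_of_mem_attr q (eq_polynomial_of_theta_stable V hstab) j u hj

end Attractor

section Lattice

variable {K : Type*} [Field K] (q : ℕ) [NeZero q]

lemma cart_expand_smul {r : ℕ} (hr : r < q) (p : K[X]) (u : PowerSeries K) :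
    cart q r (Polynomial.expand K q p • u) = p • cart q r u := by
  rw [Algebra.smul_def, ← sg_algebraMap, mul_comm, cart_mul_sg q hr, mul_comm, ← Algebra.smul_def]

lemma cart_X_pow_smul {r : ℕ} (hr : r < q) (n : ℕ) (u : PowerSeries K) :
    cart q r ((X ^ (q * n) : K[X]) • u) = (X ^ n : K[X]) • cart q r u := by
  rw [← cart_expand_smul q hr, map_pow, Polynomial.expand_X, ← pow_mul]

/-- The saturation of a lattice of power series with respect to `z`. -/
def satX (S : Submodule K[X] (PowerSeries K)) : Submodule K[X] (PowerSeries K) where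
  carrier := {u | ∃ n : ℕ, (X ^ n : K[X]) • u ∈ S}
  zero_mem' := ⟨0, by simp⟩
  add_mem' := by
    rintro u v ⟨n, hn⟩ ⟨m, hm⟩
    refine ⟨n + m, ?_⟩
    rw [smul_add]
    refine S.add_mem ?_ ?_
    · rw [pow_add, mul_comm, mul_smul]; exact S.smul_mem _ hn
    · rw [pow_add, mul_smul]; exact S.smul_mem _ hm
  smul_mem' := by
    rintro c u ⟨n, hn⟩
    exact ⟨n, by rw [smul_comm]; exact S.smul_mem _ hn⟩

lemma le_satX (S : Submodule K[X] (PowerSeries K)) : S ≤ satX S := fun u hu => ⟨0, by simpa using hu⟩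

lemma cart_mem_satX {S : Submodule K[X] (PowerSeries K)}
    (hΛ : ∀ u ∈ S, ∀ r < q, (X : K[X]) • cart q r u ∈ S) {u : PowerSeries K} (hu : u ∈ satX S)
    {r : ℕ} (hr : r < q) : cart q r u ∈ satX S := by
  obtain ⟨n, hn⟩ := hu
  have h1 : (X ^ (q * n) : K[X]) • u ∈ S := by
    obtain ⟨c, hc⟩ := Nat.exists_eq_add_of_le (Nat.le_mul_of_pos_left n (NeZero.pos q))
    rw [hc, add_comm, pow_add, mul_smul]
    exact S.smul_mem _ hn
  have h2 := hΛ _ h1 r hr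
  rw [cart_X_pow_smul q hr, ← mul_smul, ← pow_succ'] at h2
  exact ⟨n + 1, h2⟩

lemma theta_X_pow_smul (n : ℕ) (u : PowerSeries K) :
    theta ((X ^ n : K[X]) • u) = (X ^ n : K[X]) • theta u + (n : K) • (X ^ n : K[X]) • u := by
  ext m
  rw [Algebra.smul_def (X ^ n : K[X]) u, Algebra.smul_def (X ^ n : K[X]) (theta u)]
  simp only [coeff_theta, map_add, PowerSeries.coeff_smul, map_pow, algebraMap_X,
    PowerSeries.coeff_X_pow_mul', smul_eq_mul]
  split_ifs with h
  · rw [Nat.cast_sub h]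
    ring
  · simp

lemma theta_mem_satX [CharZero K] (hq : 2 ≤ q) {S : Submodule K[X] (PowerSeries K)}
    (hσ : ∀ u ∈ S, sg q u ∈ S) (hΛ : ∀ u ∈ S, ∀ r < q, (X : K[X]) • cart q r u ∈ S)
    (hθ : ∃ p : K[X], p ≠ 0 ∧ ∀ u ∈ S, p • theta u ∈ S) :
    ∀ u ∈ satX S, theta u ∈ satX S := by
  classical
  have hq0 : (q : K) ≠ 0 := Nat.cast_ne_zero.2 (NeZero.ne q)
  have hσR : ∀ u ∈ satX S, sg q u ∈ satX S := by
    rintro u ⟨n, hn⟩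
    refine ⟨q * n, ?_⟩
    have := hσ _ hn
    rwa [Algebra.smul_def, map_mul, sg_algebraMap, ← Algebra.smul_def, map_pow,
      Polynomial.expand_X, ← pow_mul] at this
  have hex : ∃ d : ℕ, ∃ p : K[X], p ≠ 0 ∧ p.natDegree = d ∧ ∀ u ∈ satX S, p • theta u ∈ satX S := by
    obtain ⟨p, hp0, hp⟩ := hθ
    refine ⟨_, p, hp0, rfl, ?_⟩
    rintro u ⟨n, hn⟩
    have h1 := hp _ hn
    rw [theta_X_pow_smul, smul_add] at h1
    have h2 : p • (n : K) • (X ^ n : K[X]) • u ∈ S :=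
      S.smul_mem _ (S.smul_of_tower_mem _ hn)
    have h3 := S.sub_mem h1 h2
    rw [add_sub_cancel_right, smul_comm] at h3
    exact ⟨n, h3⟩
  obtain ⟨p, hp0, hpd, hp⟩ := Nat.find_spec hex
  choose ps hps hpsd using fun r => exists_cart_algebraMap q r p
  obtain ⟨s, hs, hs0⟩ : ∃ s < q, ps s ≠ 0 := by
    by_contra! hcon
    apply hp0
    have := sum_X_pow_mul_sg_cart q (algebraMap K[X] (PowerSeries K) p)
    rw [Finset.sum_eq_zero] at this
    · ext n
      simpa using (congrArg (PowerSeries.coeff n) this).symm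
    · intro s hs
      rw [hps, hcon s (Finset.mem_range.mp hs)]
      simp
  have hmem : ∀ u ∈ satX S, ps s • theta u ∈ satX S := by
    intro u hu
    have h1 := cart_mem_satX q hΛ (hp _ (hσR u hu)) hs
    rw [theta_sg, smul_comm, map_smul, Algebra.smul_def p, cart_mul_sg q hs, hps,
      ← Algebra.smul_def] at h1
    have := (satX S).smul_of_tower_mem (q : K)⁻¹ h1
    rwa [smul_smul, inv_mul_cancel₀ hq0, one_smul] at this
  have h1 : p.natDegree ≤ (ps s).natDegree := by
    rw [hpd]
    exact Nat.find_min' hex ⟨ps s, hs0, rfl, hmem⟩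
  have h2 := hpsd s
  have h3 : p.natDegree = 0 := by nlinarith
  obtain ⟨c, hc⟩ := Polynomial.natDegree_eq_zero.1 h3
  have hc0 : c ≠ 0 := by
    rintro rfl
    exact hp0 (by rw [← hc, map_zero])
  intro u hu
  have := (satX S).smul_mem (C c⁻¹) (hp u hu)
  rwa [← hc, ← mul_smul, ← C_mul, inv_mul_cancel₀ hc0, C_1, one_smul] at this

/-- The polynomial combinations of `s` with coefficients of degree at most `m`. -/
def degSpan (s : Set (PowerSeries K)) (m : ℕ) : Submodule K (PowerSeries K) :=
  Submodule.span K {v | ∃ i ≤ m, ∃ y ∈ s, v = (X ^ i : K[X]) • y}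

lemma degSpan_mono (s : Set (PowerSeries K)) : Monotone (degSpan s) := fun _ _ h =>
  Submodule.span_mono fun _ ⟨i, hi, y, hy, hv⟩ => ⟨i, hi.trans h, y, hy, hv⟩

lemma degSpan_finite {s : Set (PowerSeries K)} (hs : s.Finite) (m : ℕ) :
    FiniteDimensional K (degSpan s m) := by
  refine FiniteDimensional.span_of_finite K ?_
  refine (((Set.finite_Iic m).prod hs).image fun p => (X ^ p.1 : K[X]) • p.2).subset ?_
  rintro v ⟨i, hi, y, hy, rfl⟩
  exact ⟨(i, y), ⟨hi, hy⟩, rfl⟩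

lemma X_pow_smul_mem_degSpan {s : Set (PowerSeries K)} {m : ℕ} {u : PowerSeries K}
    (hu : u ∈ degSpan s m) (n : ℕ) : (X ^ n : K[X]) • u ∈ degSpan s (n + m) := by
  induction hu using Submodule.span_induction with
  | mem v hv =>
    obtain ⟨i, hi, y, hy, rfl⟩ := hv
    exact Submodule.subset_span ⟨n + i, by omega, y, hy, by rw [pow_add, mul_smul]⟩
  | zero => simp
  | add u v _ _ hu hv => rw [smul_add]; exact add_mem hu hv
  | smul c u _ hu => rw [smul_comm]; exact Submodule.smul_mem _ _ hu

lemma exists_mem_degSpan {s : Set (PowerSeries K)} {u : PowerSeries K}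
    (hu : u ∈ Submodule.span K[X] s) : ∃ m, u ∈ degSpan s m := by
  induction hu using Submodule.span_induction with
  | mem v hv => exact ⟨0, Submodule.subset_span ⟨0, le_rfl, v, hv, by simp⟩⟩
  | zero => exact ⟨0, zero_mem _⟩
  | add u v _ _ hu hv =>
    obtain ⟨m, hm⟩ := hu
    obtain ⟨n, hn⟩ := hv
    exact ⟨max m n, add_mem (degSpan_mono s (le_max_left _ _) hm)
      (degSpan_mono s (le_max_right _ _) hn)⟩
  | smul p u _ hu =>
    obtain ⟨m, hm⟩ := hu
    refine ⟨p.natDegree + m, ?_⟩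
    have hp : p • u = ∑ i ∈ Finset.range (p.natDegree + 1), monomial i (p.coeff i) • u := by
      rw [← Finset.sum_smul, ← p.as_sum_range' (p.natDegree + 1) (Nat.lt_succ_self _)]
    rw [hp]
    refine Submodule.sum_mem _ fun i hi => ?_
    rw [← C_mul_X_pow_eq_monomial, ← smul_eq_C_mul, smul_assoc]
    refine Submodule.smul_mem _ _ (degSpan_mono s ?_ (X_pow_smul_mem_degSpan hm i))
    have := Finset.mem_range.1 hi
    omega

lemma exists_X_smul_cart_mem_degSpan {s : Set (PowerSeries K)} (hs : s.Finite)
    (hΛ : ∀ u ∈ Submodule.span K[X] s, ∀ r < q,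
      (X : K[X]) • cart q r u ∈ Submodule.span K[X] s) :
    ∃ g, ∀ m, ∀ u ∈ degSpan s m, ∀ r < q, (X : K[X]) • cart q r u ∈ degSpan s (g + m / q) := by
  have h1 : ∀ y ∈ s, ∀ j r : ℕ, ∃ m, r < q →
      (X : K[X]) • cart q r ((X ^ j : K[X]) • y) ∈ degSpan s m := fun y hy j r => by
    by_cases hr : r < q
    · obtain ⟨m, hm⟩ := exists_mem_degSpan
        (hΛ _ (Submodule.smul_mem _ (X ^ j : K[X]) (Submodule.subset_span hy)) r hr)
      exact ⟨m, fun _ => hm⟩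
    · exact ⟨0, fun h => absurd h hr⟩
  choose! G hG using h1
  let F : Finset ℕ := ((hs.toFinset ×ˢ (Finset.range q ×ˢ Finset.range q))).image
    fun t => G t.1 t.2.1 t.2.2
  refine ⟨F.sup id, fun m u hu r hr => ?_⟩
  induction hu using Submodule.span_induction with
  | mem v hv =>
    obtain ⟨i, hi, y, hy, rfl⟩ := hv
    have hj : i % q < q := Nat.mod_lt _ (NeZero.pos q)
    have h2 : G y (i % q) r ≤ F.sup id := Finset.le_sup (f := id) (by
      refine Finset.mem_image.2 ⟨(y, i % q, r), ?_, rfl⟩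
      simp [hy, hj, hr])
    have h3 := X_pow_smul_mem_degSpan (hG y hy (i % q) r hr) (i / q)
    rw [smul_comm, ← cart_X_pow_smul q hr, ← mul_smul, ← pow_add, Nat.div_add_mod] at h3
    refine degSpan_mono s ?_ h3
    have := Nat.div_le_div_right (c := q) hi
    omega
  | zero => simp
  | add u v _ _ hu hv => rw [map_add, smul_add]; exact add_mem hu hv
  | smul c u _ hu => rw [map_smul, smul_comm]; exact Submodule.smul_mem _ _ hu

/-- A finitely generated lattice of power series which is stable under the Mahler operator, under
the sections up to a factor `z`, and under `z d/dz` up to a denominator, consists of polynomials. -/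
theorem eq_polynomial_of_lattice [CharZero K] (hq : 2 ≤ q) (S : Submodule K[X] (PowerSeries K))
    (hS : S.FG) (hσ : ∀ u ∈ S, sg q u ∈ S)
    (hΛ : ∀ u ∈ S, ∀ r < q, (X : K[X]) • cart q r u ∈ S)
    (hθ : ∃ p : K[X], p ≠ 0 ∧ ∀ u ∈ S, p • theta u ∈ S) :
    ∀ u ∈ S, ∃ p : K[X], u = algebraMap K[X] (PowerSeries K) p := by
  obtain ⟨t, rfl⟩ := hS
  set s : Set (PowerSeries K) := ↑t
  have hs : s.Finite := t.finite_toSet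
  obtain ⟨g, hg⟩ := exists_X_smul_cart_mem_degSpan q hs hΛ
  let mulX : ℕ → PowerSeries K →ₗ[K] PowerSeries K := fun N =>
    (LinearMap.lsmul K[X] (PowerSeries K) (X ^ N)).restrictScalars K
  have hinj : ∀ N, Function.Injective (mulX N) := fun N u v h => by
    have h' : (X ^ N : K[X]) • u = (X ^ N : K[X]) • v := h
    rw [Algebra.smul_def, Algebra.smul_def, map_pow, algebraMap_X] at h'
    exact mul_left_cancel₀ (pow_ne_zero _ PowerSeries.X_ne_zero) h'
  let V : ℕ → Submodule K (PowerSeries K) := fun N => (degSpan s (2 * N)).comap (mulX N)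
  have hVmem : ∀ N u, u ∈ V N ↔ (X ^ N : K[X]) • u ∈ degSpan s (2 * N) := fun _ _ => Iff.rfl
  have hVmono : Monotone V := monotone_nat_of_le_succ fun N u hu => by
    rw [hVmem] at hu ⊢
    have := X_pow_smul_mem_degSpan hu 1
    rw [← mul_smul, ← pow_add, add_comm 1 N] at this
    exact degSpan_mono s (by omega) this
  have hVfin : ∀ N, FiniteDimensional K (V N) := fun N => by
    have := degSpan_finite hs (2 * N)
    exact FiniteDimensional.of_injective ((mulX N).restrict (p := V N) (q := degSpan s (2 * N))
      fun u hu => hu) fun u v h => Subtype.ext (hinj N (congrArg Subtype.val h))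
  have hcart : ∀ N, ∀ u ∈ V N, ∀ r < q, cart q r u ∈ V (g + 2 + N / q) := by
    intro N u hu r hr
    rw [hVmem] at hu ⊢
    set c := N / q + 1 with hc
    have hqc : N ≤ q * c := by
      have h1 := Nat.div_add_mod N q
      have h2 := Nat.mod_lt N (NeZero.pos q)
      rw [hc, mul_add]
      omega
    have h1 := X_pow_smul_mem_degSpan hu (q * c - N)
    rw [← mul_smul, ← pow_add, Nat.sub_add_cancel hqc] at h1
    have h2 := hg _ _ h1 r hr
    rw [cart_X_pow_smul q hr, ← mul_smul, ← pow_succ'] at h2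
    have h3 := X_pow_smul_mem_degSpan h2 g
    rw [← mul_smul, ← pow_add] at h3
    have h4 : (q * c - N + 2 * N) / q = N / q + c := by
      rw [show q * c - N + 2 * N = N + q * c by omega, Nat.add_mul_div_left _ _ (NeZero.pos q)]
    rw [h4] at h3
    rw [show g + 2 + N / q = g + (c + 1) by omega]
    exact degSpan_mono s (by omega) h3
  have hdiv : ∀ N, N / q ≤ N / 2 := fun N => Nat.div_le_div_left hq (by norm_num)
  have hattr : ∀ N, ∃ j, V N ≤ attr q (V (2 * g + 4)) j := by
    intro N
    induction N using Nat.strong_induction_on with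
    | _ N ih =>
      by_cases hN : N ≤ 2 * g + 4
      · exact ⟨0, hVmono hN⟩
      · obtain ⟨j, hj⟩ := ih (g + 2 + N / q) (by have := hdiv N; omega)
        exact ⟨j + 1, fun u hu => (mem_attr_succ q).2 fun r hr => hj (hcart N u hu r hr)⟩
  have := hVfin (2 * g + 4)
  intro u hu
  refine eq_polynomial_of_attracted q (satX (Submodule.span K[X] s) : Set (PowerSeries K))
    (theta_mem_satX q hq hσ hΛ hθ) (V (2 * g + 4)) ?_ ?_ u (le_satX _ hu)
  · intro u hu r hr
    refine hVmono ?_ (hcart _ u hu r hr)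
    have := hdiv (2 * g + 4)
    omega
  · rintro u ⟨n, hn⟩
    obtain ⟨m, hm⟩ := exists_mem_degSpan hn
    obtain ⟨j, hj⟩ := hattr (max n m)
    refine ⟨j, hj ((hVmem _ _).2 ?_)⟩
    have := X_pow_smul_mem_degSpan hm (max n m - n)
    rw [← mul_smul, ← pow_add, Nat.sub_add_cancel (le_max_left _ _)] at this
    exact degSpan_mono s (by omega) this

end Lattice

section Regular

variable {k E : Type*} [Field k] [Field E] [Algebra k E]

/-- `k` is algebraically closed in `E`. -/
def RelClosed (k E : Type*) [Field k] [Field E] [Algebra k E] : Prop :=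
  ∀ x : E, IsAlgebraic k x → x ∈ (algebraMap k E).range

lemma RelClosed.natDegree_minpoly (hE : RelClosed k E) {Ω : Type*} [Field Ω] [Algebra k Ω]
    [Algebra E Ω] [IsScalarTower k E Ω] {x : Ω} (hx : IsIntegral k x) :
    (minpoly E x).natDegree = (minpoly k x).natDegree := by
  have hxE : IsIntegral E x := hx.tower_top
  have h1 := integralClosure.mem_lifts_of_monic_of_dvd_map E (minpoly.monic hx)
    (minpoly.monic hxE) (minpoly.dvd_map_of_isScalarTower k E x)
  have h2 : minpoly E x ∈ Polynomial.lifts (algebraMap k E) := by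
    rw [Polynomial.lifts_iff_coeff_lifts] at h1 ⊢
    intro n
    obtain ⟨y, hy⟩ := h1 n
    have hy' : IsIntegral k (algebraMap (integralClosure k E) E y) := y.2
    obtain ⟨z, hz⟩ := hE _ hy'.isAlgebraic
    exact ⟨z, by rw [hz, hy]⟩
  obtain ⟨p, hp, hpd, hpm⟩ := Polynomial.lifts_and_natDegree_eq_and_monic h2 (minpoly.monic hxE)
  apply le_antisymm
  · have := Polynomial.natDegree_le_of_dvd (minpoly.dvd_map_of_isScalarTower k E x)
      ((minpoly.monic hx).map _).ne_zero
    rwa [Polynomial.natDegree_map] at this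
  · rw [← hpd]
    refine Polynomial.natDegree_le_of_dvd (minpoly.dvd k x ?_) hpm.ne_zero
    rw [← Polynomial.aeval_map_algebraMap E, hp, minpoly.aeval]

lemma RelClosed.isDomain_tensor_of_finite [CharZero k] (hE : RelClosed k E) (κ : Type*) [Field κ]
    [Algebra k κ] [FiniteDimensional k κ] : IsDomain (E ⊗[k] κ) := by
  let pb := Field.powerBasisOfFiniteOfSeparable k κ
  let fb : κ →ₐ[k] AlgebraicClosure E := IsAlgClosed.lift
  let f : E ⊗[k] κ →ₐ[E] AlgebraicClosure E := Algebra.TensorProduct.lift (Algebra.ofId _ _) fb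
    fun _ _ => Commute.all _ _
  let b := Algebra.TensorProduct.basis E pb.basis
  have hinteg : IsIntegral k (fb pb.gen) := (pb.isIntegral_gen).map fb
  have hdeg : (minpoly E (fb pb.gen)).natDegree = pb.dim := by
    rw [hE.natDegree_minpoly hinteg, minpoly.algHom_eq fb fb.injective, pb.natDegree_minpoly]
  have hli : LinearIndependent E (f ∘ b) := by
    have := linearIndependent_pow (K := E) (fb pb.gen)
    rw [hdeg] at this
    convert this using 1
    ext i
    simp [f, b]
  have hinj : Function.Injective f := by
    rw [injective_iff_map_eq_zero]
    intro x hx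
    rw [← b.sum_repr x, map_sum] at hx
    simp only [map_smul] at hx
    have := Fintype.linearIndependent_iff.1 hli _ hx
    rw [← b.sum_repr x]
    exact Finset.sum_eq_zero fun i _ => by rw [this i, zero_smul]
  exact hinj.isDomain f.toRingHom

theorem RelClosed.isDomain_tensor [CharZero k] (hE : RelClosed k E) (L : Type*) [Field L]
    [Algebra k L] : IsDomain (L ⊗[k] E) := by
  classical
  let b := Module.Basis.ofVectorSpace k E
  have : NoZeroDivisors (L ⊗[k] E) := by
    refine ⟨fun {x y} hxy => ?_⟩
    by_contra! hcon
    obtain ⟨hx, hy⟩ := hcon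
    let B := Algebra.TensorProduct.basis L b
    let T : Finset L := (B.repr x).support.image (B.repr x) ∪ (B.repr y).support.image (B.repr y)
    let A := Algebra.adjoin k (T : Set L)
    have hA : Algebra.FiniteType k A := Subalgebra.fg_iff_finiteType _ |>.1
      (Subalgebra.fg_adjoin_finset T)
    let BA := Algebra.TensorProduct.basis A b
    let j : A ⊗[k] E →ₐ[k] L ⊗[k] E := Algebra.TensorProduct.map A.val (AlgHom.id k E)
    have hj : Function.Injective j :=
      Module.Flat.rTensor_preserves_injective_linearMap (M := E) A.val.toLinearMap
        Subtype.val_injective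
    have hlift : ∀ z : L ⊗[k] E, (∀ i, B.repr z i ∈ A) → ∃ z' : A ⊗[k] E, j z' = z := by
      intro z hz
      refine ⟨∑ i ∈ (B.repr z).support, (⟨B.repr z i, hz i⟩ : A) ⊗ₜ[k] b i, ?_⟩
      rw [map_sum]
      conv_rhs => rw [← B.linearCombination_repr z, Finsupp.linearCombination_apply, Finsupp.sum]
      refine Finset.sum_congr rfl fun i _ => ?_
      rw [Algebra.TensorProduct.basis_repr_symm_apply']
      simp [j]
    have hmem : ∀ z ∈ ({x, y} : Set (L ⊗[k] E)), ∀ i, B.repr z i ∈ A := by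
      intro z hz i
      by_cases h0 : B.repr z i = 0
      · rw [h0]; exact zero_mem _
      · refine Algebra.subset_adjoin ?_
        simp only [T, Finset.coe_union, Finset.coe_image]
        rcases hz with rfl | rfl
        · exact Or.inl ⟨i, by simpa using h0, rfl⟩
        · exact Or.inr ⟨i, by simpa using h0, rfl⟩
    obtain ⟨x', hx'⟩ := hlift x (hmem x (by simp))
    obtain ⟨y', hy'⟩ := hlift y (hmem y (by simp))
    have hxy' : x' * y' = 0 := hj (by rw [map_mul, hx', hy', hxy, map_zero])
    have hx0 : x' ≠ 0 := by rintro rfl; exact hx (by rw [← hx', map_zero])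
    have hy0 : y' ≠ 0 := by rintro rfl; exact hy (by rw [← hy', map_zero])
    obtain ⟨i, hi⟩ : ∃ i, BA.repr x' i ≠ 0 := by
      by_contra! h
      exact hx0 (BA.ext_elem fun i => by simp [h i])
    obtain ⟨l, hl⟩ : ∃ i, BA.repr y' i ≠ 0 := by
      by_contra! h
      exact hy0 (BA.ext_elem fun i => by simp [h i])
    have hjac : (⊥ : Ideal A).jacobson = ⊥ := by
      have hJ : IsJacobsonRing A := isJacobsonRing_of_finiteType (A := k)
      exact hJ.out (Ideal.isPrime_bot.isRadical)
    have hprod : BA.repr x' i * BA.repr y' l ∈ (⊥ : Ideal A).jacobson := by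
      rw [Ideal.mem_jacobson_bot, ← Ideal.mem_jacobson_bot, Ideal.jacobson, Ideal.mem_sInf]
      rintro m ⟨-, hm⟩
      let κ := A ⧸ m
      let : Field κ := Ideal.Quotient.field m
      have hfin : FiniteDimensional k κ := by
        have : Algebra.FiniteType k κ := .of_surjective (Ideal.Quotient.mkₐ k m)
          (Ideal.Quotient.mkₐ_surjective k m)
        exact finite_of_finite_type_of_isJacobsonRing k κ
      let Bκ := Algebra.TensorProduct.basis κ b
      let red : A ⊗[k] E →ₐ[k] κ ⊗[k] E :=
        Algebra.TensorProduct.map (Ideal.Quotient.mkₐ k m) (AlgHom.id k E)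
      have hred : ∀ z s, Bκ.repr (red z) s = Ideal.Quotient.mk m (BA.repr z s) := by
        intro z s
        induction z using TensorProduct.induction_on with
        | zero => simp
        | tmul a e =>
          simp only [red, Bκ, BA, Algebra.TensorProduct.map_tmul, Algebra.TensorProduct.basis_repr_tmul,
            Finsupp.smul_apply, Finsupp.mapRange_apply, smul_eq_mul, map_mul]
          rfl
        | add z w hz hw => simp [hz, hw]
      have hdom : IsDomain (κ ⊗[k] E) :=
        have := hE.isDomain_tensor_of_finite κ
        (Algebra.TensorProduct.comm k κ E).toMulEquiv.isDomain
      have h0 : red x' * red y' = 0 := by rw [← map_mul, hxy', map_zero]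
      rcases mul_eq_zero.1 h0 with h | h
      · refine m.mul_mem_right _ ?_
        rw [← Ideal.Quotient.eq_zero_iff_mem, ← hred, h]
        simp
      · refine m.mul_mem_left _ ?_
        rw [← Ideal.Quotient.eq_zero_iff_mem, ← hred, h]
        simp
    rw [hjac, Ideal.mem_bot] at hprod
    exact (mul_ne_zero hi hl) hprod
  have : Nontrivial (L ⊗[k] E) := inferInstance
  exact NoZeroDivisors.to_isDomain _

end Regular

section AlgClosureFinite

variable {k E : Type*} [Field k] [Field E] [Algebra k E]

lemma linearIndependent_adjoin_of_algebraicClosure {ι σ : Type*} {x : σ → E}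
    (hx : AlgebraicIndependent k x) {b : ι → algebraicClosure k E} (hb : LinearIndependent k b) :
    LinearIndependent (Algebra.adjoin k (Set.range x)) (fun i => (b i : E)) := by
  rw [linearIndependent_iff']
  intro s g hg i hi
  let p : ι → MvPolynomial σ k := fun i => hx.aevalEquiv.symm (g i)
  have hp : ∀ i, MvPolynomial.aeval x (p i) = (g i : E) := fun i => by
    rw [← hx.algebraMap_aevalEquiv, AlgEquiv.apply_symm_apply]
    rfl
  let P : MvPolynomial σ (algebraicClosure k E) :=
    ∑ i ∈ s, MvPolynomial.C (b i) * MvPolynomial.map (algebraMap k _) (p i)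
  have hP : P = 0 := by
    apply hx.algebraicClosure
    rw [map_zero, ← hg, map_sum]
    refine Finset.sum_congr rfl fun i _ => ?_
    rw [map_mul, MvPolynomial.aeval_C, MvPolynomial.aeval_map_algebraMap, hp, mul_comm,
      Subalgebra.smul_def, smul_eq_mul]
    rfl
  have hpi : p i = 0 := by
    ext m
    have h1 : ∑ i ∈ s, (p i).coeff m • b i = 0 := by
      have := congrArg (MvPolynomial.coeff m) hP
      rw [MvPolynomial.coeff_sum, MvPolynomial.coeff_zero] at this
      rw [← this]
      refine Finset.sum_congr rfl fun i _ => ?_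
      rw [MvPolynomial.coeff_C_mul, MvPolynomial.coeff_map, Algebra.smul_def, mul_comm]
    simpa using linearIndependent_iff'.1 hb s _ h1 i hi
  have : g i = hx.aevalEquiv (p i) := by simp [p]
  rw [this, hpi, map_zero]

open scoped IntermediateField.algebraAdjoinAdjoin in
lemma finiteDimensional_algebraicClosure {s : Set E} (hs : s.Finite)
    (htop : IntermediateField.adjoin k s = ⊤) : FiniteDimensional k (algebraicClosure k E) := by
  have hfr : Algebra.IsAlgebraic (Algebra.adjoin k s) E := by
    have h2 : Algebra.IsAlgebraic (IntermediateField.adjoin k s) E := by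
      rw [htop]
      refine ⟨fun y => isAlgebraic_algebraMap (⟨y, trivial⟩ : (⊤ : IntermediateField k E))⟩
    exact (IsFractionRing.comap_isAlgebraic_iff (A := Algebra.adjoin k s)
      (K := IntermediateField.adjoin k s) (C := E)).2 h2
  obtain ⟨t, hts, ht⟩ := exists_isTranscendenceBasis_subset (R := k) s
  let F := IntermediateField.adjoin k t
  have hfin : FiniteDimensional F E := by
    have halg : Algebra.IsAlgebraic F E := by
      have := ht.isAlgebraic_field
      rwa [Subtype.range_coe] at this
    have h1 : IntermediateField.adjoin F s = ⊤ := by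
      rw [eq_top_iff]
      intro y _
      have hy : y ∈ IntermediateField.adjoin k s := by rw [htop]; trivial
      have hle : IntermediateField.adjoin k s ≤
          (IntermediateField.adjoin F s).restrictScalars k :=
        IntermediateField.adjoin_le_iff.2 (IntermediateField.subset_adjoin F s)
      exact hle hy
    have h2 : FiniteDimensional F (IntermediateField.adjoin F s) := by
      have := hs.to_subtype
      exact IntermediateField.finiteDimensional_adjoin fun y _ => (halg.isAlgebraic y).isIntegral
    rw [h1] at h2
    exact Module.Finite.equiv (IntermediateField.topEquiv (F := F) (E := E)).toLinearEquiv
  let b := Module.Basis.ofVectorSpace k (algebraicClosure k E)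
  have hli := linearIndependent_adjoin_of_algebraicClosure ht.1 b.linearIndependent
  rw [Subtype.range_coe] at hli
  have hliF : LinearIndependent F (fun i => (b i : E)) :=
    (LinearIndependent.iff_fractionRing (Algebra.adjoin k t) F).1 hli
  have := hliF.finite
  exact Module.Finite.of_basis b

end AlgClosureFinite

section Integrality

variable {K : Type*} [Field K] (q : ℕ) [NeZero q]

lemma isIntegralElem_comp {R A B : Type*} [CommRing R] [CommRing A] [CommRing B] {e : R →+* A}
    {f : A →+* B} (he : e.IsIntegral) {x : B} (hx : f.IsIntegralElem x) :
    (f.comp e).IsIntegralElem x := by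
  let := e.toAlgebra
  let := f.toAlgebra
  let := (f.comp e).toAlgebra
  have : IsScalarTower R A B := .of_algebraMap_eq fun _ => rfl
  have : Algebra.IsIntegral R A := ⟨he⟩
  exact isIntegral_trans (R := R) (A := A) x hx

lemma expand_isIntegral : (Polynomial.expand K q : K[X] →+* K[X]).IsIntegral := by
  intro p
  induction p using Polynomial.induction_on' with
  | add p r hp hr => exact hp.add _ hr
  | monomial n a =>
    rw [← C_mul_X_pow_eq_monomial]
    have hX : (Polynomial.expand K q : K[X] →+* K[X]).IsIntegralElem X := by
      refine ⟨X ^ q - C X, monic_X_pow_sub_C _ (NeZero.ne q), ?_⟩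
      simp
    have hXn : (Polynomial.expand K q : K[X] →+* K[X]).IsIntegralElem (X ^ n) := by
      induction n with
      | zero => simpa using RingHom.isIntegralElem_map (Polynomial.expand K q : K[X] →+* K[X]) (x := 1)
      | succ n ih => rw [pow_succ]; exact ih.mul _ hX
    have hC : (Polynomial.expand K q : K[X] →+* K[X]).IsIntegralElem (C a) := by
      simpa using RingHom.isIntegralElem_map (Polynomial.expand K q : K[X] →+* K[X]) (x := C a)
    exact hC.mul _ hXn

lemma exists_dvd_expand {D : K[X]} (hD : D ≠ 0) : ∃ D' : K[X], D' ≠ 0 ∧ D ∣ expand K q D' := by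
  let e : K[X] →+* K[X] := Polynomial.expand K q
  have hi := expand_isIntegral (K := K) q
  have key : ∀ {R A : Type _} [CommRing R] [Nontrivial R] [CommRing A] [IsDomain A] (e : R →+* A)
      (_ : e.IsIntegral) (x : A), x ≠ 0 → ∃ r, r ≠ 0 ∧ x ∣ e r := by
    intro R A _ _ _ _ e he x hx
    let := e.toAlgebra
    have : Algebra.IsIntegral R A := ⟨he⟩
    exact (Algebra.IsIntegral.isIntegral (R := R) x).isAlgebraic.exists_nonzero_dvd
      (mem_nonZeroDivisors_of_ne_zero hx)
  exact key e hi D hD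

lemma isIntegral_of_sg {v : PowerSeries K} (h : IsIntegral K[X] (sg q v)) : IsIntegral K[X] v := by
  obtain ⟨P, hP, hP0⟩ := isIntegralElem_comp (expand_isIntegral (K := K) q) h
  refine ⟨P, hP, sg_injective q ?_⟩
  rw [map_zero, Polynomial.hom_eval₂, ← hP0]
  congr 1
  exact RingHom.ext fun p => sg_algebraMap q p

lemma isIntegral_sg {v : PowerSeries K} (h : IsIntegral K[X] v) : IsIntegral K[X] (sg q v) := by
  refine h.map_of_comp_eq (expand K q : K[X] →+* K[X]) (sg q) ?_
  exact RingHom.ext fun p => (sg_algebraMap q p).symm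

lemma isIntegral_rescale {v : PowerSeries K} (c : K) (h : IsIntegral K[X] v) :
    IsIntegral K[X] (PowerSeries.rescale c v) := by
  refine h.map_of_comp_eq (Polynomial.compRingHom (C c * X)) (PowerSeries.rescale c) ?_
  refine Polynomial.ringHom_ext (fun a => ?_) ?_
  · ext n
    cases n <;> simp [Polynomial.coeff_C]
  · ext n
    simp [algebraMap_eq_coe, PowerSeries.coeff_X, Polynomial.coe_C]

lemma sum_rescale_eq {ζ : K} (hζ : IsPrimitiveRoot ζ q) (u : PowerSeries K) {r : ℕ} (hr : r < q) :
    ∑ s ∈ Finset.range q, ζ ^ (s * (q - r)) • PowerSeries.rescale (ζ ^ s) u =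
      (q : K) • (PowerSeries.X ^ r * sg q (cart q r u)) := by
  ext n
  obtain ⟨a, t, ht, rfl⟩ : ∃ a t, t < q ∧ n = q * a + t :=
    ⟨n / q, n % q, Nat.mod_lt _ (NeZero.pos q), (Nat.div_add_mod n q).symm⟩
  rw [PowerSeries.coeff_smul, coeff_X_pow_mul_sg q ht hr, map_sum]
  simp only [PowerSeries.coeff_smul, PowerSeries.coeff_rescale, smul_eq_mul, coeff_cart]
  have h1 : ∀ s, ζ ^ (s * (q - r)) * ((ζ ^ s) ^ (q * a + t) * PowerSeries.coeff (q * a + t) u) =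
      (ζ ^ (q - r + t)) ^ s * PowerSeries.coeff (q * a + t) u := by
    intro s
    rw [← mul_assoc, ← pow_mul, ← pow_add, ← pow_mul]
    congr 1
    rw [show s * (q - r) + s * (q * a + t) = q * (s * a) + (q - r + t) * s by ring, pow_add, pow_mul,
      hζ.pow_eq_one, one_pow, one_mul]
  simp only [h1, ← Finset.sum_mul]
  split_ifs with h
  · subst h
    rw [Nat.sub_add_cancel hr.le, hζ.pow_eq_one]
    simp
  · rw [mul_zero]
    have hne : ζ ^ (q - r + t) ≠ 1 := by
      rw [Ne, hζ.pow_eq_one_iff_dvd]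
      rintro ⟨c, hc⟩
      have : c = 1 := by
        rcases c with _ | _ | c
        · omega
        · rfl
        · have : q * 2 ≤ q * (c + 1 + 1) := Nat.mul_le_mul_left _ (by omega)
          omega
      subst this
      omega
    have := mul_neg_geom_sum (ζ ^ (q - r + t)) q
    rw [← pow_mul, mul_comm _ q, pow_mul, hζ.pow_eq_one, one_pow, sub_self] at this
    rw [(mul_eq_zero.1 this).resolve_left (sub_ne_zero.2 (Ne.symm hne)), zero_mul]

lemma isIntegral_X_smul_cart [CharZero K] {ζ : K} (hζ : IsPrimitiveRoot ζ q) {u : PowerSeries K}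
    (hu : IsIntegral K[X] u) {r : ℕ} (hr : r < q) :
    IsIntegral K[X] ((X : K[X]) • cart q r u) := by
  have hq0 : (q : K) ≠ 0 := Nat.cast_ne_zero.2 (NeZero.ne q)
  apply isIntegral_of_sg q
  have h1 : IsIntegral K[X] ((q : K) • (PowerSeries.X ^ r * sg q (cart q r u))) := by
    rw [← sum_rescale_eq q hζ u hr]
    exact IsIntegral.sum _ fun s _ => (isIntegral_rescale _ hu).smul _
  have h2 := h1.smul ((C (q : K)⁻¹ * X ^ (q - r)) : K[X])
  convert h2 using 1
  rw [Algebra.smul_def, Algebra.smul_def, map_mul, map_mul, sg_algebraMap, expand_X, map_pow,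
    map_pow, algebraMap_X, PowerSeries.smul_eq_C_mul]
  have h3 : algebraMap K[X] (PowerSeries K) (C (q : K)⁻¹) * PowerSeries.C (q : K) = 1 := by
    rw [algebraMap_eq_coe, Polynomial.coe_C, ← map_mul, inv_mul_cancel₀ hq0, map_one]
  calc _ = 1 * (PowerSeries.X ^ (q - r) * PowerSeries.X ^ r) * sg q (cart q r u) := by
        rw [← pow_add, Nat.sub_add_cancel hr.le, one_mul]
    _ = _ := by rw [← h3]; ring

lemma sg_linearIndependent {ι : Type*} {y : ι → PowerSeries K} (hy : LinearIndependent K[X] y) :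
    LinearIndependent K[X] (fun i => sg q (y i)) := by
  rw [linearIndependent_iff'] at hy ⊢
  intro s p hp i hi
  have h1 : ∀ r < q, cart q r (algebraMap K[X] (PowerSeries K) (p i)) = 0 := by
    intro r hr
    choose p' hp' _ using fun i => exists_cart_algebraMap q r (p i)
    have := congrArg (cart q r) hp
    rw [map_sum, map_zero] at this
    have h2 := hy s p' (by
      rw [← this]
      refine Finset.sum_congr rfl fun j _ => ?_
      rw [Algebra.smul_def, Algebra.smul_def, cart_mul_sg q hr, hp']) i hi
    rw [hp', h2, map_zero]
  have h2 := sum_X_pow_mul_sg_cart q (algebraMap K[X] (PowerSeries K) (p i))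
  rw [Finset.sum_eq_zero fun r hr => by rw [h1 r (Finset.mem_range.1 hr), map_zero, mul_zero]] at h2
  ext n
  simpa using (congrArg (PowerSeries.coeff n) h2).symm

end Integrality

section AlgebraicSeries

variable {K : Type*} [Field K] (q : ℕ) [NeZero q]
variable {k 𝕃 : Type*} [Field k] [Algebra K[X] k] [IsFractionRing K[X] k]
  [Field 𝕃] [Algebra (PowerSeries K) 𝕃] [IsFractionRing (PowerSeries K) 𝕃] [Algebra k 𝕃]
  [Algebra K[X] 𝕃] [IsScalarTower K[X] k 𝕃] [IsScalarTower K[X] (PowerSeries K) 𝕃]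

lemma algebraMap_series_injective : Function.Injective (algebraMap (PowerSeries K) 𝕃) :=
  IsFractionRing.injective _ _

lemma isIntegral_algebraMap_series {u : PowerSeries K} :
    IsIntegral K[X] (algebraMap (PowerSeries K) 𝕃 u) ↔ IsIntegral K[X] u :=
  isIntegral_algebraMap_iff algebraMap_series_injective

lemma exists_smul_eq_algebraMap {x : 𝕃} (hx : IsAlgebraic K[X] x) :
    ∃ d : K[X], d ≠ 0 ∧ ∃ u : PowerSeries K, IsIntegral K[X] u ∧
      d • x = algebraMap (PowerSeries K) 𝕃 u := by
  obtain ⟨d, hd, hi⟩ := hx.exists_integral_multiple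
  have h1 : IsIntegral (PowerSeries K) (d • x) := hi.tower_top
  obtain ⟨u, hu⟩ := IsIntegrallyClosed.isIntegral_iff.1 h1
  refine ⟨d, hd, u, ?_, hu.symm⟩
  rwa [← hu, isIntegral_algebraMap_series] at hi

lemma algebraMap_smul_series (d : K[X]) (u : PowerSeries K) :
    algebraMap (PowerSeries K) 𝕃 (d • u) = d • algebraMap (PowerSeries K) 𝕃 u := by
  rw [Algebra.smul_def, Algebra.smul_def, map_mul, ← IsScalarTower.algebraMap_apply]

/-- The series integral over `K[X]` which lie in an intermediate field. -/
def integralSeries (E : IntermediateField k 𝕃) : Submodule K[X] (PowerSeries K) where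
  carrier := {u | IsIntegral K[X] u ∧ algebraMap (PowerSeries K) 𝕃 u ∈ E}
  zero_mem' := ⟨isIntegral_zero, by rw [map_zero]; exact E.zero_mem⟩
  add_mem' ha hb := ⟨ha.1.add hb.1, by rw [map_add]; exact E.add_mem ha.2 hb.2⟩
  smul_mem' c x hx := ⟨hx.1.smul c, by
    rw [algebraMap_smul_series c x, ← algebraMap_smul k]
    exact E.smul_mem hx.2⟩

variable (E : IntermediateField k 𝕃) [FiniteDimensional k E]

lemma isAlgebraic_of_mem {x : 𝕃} (hx : x ∈ E) : IsAlgebraic K[X] x := by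
  rw [IsFractionRing.isAlgebraic_iff K[X] k 𝕃]
  exact (Algebra.IsAlgebraic.isAlgebraic (R := k) (⟨x, hx⟩ : E)).algebraMap (A := 𝕃)

lemma smul_mem_of_mem {x : 𝕃} (hx : x ∈ E) (d : K[X]) : d • x ∈ E := by
  rw [← algebraMap_smul k]; exact E.smul_mem hx

lemma mem_of_smul_mem {x : 𝕃} {d : K[X]} (hd : d ≠ 0) (hx : d • x ∈ E) : x ∈ E := by
  have : (algebraMap K[X] k d)⁻¹ • d • x = x := by
    rw [← algebraMap_smul k d x, inv_smul_smul₀]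
    exact (map_ne_zero_iff _ (IsFractionRing.injective K[X] k)).2 hd
  rw [← this]
  exact E.smul_mem hx

lemma exists_smul_mem_integralSeries {x : 𝕃} (hx : x ∈ E) :
    ∃ d : K[X], d ≠ 0 ∧ ∃ u ∈ integralSeries E, d • x = algebraMap (PowerSeries K) 𝕃 u := by
  obtain ⟨d, hd, u, hu, h⟩ := exists_smul_eq_algebraMap (K := K) (isAlgebraic_of_mem E hx)
  exact ⟨d, hd, u, ⟨hu, h ▸ smul_mem_of_mem E hx d⟩, h⟩

lemma exists_smul_mem_integralSeries' {v : PowerSeries K}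
    (hv : algebraMap (PowerSeries K) 𝕃 v ∈ E) :
    ∃ d : K[X], d ≠ 0 ∧ d • v ∈ integralSeries E := by
  obtain ⟨d, hd, u, hu, h⟩ := exists_smul_mem_integralSeries (K := K) E hv
  rw [← algebraMap_smul_series d v] at h
  exact ⟨d, hd, (algebraMap_series_injective h) ▸ hu⟩

lemma integralSeries_fg [CharZero K] : (integralSeries (K := K) E).FG := by
  have : CharZero k := charZero_of_injective_algebraMap (IsFractionRing.injective K[X] k)
  have hN : IsNoetherian K[X] (integralClosure K[X] E) :=
    IsIntegralClosure.isNoetherian K[X] k E (integralClosure K[X] E)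
  have : IsScalarTower K[X] E 𝕃 := ⟨fun a e x => smul_assoc a (e : 𝕃) x⟩
  let f : integralSeries (K := K) E →ₗ[K[X]] integralClosure K[X] E :=
    { toFun := fun u => ⟨⟨algebraMap (PowerSeries K) 𝕃 u, u.2.2⟩, by
        rw [mem_integralClosure_iff,
          ← isIntegral_algebraMap_iff (B := 𝕃) (algebraMap E 𝕃).injective]
        exact isIntegral_algebraMap_series.2 u.2.1⟩
      map_add' := fun u v => Subtype.ext (Subtype.ext (map_add _ _ _))
      map_smul' := fun c u => Subtype.ext (Subtype.ext (algebraMap_smul_series c (u : PowerSeries K))) }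
  have hf : Function.Injective f := fun u v h =>
    Subtype.ext (algebraMap_series_injective (𝕃 := 𝕃) 
      (congrArg Subtype.val (congrArg Subtype.val h)))
  have : IsNoetherian K[X] (integralSeries (K := K) E) := isNoetherian_of_injective f hf
  exact Module.Finite.iff_fg.1 inferInstance

lemma exists_smul_eq_sum {n : ℕ} (hn : Module.finrank k E = n) {y : Fin n → PowerSeries K}
    (hy : ∀ i, y i ∈ integralSeries E) (hli : LinearIndependent K[X] y) {u : PowerSeries K}
    (hu : u ∈ integralSeries E) :
    ∃ D : K[X], D ≠ 0 ∧ ∃ p : Fin n → K[X], D • u = ∑ i, p i • y i := by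
  let z : Fin n → E := fun i => ⟨algebraMap (PowerSeries K) 𝕃 (y i), (hy i).2⟩
  have hz : LinearIndependent k z := by
    rw [← LinearIndependent.iff_fractionRing K[X] k]
    have h1 : LinearIndependent K[X] (fun i => algebraMap (PowerSeries K) 𝕃 (y i)) :=
      hli.map' (IsScalarTower.toAlgHom K[X] (PowerSeries K) 𝕃).toLinearMap
        (LinearMap.ker_eq_bot.2 algebraMap_series_injective)
    exact LinearIndependent.of_comp (E.val.toLinearMap.restrictScalars K[X]) h1
  have hspan := hz.span_eq_top_of_card_eq_finrank' (by simp [hn])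
  have hmem : (⟨algebraMap (PowerSeries K) 𝕃 u, hu.2⟩ : E) ∈ Submodule.span k (Set.range z) := by
    rw [hspan]; trivial
  obtain ⟨c, hc⟩ := (Submodule.mem_span_range_iff_exists_fun k).1 hmem
  classical
  obtain ⟨D, hD⟩ := IsLocalization.exist_integer_multiples_of_finset (nonZeroDivisors K[X])
    (Finset.univ.image c)
  choose p hp using fun i => hD (c i) (Finset.mem_image_of_mem _ (Finset.mem_univ i))
  refine ⟨D, nonZeroDivisors.ne_zero D.2, p, algebraMap_series_injective (𝕃 := 𝕃) ?_⟩
  have hc' : ∑ i, c i • algebraMap (PowerSeries K) 𝕃 (y i) = algebraMap (PowerSeries K) 𝕃 u := by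
    have := congrArg (algebraMap E 𝕃) hc
    simpa [z] using this
  rw [algebraMap_smul_series, map_sum, ← hc', Finset.smul_sum]
  refine Finset.sum_congr rfl fun i _ => ?_
  rw [algebraMap_smul_series, ← algebraMap_smul k (p i), hp, smul_assoc]

lemma exists_independent_integralSeries {n : ℕ} (hn : Module.finrank k E = n) :
    ∃ y : Fin n → PowerSeries K, (∀ i, y i ∈ integralSeries E) ∧ LinearIndependent K[X] y := by
  let b := Module.finBasisOfFinrankEq k E hn
  choose d hd y hy hdy using fun i => exists_smul_mem_integralSeries (K := K) E (b i).2
  refine ⟨y, hy, ?_⟩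
  have h1 : LinearIndependent k (fun i => ((b i : E) : 𝕃)) :=
    b.linearIndependent.map' E.val.toLinearMap (LinearMap.ker_eq_bot.2 E.val.injective)
  have hd' : ∀ i, algebraMap K[X] k (d i) ≠ 0 := fun i =>
    (map_ne_zero_iff _ (IsFractionRing.injective K[X] k)).2 (hd i)
  have h2 := h1.units_smul (fun i => Units.mk0 _ (hd' i))
  rw [← LinearIndependent.iff_fractionRing K[X] k] at h2
  refine LinearIndependent.of_comp (IsScalarTower.toAlgHom K[X] (PowerSeries K) 𝕃).toLinearMap ?_
  have h3 : (IsScalarTower.toAlgHom K[X] (PowerSeries K) 𝕃).toLinearMap ∘ y =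
      (fun i => Units.mk0 (algebraMap K[X] k (d i)) (hd' i)) • fun i => ((b i : E) : 𝕃) := ?_
  · rw [h3]; exact h2
  funext i
  simp only [Function.comp_apply, AlgHom.toLinearMap_apply, IsScalarTower.coe_toAlgHom', ← hdy,
    Pi.smul_apply', Units.smul_mk0, algebraMap_smul]

lemma cart_mem_of_sg_stable (hσ : ∀ v : PowerSeries K, algebraMap _ 𝕃 v ∈ E →
      algebraMap _ 𝕃 (sg q v) ∈ E) {u : PowerSeries K} (hu : u ∈ integralSeries E) {r : ℕ}
    (hr : r < q) : algebraMap _ 𝕃 (cart q r u) ∈ E := by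
  obtain ⟨y, hy, hli⟩ := exists_independent_integralSeries (K := K) E rfl
  obtain ⟨D, hD, p, hp⟩ := exists_smul_eq_sum E rfl (y := fun i => sg q (y i))
    (fun i => ⟨isIntegral_sg q (hy i).1, hσ _ (hy i).2⟩) (sg_linearIndependent q hli) hu
  obtain ⟨D', hD', e, he⟩ := exists_dvd_expand q hD
  choose p' hp' _ using fun i => exists_cart_algebraMap q r (e * p i)
  have h1 : D' • cart q r u = ∑ i, p' i • y i := by
    have h2 : u * sg q (algebraMap _ _ D') = ∑ i, (e * p i) • sg q (y i) := by
      rw [sg_algebraMap, he, mul_comm, ← Algebra.smul_def, mul_comm D e, mul_smul, hp,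
        Finset.smul_sum]
      simp only [mul_smul]
    have h3 := congrArg (cart q r) h2
    rw [cart_mul_sg q hr, map_sum, mul_comm, ← Algebra.smul_def] at h3
    rw [h3]
    refine Finset.sum_congr rfl fun i _ => ?_
    rw [Algebra.smul_def, Algebra.smul_def, cart_mul_sg q hr, hp']
  apply mem_of_smul_mem E hD'
  rw [← algebraMap_smul_series, h1, map_sum]
  exact sum_mem fun i _ => by
    rw [algebraMap_smul_series]; exact smul_mem_of_mem E (hy i).2 _

lemma theta_algebraMap (p : K[X]) : theta (algebraMap K[X] (PowerSeries K) p) =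
    algebraMap K[X] (PowerSeries K) (X * derivative p) := by
  ext n
  cases n with
  | zero => simp
  | succ n => simp [coeff_derivative, mul_comm]

lemma exists_theta_aeval (u : PowerSeries K) (P : K[X][X]) :
    ∃ R : K[X][X], theta (aeval u P) = aeval u R + aeval u (derivative P) * theta u := by
  induction P using Polynomial.induction_on' with
  | add P Q hP hQ =>
    obtain ⟨R, hR⟩ := hP
    obtain ⟨R', hR'⟩ := hQ
    exact ⟨R + R', by simp only [map_add, hR, hR']; ring⟩
  | monomial n a =>
    refine ⟨monomial n (X * derivative a), ?_⟩
    rw [aeval_monomial, aeval_monomial, Derivation.leibniz, derivative_monomial, aeval_monomial,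
      theta_algebraMap, Derivation.leibniz_pow]
    simp only [smul_eq_mul, nsmul_eq_mul, map_mul, map_natCast]
    ring

lemma theta_mem_of_mem_integralSeries [CharZero K] {u : PowerSeries K}
    (hu : u ∈ integralSeries E) : algebraMap _ 𝕃 (theta u) ∈ E := by
  set P := minpoly K[X] u with hPdef
  have hmon : P.Monic := minpoly.monic hu.1
  have hdeg : 0 < P.natDegree := minpoly.natDegree_pos hu.1
  have hP' : derivative P ≠ 0 := fun h => by
    have := derivative_eq_zero.1 h
    omega
  have : FaithfulSMul K[X] (PowerSeries K) := (faithfulSMul_iff_algebraMap_injective _ _).2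
    (by simp [algebraMap_eq_coe, Function.Injective])
  have hne : aeval u (derivative P) ≠ 0 := fun h => by
    have h1 := minpoly.IsIntegrallyClosed.degree_le_of_ne_zero hP' h
    exact absurd (degree_derivative_lt hmon.ne_zero) (not_lt.2 h1)
  obtain ⟨R, hR⟩ := exists_theta_aeval u P
  rw [minpoly.aeval, map_zero] at hR
  have haev : ∀ Q : K[X][X], algebraMap _ 𝕃 (aeval u Q) ∈ E := by
    intro Q
    rw [aeval_eq_sum_range, map_sum]
    exact sum_mem fun i _ => by
      rw [algebraMap_smul_series, map_pow]
      exact smul_mem_of_mem E (pow_mem hu.2 _) _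
  have h2 := congrArg (algebraMap (PowerSeries K) 𝕃) hR
  rw [map_zero, map_add, map_mul] at h2
  have hne' : algebraMap (PowerSeries K) 𝕃 (aeval u (derivative P)) ≠ 0 :=
    (map_ne_zero_iff _ algebraMap_series_injective).2 hne
  have h3 : algebraMap _ 𝕃 (theta u) =
      -(algebraMap _ 𝕃 (aeval u R) / algebraMap _ 𝕃 (aeval u (derivative P))) := by
    field_simp
    linear_combination -h2
  rw [h3]
  exact neg_mem (div_mem (haev _) (haev _))

lemma exists_smul_theta_mem [CharZero K] :
    ∃ p : K[X], p ≠ 0 ∧ ∀ u ∈ integralSeries (K := K) E, p • theta u ∈ integralSeries E := by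
  obtain ⟨t, ht⟩ := integralSeries_fg (K := K) E
  have hdt : ∀ u : t, ∃ d : K[X], d ≠ 0 ∧ d • theta (u : PowerSeries K) ∈ integralSeries E :=
    fun u => exists_smul_mem_integralSeries' E
      (theta_mem_of_mem_integralSeries E (ht ▸ Submodule.subset_span u.2))
  choose d hd hdm using hdt
  refine ⟨∏ u, d u, Finset.prod_ne_zero_iff.2 fun u _ => hd u, fun u hu => ?_⟩
  rw [← ht] at hu
  induction hu using Submodule.span_induction with
  | mem u hu =>
    obtain ⟨e, he⟩ := Finset.dvd_prod_of_mem d (Finset.mem_univ ⟨u, hu⟩)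
    rw [he, mul_comm, mul_smul]
    exact Submodule.smul_mem _ _ (hdm ⟨u, hu⟩)
  | zero => simp
  | add u v _ _ hu hv => rw [map_add, smul_add]; exact Submodule.add_mem _ hu hv
  | smul c u hu' hu =>
    rw [Algebra.smul_def c u, Derivation.leibniz, theta_algebraMap, smul_add, smul_eq_mul,
      smul_eq_mul, ← Algebra.smul_def, mul_comm u, ← Algebra.smul_def, smul_comm]
    refine Submodule.add_mem _ (Submodule.smul_mem _ _ hu) (Submodule.smul_mem _ _
      (Submodule.smul_mem _ _ ?_))
    rw [← ht]; exact hu'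

theorem eq_bot_of_sg_stable [CharZero K] (hq : 2 ≤ q) {ζ : K} (hζ : IsPrimitiveRoot ζ q)
    (hσ : ∀ v : PowerSeries K, algebraMap _ 𝕃 v ∈ E → algebraMap _ 𝕃 (sg q v) ∈ E) : E = ⊥ := by
  have key := eq_polynomial_of_lattice q hq (integralSeries (K := K) E) (integralSeries_fg E)
    (fun u hu => ⟨isIntegral_sg q hu.1, hσ u hu.2⟩)
    (fun u hu r hr => ⟨isIntegral_X_smul_cart q hζ hu.1 hr, by
      rw [algebraMap_smul_series]
      exact smul_mem_of_mem E (cart_mem_of_sg_stable q E hσ hu hr) _⟩)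
    (exists_smul_theta_mem E)
  rw [eq_bot_iff]
  intro x hx
  obtain ⟨d, hd, u, hu, h⟩ := exists_smul_mem_integralSeries (K := K) E hx
  obtain ⟨p, rfl⟩ := key u hu
  apply mem_of_smul_mem ⊥ hd
  rw [h, ← IsScalarTower.algebraMap_apply K[X] (PowerSeries K) 𝕃,
    IsScalarTower.algebraMap_apply K[X] k 𝕃]
  exact IntermediateField.algebraMap_mem _ _

end AlgebraicSeries

section RelativelyClosed

variable {K : Type*} [Field K] (q : ℕ) [NeZero q]
variable {k 𝕃 : Type*} [Field k] [Algebra K[X] k] [IsFractionRing K[X] k]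
  [Field 𝕃] [Algebra (PowerSeries K) 𝕃] [IsFractionRing (PowerSeries K) 𝕃] [Algebra k 𝕃]
  [Algebra K[X] 𝕃] [IsScalarTower K[X] k 𝕃] [IsScalarTower K[X] (PowerSeries K) 𝕃]

variable (K 𝕃) in
/-- The Mahler operator on the fraction field of the ring of power series. -/
def sgFrac : 𝕃 →+* 𝕃 := IsFractionRing.map (sg_injective (K := K) q)

lemma sgFrac_algebraMap (v : PowerSeries K) :
    sgFrac K q 𝕃 (algebraMap _ 𝕃 v) = algebraMap _ 𝕃 (sg q v) :=
  IsLocalization.map_eq (M := nonZeroDivisors (PowerSeries K))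
    (T := nonZeroDivisors (PowerSeries K))
    (nonZeroDivisors_le_comap_nonZeroDivisors_of_injective _ (sg_injective q)) v

lemma sgFrac_mem_range (c : k) :
    sgFrac K q 𝕃 (algebraMap k 𝕃 c) ∈ Set.range (algebraMap k 𝕃) := by
  obtain ⟨a, b, _, rfl⟩ := IsFractionRing.div_surjective (A := K[X]) c
  have h : ∀ a : K[X], sgFrac K q 𝕃 (algebraMap k 𝕃 (algebraMap K[X] k a)) =
      algebraMap k 𝕃 (algebraMap K[X] k (expand K q a)) := fun a => by
    rw [← IsScalarTower.algebraMap_apply, ← IsScalarTower.algebraMap_apply,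
      IsScalarTower.algebraMap_apply K[X] (PowerSeries K) 𝕃, sgFrac_algebraMap, sg_algebraMap,
      ← IsScalarTower.algebraMap_apply]
  exact ⟨algebraMap K[X] k (expand K q a) / algebraMap K[X] k (expand K q b), by
    rw [map_div₀, map_div₀, map_div₀, h, h]⟩

lemma sgFrac_mem_adjoin {s : Set 𝕃}
    (hs : ∀ x ∈ s, sgFrac K q 𝕃 x ∈ IntermediateField.adjoin k s) {x : 𝕃}
    (hx : x ∈ IntermediateField.adjoin k s) :
    sgFrac K q 𝕃 x ∈ IntermediateField.adjoin k s := by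
  induction hx using IntermediateField.adjoin_induction with
  | mem x hx => exact hs x hx
  | algebraMap c =>
    obtain ⟨c', hc'⟩ := sgFrac_mem_range (K := K) (𝕃 := 𝕃) q c
    rw [← hc']
    exact IntermediateField.algebraMap_mem _ _
  | add x y _ _ hx hy => rw [map_add]; exact add_mem hx hy
  | inv x _ hx => rw [map_inv₀]; exact inv_mem hx
  | mul x y _ _ hx hy => rw [map_mul]; exact mul_mem hx hy

lemma isAlgebraic_sg {v : PowerSeries K} (hv : IsAlgebraic K[X] (algebraMap _ 𝕃 v)) :
    IsAlgebraic K[X] (algebraMap _ 𝕃 (sg q v)) := by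
  obtain ⟨d, hd, u, hu, h⟩ := exists_smul_eq_algebraMap hv
  rw [← algebraMap_smul_series] at h
  have h1 := isIntegral_sg q (algebraMap_series_injective h ▸ hu)
  rw [Algebra.smul_def, map_mul, sg_algebraMap, ← Algebra.smul_def,
    ← isIntegral_algebraMap_series (𝕃 := 𝕃), algebraMap_smul_series] at h1
  refine IsAlgebraic.of_smul (y := expand K q d) (mem_nonZeroDivisors_of_ne_zero ?_) h1.isAlgebraic
  rwa [Ne, expand_eq_zero (NeZero.pos q)]

theorem relClosed_adjoin [CharZero K] (hq : 2 ≤ q) {ζ : K} (hζ : IsPrimitiveRoot ζ q)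
    {s : Set 𝕃} (hfin : s.Finite)
    (hs : ∀ x ∈ s, sgFrac K q 𝕃 x ∈ IntermediateField.adjoin k s) :
    RelClosed k (IntermediateField.adjoin k s) := by
  set E := IntermediateField.adjoin k s with hE
  let t : Set E := (Subtype.val : E → 𝕃) ⁻¹' s
  have ht : E.val '' t = s := by
    change Subtype.val '' (Subtype.val ⁻¹' s) = s
    rw [Set.image_preimage_eq_iff]
    intro x hx
    exact ⟨⟨x, IntermediateField.subset_adjoin _ _ hx⟩, rfl⟩
  have htop : IntermediateField.adjoin k t = ⊤ := by
    apply IntermediateField.map_injective E.val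
    rw [IntermediateField.adjoin_map, ht, ← AlgHom.fieldRange_eq_map, IntermediateField.fieldRange_val]
  have : FiniteDimensional k (algebraicClosure k E) :=
    finiteDimensional_algebraicClosure (hfin.preimage Subtype.val_injective.injOn) htop
  let E' : IntermediateField k 𝕃 := (algebraicClosure k E).map E.val
  have : FiniteDimensional k E' :=
    LinearEquiv.finiteDimensional ((algebraicClosure k E).equivMap E.val).toLinearEquiv
  have hE'mem : ∀ {x : 𝕃}, x ∈ E' ↔ x ∈ E ∧ IsAlgebraic k x := by
    intro x
    constructor
    · rintro ⟨y, hy, rfl⟩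
      exact ⟨y.2, (mem_algebraicClosure_iff.1 hy).algebraMap (A := 𝕃)⟩
    · rintro ⟨hx, hax⟩
      refine ⟨⟨x, hx⟩, mem_algebraicClosure_iff.2 ?_, rfl⟩
      exact (isAlgebraic_algebraMap_iff (algebraMap E 𝕃).injective).1 hax
  have hbot : E' = ⊥ := by
    refine eq_bot_of_sg_stable q E' hq hζ fun v hv => ?_
    rw [hE'mem, ← IsFractionRing.isAlgebraic_iff K[X] k 𝕃] at hv ⊢
    refine ⟨?_, isAlgebraic_sg q hv.2⟩
    rw [← sgFrac_algebraMap]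
    exact sgFrac_mem_adjoin q hs hv.1
  intro x hx
  have hx' : (x : 𝕃) ∈ E' := hE'mem.2 ⟨x.2, hx.algebraMap (A := 𝕃)⟩
  rw [hbot] at hx'
  obtain ⟨c, hc⟩ := IntermediateField.mem_bot.1 hx'
  exact ⟨c, Subtype.ext hc⟩

end RelativelyClosed

/-- A sequence of polynomial growth cannot be dominated by its values at doubled arguments. -/
lemma exists_mul_double_le (d : ℕ → ℕ) (n : ℕ) (hd1 : ∀ m, 1 ≤ d m)
    (hd : ∀ m, d m ≤ (m + 1) ^ n) (m₀ : ℕ) : ∃ δ, m₀ * d (2 * δ) ≤ (δ + 1) * d δ := by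
  by_contra! h
  set δ₀ := m₀ * 2 ^ (n + 1)
  have hstep : ∀ δ, δ₀ ≤ δ → 2 ^ (n + 1) * d δ ≤ d (2 * δ) := by
    intro δ hδ
    have h1 := h δ
    by_contra! h2
    have h3 : m₀ * d (2 * δ) ≤ m₀ * (2 ^ (n + 1) * d δ) := Nat.mul_le_mul_left _ h2.le
    have h4 : m₀ * (2 ^ (n + 1) * d δ) ≤ (δ + 1) * d δ := by
      rw [← mul_assoc]; exact Nat.mul_le_mul_right _ (by omega)
    omega
  have hiter : ∀ i, 2 ^ ((n + 1) * i) ≤ d (2 ^ i * δ₀) := by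
    intro i
    induction i with
    | zero => simpa using hd1 δ₀
    | succ i ih =>
      calc 2 ^ ((n + 1) * (i + 1)) = 2 ^ (n + 1) * 2 ^ ((n + 1) * i) := by ring
        _ ≤ 2 ^ (n + 1) * d (2 ^ i * δ₀) := Nat.mul_le_mul_left _ ih
        _ ≤ d (2 * (2 ^ i * δ₀)) := hstep _ (Nat.le_mul_of_pos_left _ (by positivity))
        _ = _ := by congr 1; ring
  have hlt : ∀ i, 2 ^ i ≤ (δ₀ + 1) ^ n := by
    intro i
    have h1 : 2 ^ ((n + 1) * i) ≤ (2 ^ i * (δ₀ + 1)) ^ n :=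
      (hiter i).trans ((hd _).trans (Nat.pow_le_pow_left
        (by have : 1 ≤ 2 ^ i := Nat.one_le_two_pow
            nlinarith) _))
    have h2 : 2 ^ ((n + 1) * i) = (2 ^ i) ^ n * 2 ^ i := by ring
    rw [h2, mul_pow] at h1
    exact Nat.le_of_mul_le_mul_left h1 (by positivity)
  exact absurd (hlt ((δ₀ + 1) ^ n)) (not_le.2 Nat.lt_two_pow_self)

section Box

variable {L : Type*} [CommRing L] {n : ℕ}

/-- Monomials in the entries of `u` with all exponents at most `m`. -/
def boxSet (u : Fin n → L) (m : ℕ) : Set L :=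
  {x | ∃ f : Fin n → ℕ, (∀ i, f i ≤ m) ∧ x = ∏ i, u i ^ f i}

lemma one_mem_boxSet (u : Fin n → L) (m : ℕ) : 1 ∈ boxSet u m :=
  ⟨0, by simp, by simp⟩

lemma mul_mem_boxSet {u : Fin n → L} {m : ℕ} (i : Fin n) {x : L} (hx : x ∈ boxSet u m) :
    u i * x ∈ boxSet u (m + 1) := by
  obtain ⟨f, hf, rfl⟩ := hx
  refine ⟨f + Pi.single i 1, fun j => ?_, ?_⟩
  · have := hf j
    by_cases h : j = i
    · subst h; simpa using this
    · simp [h]; omega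
  · simp only [Pi.add_apply, pow_add, Finset.prod_mul_distrib]
    rw [mul_comm, Finset.prod_eq_single (a := i) (f := fun x => u x ^ (Pi.single i 1 : Fin n → ℕ) x)]
      <;> simp +contextual

lemma boxSet_mono (u : Fin n → L) {m m' : ℕ} (h : m ≤ m') : boxSet u m ⊆ boxSet u m' :=
  fun _ ⟨f, hf, hx⟩ => ⟨f, fun i => (hf i).trans h, hx⟩

lemma exists_boxSet_eq (u : Fin n → L) (m : ℕ) :
    ∃ s : Finset L, (s : Set L) = boxSet u m ∧ s.card ≤ (m + 1) ^ n := by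
  classical
  refine ⟨(Fintype.piFinset fun _ : Fin n => Finset.range (m + 1)).image fun f => ∏ i, u i ^ f i,
    ?_, Finset.card_image_le.trans (by simp)⟩
  ext x
  simp only [Finset.coe_image, Set.mem_image, Finset.mem_coe, Fintype.mem_piFinset,
    Finset.mem_range, Nat.lt_succ_iff, boxSet, Set.mem_ofPred_eq]
  exact exists_congr fun f => and_congr_right fun _ => eq_comm

lemma finite_boxSet (u : Fin n → L) (m : ℕ) : (boxSet u m).Finite := by
  obtain ⟨s, hs, _⟩ := exists_boxSet_eq u m
  rw [← hs]; exact s.finite_toSet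

lemma boxSet_subset_submonoid {S : Type*} [SetLike S L] [SubmonoidClass S L] (M : S)
    {u : Fin n → L} (hu : ∀ i, u i ∈ M) (m : ℕ) : boxSet u m ⊆ M := by
  rintro x ⟨f, _, rfl⟩
  exact prod_mem fun i _ => pow_mem (hu i) _

lemma finrank_span_boxSet_le {k L : Type*} [Field k] [Field L] [Algebra k L] (u : Fin n → L)
    (m : ℕ) : Module.finrank k (Submodule.span k (boxSet u m)) ≤ (m + 1) ^ n := by
  obtain ⟨s, hs, hcard⟩ := exists_boxSet_eq u m
  rw [← hs]
  exact (finrank_span_finset_le_card s).trans hcard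

lemma one_le_finrank_span_boxSet {k L : Type*} [Field k] [Field L] [Algebra k L] (u : Fin n → L)
    (m : ℕ) : 1 ≤ Module.finrank k (Submodule.span k (boxSet u m)) := by
  have : FiniteDimensional k (Submodule.span k (boxSet u m)) :=
    FiniteDimensional.span_of_finite k (finite_boxSet u m)
  rw [Nat.one_le_iff_ne_zero, Ne, Submodule.finrank_eq_zero]
  intro h
  have h1 := Submodule.subset_span (R := k) (one_mem_boxSet u m)
  rw [h] at h1
  exact one_ne_zero h1

end Box

section Coordinates

/-- Clearing denominators uniformly over a finite set. -/
lemma exists_common_denominator {A k L : Type*} [CommRing A] [IsDomain A] [Field k] [Algebra A k]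
    [IsFractionRing A k] [Field L] [Algebra k L] [Algebra A L] [IsScalarTower A k L] {e : ℕ}
    (c : Fin e → L) {s : Set L} (hs : s.Finite)
    (h : ∀ x ∈ s, x ∈ Submodule.span k (Set.range c)) :
    ∃ D : A, D ≠ 0 ∧ ∀ x ∈ s, ∃ r : Fin e → A, D • x = ∑ t, r t • c t := by
  classical
  induction s, hs using Set.Finite.induction_on with
  | empty => exact ⟨1, one_ne_zero, by simp⟩
  | @insert y s _ _ ih =>
    obtain ⟨D, hD, hDs⟩ := ih fun x hx => h x (Set.mem_insert_of_mem _ hx)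
    obtain ⟨g, hg⟩ := (Submodule.mem_span_range_iff_exists_fun k).1 (h y (Set.mem_insert _ _))
    obtain ⟨D', hD'⟩ := IsLocalization.exist_integer_multiples_of_finset (nonZeroDivisors A)
      (Finset.univ.image g)
    choose p hp using fun i => hD' (g i) (Finset.mem_image_of_mem _ (Finset.mem_univ i))
    refine ⟨D * D', mul_ne_zero hD (nonZeroDivisors.ne_zero D'.2), ?_⟩
    rintro x (rfl | hx)
    · refine ⟨fun t => D * p t, ?_⟩
      rw [mul_smul, ← hg, Finset.smul_sum, Finset.smul_sum]
      refine Finset.sum_congr rfl fun t _ => ?_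
      rw [mul_smul, ← algebraMap_smul k (p t), hp, smul_assoc]
    · obtain ⟨r, hr⟩ := hDs x hx
      refine ⟨fun t => D' * r t, ?_⟩
      rw [mul_comm, mul_smul, hr, Finset.smul_sum]
      simp only [mul_smul]

variable {A R L T : Type*} [CommRing A] [CommRing R] [CommRing L] [CommRing T] [Algebra A R]
  [Algebra A L] (ρ : R →+* T) (μ : L →+* T)

lemma pow_mul_mem_closure {n : ℕ} (h : Fin n → R) (u : Fin n → L) (j : ℕ) {m : ℕ} {x : L}
    (hx : x ∈ boxSet u m) :
    (∑ i, ρ (h i) * μ (u i)) ^ j * μ x ∈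
      AddSubgroup.closure {y | ∃ s : R, ∃ x ∈ boxSet u (m + j), y = ρ s * μ x} := by
  induction j with
  | zero => exact AddSubgroup.subset_closure ⟨1, x, hx, by simp⟩
  | succ j ih =>
    rw [pow_succ', mul_assoc]
    generalize (∑ i, ρ (h i) * μ (u i)) ^ j * μ x = t at ih
    induction ih using AddSubgroup.closure_induction with
    | mem t ht =>
      obtain ⟨s, x, hx, rfl⟩ := ht
      rw [Finset.sum_mul]
      refine sum_mem fun i _ => AddSubgroup.subset_closure
        ⟨h i * s, u i * x, mul_mem_boxSet i hx, ?_⟩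
      rw [map_mul, map_mul]; ring
    | zero => simp
    | add a b _ _ ha hb => rw [mul_add]; exact add_mem ha hb
    | neg a _ ha => rw [mul_neg]; exact neg_mem ha

lemma exists_coordinates (hρμ : ∀ a : A, ρ (algebraMap A R a) = μ (algebraMap A L a)) {e : ℕ}
    (c : Fin e → L) {D : A} {s : Set L} (hD : ∀ x ∈ s, ∃ r : Fin e → A, D • x = ∑ t, r t • c t)
    {y : T} (hy : y ∈ AddSubgroup.closure {y | ∃ a : R, ∃ x ∈ s, y = ρ a * μ x}) :
    ∃ v : Fin e → R, μ (algebraMap A L D) * y = ∑ t, ρ (v t) * μ (c t) := by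
  induction hy using AddSubgroup.closure_induction with
  | mem t ht =>
    obtain ⟨a, x, hx, rfl⟩ := ht
    obtain ⟨r, hr⟩ := hD x hx
    refine ⟨fun t => a * algebraMap A R (r t), ?_⟩
    rw [mul_left_comm, ← map_mul, ← Algebra.smul_def, hr, map_sum, Finset.mul_sum]
    refine Finset.sum_congr rfl fun t _ => ?_
    rw [map_mul, hρμ, Algebra.smul_def, map_mul]; ring
  | zero => exact ⟨0, by simp⟩
  | add a b _ _ ha hb =>
    obtain ⟨v, hv⟩ := ha
    obtain ⟨w, hw⟩ := hb
    exact ⟨v + w, by simp [mul_add, hv, hw, add_mul, Finset.sum_add_distrib]⟩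
  | neg a _ ha =>
    obtain ⟨v, hv⟩ := ha
    exact ⟨-v, by simp [hv]⟩

end Coordinates

section LeftInverse

variable {k E L : Type*} [Field k] [Field E] [Field L] [Algebra k E] [Algebra k L]

lemma sum_tmul_ne_zero {n : ℕ} {h : Fin n → E} {u : Fin n → L} (hh : LinearIndependent k h)
    (hu : u ≠ 0) : ∑ i, h i ⊗ₜ[k] u i ≠ 0 := by
  intro h0
  have h1 := Module.Flat.linearIndependent_one_tmul (S := L) hh
  have h2 : ∑ i, u i • ((1 : L) ⊗ₜ[k] h i) = 0 := by
    have := congrArg (TensorProduct.comm k E L) h0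
    simpa [TensorProduct.smul_tmul'] using this
  exact hu (funext fun i => Fintype.linearIndependent_iff.1 h1 u h2 i)

lemma exists_leftInverse_matrix [IsDomain (E ⊗[k] L)] {e : ℕ} {c : Fin e → L}
    (hc : LinearIndependent k c) {G : E ⊗[k] L} (hG : G ≠ 0) :
    ∃ ψ : Fin e → Fin e → E, ∀ v w : Fin e → E,
      ∑ t, v t ⊗ₜ[k] c t = G * ∑ t, w t ⊗ₜ[k] c t → ∀ t, w t = ∑ s, v s * ψ s t := by
  have h1 := Module.Flat.linearIndependent_one_tmul (S := E) hc
  have h2 : LinearIndependent E (fun t => G * ((1 : E) ⊗ₜ[k] c t)) :=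
    h1.map' (LinearMap.mulLeft E G) (LinearMap.ker_eq_bot.2 (mul_right_injective₀ hG))
  have h3 := h2.fintypeLinearCombination_injective
  obtain ⟨Ψ, hΨ⟩ := LinearMap.exists_leftInverse_of_injective _ (LinearMap.ker_eq_bot.2 h3)
  refine ⟨fun s t => Ψ (1 ⊗ₜ c s) t, fun v w h t => ?_⟩
  have hv : ∀ v : Fin e → E, ∑ t, v t ⊗ₜ[k] c t = ∑ t, v t • ((1 : E) ⊗ₜ[k] c t) := fun v =>
    Finset.sum_congr rfl fun t _ => by rw [TensorProduct.smul_tmul', smul_eq_mul, mul_one]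
  rw [hv, hv] at h
  have h4 := congrArg Ψ h
  have h5 := LinearMap.congr_fun hΨ w
  rw [LinearMap.comp_apply, Fintype.linearCombination_apply, LinearMap.id_apply] at h5
  simp only [← mul_smul_comm, ← Finset.mul_sum] at h5
  rw [h5, map_sum] at h4
  rw [← h4, Finset.sum_apply]
  simp

end LeftInverse

section Auxiliary

variable {K : Type*} [Field K]

/-- Polynomials of bounded degree making given combinations of power series vanish to high order. -/
lemma exists_polynomials_vanishing {ι : Type*} [Fintype ι] {e : ℕ} (s : ι → Fin e → PowerSeries K)
    {N T : ℕ} (hlt : e * T < Fintype.card ι * (N + 1)) :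
    ∃ p : ι → K[X], p ≠ 0 ∧ (∀ i, (p i).natDegree ≤ N) ∧
      ∀ t, (PowerSeries.X : PowerSeries K) ^ T ∣
        ∑ i, algebraMap K[X] (PowerSeries K) (p i) * s i t := by
  let Φ : (ι → degreeLT K (N + 1)) →ₗ[K] (Fin e → Fin T → K) :=
    { toFun := fun p t l => PowerSeries.coeff (l : ℕ)
        (∑ i, algebraMap K[X] (PowerSeries K) (p i : K[X]) * s i t)
      map_add' := fun p p' => by
        funext t l
        simp [add_mul, Finset.sum_add_distrib]
      map_smul' := fun a p => by
        funext t l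
        simp [Finset.mul_sum, Algebra.smul_def, mul_assoc,
          algebraMap_eq_coe] }
  have : FiniteDimensional K (degreeLT K (N + 1)) := (degreeLTEquiv K (N + 1)).symm.finiteDimensional
  have hker : LinearMap.ker Φ ≠ ⊥ := by
    refine LinearMap.ker_ne_bot_of_finrank_lt ?_
    rw [Module.finrank_pi_fintype, Module.finrank_pi_fintype K (M := fun _ => degreeLT K (N + 1))]
    simpa [(degreeLTEquiv K (N + 1)).finrank_eq] using hlt
  obtain ⟨p, hp, hp0⟩ := Submodule.exists_mem_ne_zero_of_ne_bot hker
  refine ⟨fun i => p i, fun h => hp0 (funext fun i => Subtype.ext (congrFun h i)), fun i => ?_,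
    fun t => ?_⟩
  · have := mem_degreeLT.1 (p i).2
    by_cases h0 : (p i : K[X]) = 0
    · simp [h0]
    · exact Nat.lt_succ_iff.1 ((natDegree_lt_iff_degree_lt h0).2 this)
  · rw [PowerSeries.X_pow_dvd_iff]
    intro l hl
    exact congrFun (congrFun (LinearMap.mem_ker.1 hp) t) ⟨l, hl⟩

lemma exists_X_pow_mul_eq {𝕃 : Type*} [Field 𝕃] [Algebra (PowerSeries K) 𝕃]
    [IsFractionRing (PowerSeries K) 𝕃] {ι : Type*} [Finite ι] (ψ : ι → 𝕃) :
    ∃ c : ℕ, ∀ i, ∃ v : PowerSeries K,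
      algebraMap (PowerSeries K) 𝕃 (PowerSeries.X ^ c) * ψ i = algebraMap _ 𝕃 v := by
  obtain ⟨b, hb⟩ := IsLocalization.exist_integer_multiples_of_finite
    (nonZeroDivisors (PowerSeries K)) ψ
  have hb0 : (b : PowerSeries K) ≠ 0 := nonZeroDivisors.ne_zero b.2
  obtain ⟨w, hw⟩ : (b : PowerSeries K) ∣ PowerSeries.X ^ (b : PowerSeries K).order.toNat := by
    conv_lhs => rw [← PowerSeries.X_pow_order_mul_divXPowOrder (f := (b : PowerSeries K))]
    exact (IsUnit.mul_right_dvd (PowerSeries.isUnit_divided_by_X_pow_order hb0)).2 dvd_rfl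
  refine ⟨(b : PowerSeries K).order.toNat, fun i => ?_⟩
  obtain ⟨v, hv⟩ := hb i
  refine ⟨w * v, ?_⟩
  rw [hw, map_mul, map_mul, hv, Algebra.smul_def]
  ring

variable {k 𝕃 : Type*} [Field k] [Algebra K[X] k] [IsFractionRing K[X] k]
  [Field 𝕃] [Algebra (PowerSeries K) 𝕃] [IsFractionRing (PowerSeries K) 𝕃] [Algebra k 𝕃]
  [Algebra K[X] 𝕃] [IsScalarTower K[X] k 𝕃] [IsScalarTower K[X] (PowerSeries K) 𝕃]

variable {L₀ L : Type*} [Field L₀] [CommRing L] [Algebra K[X] L₀] [Algebra k L₀]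
  [IsScalarTower K[X] k L₀]

/-- Auxiliary functions for a relation among specialised series. -/
theorem exists_auxiliary (E : IntermediateField k 𝕃) [IsDomain (E ⊗[k] L₀)]
    (R : Subalgebra K[X] (PowerSeries K)) (hRE : ∀ r ∈ R, algebraMap (PowerSeries K) 𝕃 r ∈ E)
    (ev : R →+* L) (j : L₀ →+* L)
    (hev : ∀ p : K[X], ev (algebraMap K[X] R p) = j (algebraMap K[X] L₀ p))
    {n : ℕ} (h : Fin n → R) (hh : LinearIndependent K[X] (fun i => (h i : PowerSeries K)))
    (u : Fin n → L₀) (hu0 : u ≠ 0) (hrel : ∑ i, ev (h i) * j (u i) = 0) (m₀ : ℕ) :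
    ∃ (δ d e : ℕ) (b : Fin d → L₀) (c : Fin e → L₀) (D : K[X]) (c₀ : ℕ),
      LinearIndependent k b ∧ (∀ i, b i ∈ boxSet u δ) ∧ (∀ t, c t ∈ boxSet u (2 * δ)) ∧ D ≠ 0 ∧
      ∀ N : ℕ, ∃ p : Fin d → K[X], p ≠ 0 ∧ (∀ i, (p i).natDegree ≤ N) ∧ ∃ s : Fin e → R,
        (∀ t, (PowerSeries.X : PowerSeries K) ^ (m₀ * N) ∣
          PowerSeries.X ^ c₀ * (s t : PowerSeries K)) ∧
        j (algebraMap K[X] L₀ D * ∑ i, algebraMap K[X] L₀ (p i) * b i) =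
          ∑ t, ev (s t) * j (c t) := by
  classical
  let r : R →+* E := ((algebraMap (PowerSeries K) 𝕃).comp R.subtype).codRestrict E
    fun x => hRE x x.2
  have hr : ∀ x : R, ((r x : E) : 𝕃) = algebraMap (PowerSeries K) 𝕃 x := fun _ => rfl
  have hralg : ∀ p : K[X], r (algebraMap K[X] R p) = algebraMap k E (algebraMap K[X] k p) := by
    intro p
    apply Subtype.ext
    rw [hr]
    change algebraMap (PowerSeries K) 𝕃 (algebraMap K[X] (PowerSeries K) p) =
      algebraMap k 𝕃 (algebraMap K[X] k p)
    rw [← IsScalarTower.algebraMap_apply, ← IsScalarTower.algebraMap_apply]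
  let ρ : R →+* (E ⊗[k] L₀) × L :=
    RingHom.prod ((Algebra.TensorProduct.includeLeftRingHom (R := k) (A := E) (B := L₀)).comp r) ev
  let μ : L₀ →+* (E ⊗[k] L₀) × L :=
    RingHom.prod (Algebra.TensorProduct.includeRight (R := k) (A := E) (B := L₀)).toRingHom j
  have hρμ : ∀ p : K[X], ρ (algebraMap K[X] R p) = μ (algebraMap K[X] L₀ p) := by
    intro p
    refine Prod.ext ?_ (hev p)
    change r (algebraMap K[X] R p) ⊗ₜ[k] (1 : L₀) = (1 : E) ⊗ₜ[k] (algebraMap K[X] L₀ p)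
    rw [hralg, IsScalarTower.algebraMap_apply K[X] k L₀, Algebra.TensorProduct.tmul_one_eq_one_tmul]
  have hρμ1 : ∀ x y, (ρ x * μ y).1 = r x ⊗ₜ[k] y := fun x y => by
    change (r x ⊗ₜ[k] (1 : L₀)) * ((1 : E) ⊗ₜ[k] y) = _
    rw [Algebra.TensorProduct.tmul_mul_tmul, mul_one, one_mul]
  have hρμ2 : ∀ x y, (ρ x * μ y).2 = ev x * j y := fun x y => rfl
  set F : (E ⊗[k] L₀) × L := ∑ i, ρ (h i) * μ (u i) with hF
  have hF1 : F.1 ≠ 0 := by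
    rw [hF, Prod.fst_sum]
    simp only [hρμ1]
    refine sum_tmul_ne_zero ?_ hu0
    rw [← LinearIndependent.iff_fractionRing K[X] k]
    have h1 : LinearIndependent K[X] (fun i => algebraMap (PowerSeries K) 𝕃 (h i)) :=
      hh.map' (IsScalarTower.toAlgHom K[X] (PowerSeries K) 𝕃).toLinearMap
        (LinearMap.ker_eq_bot.2 algebraMap_series_injective)
    exact LinearIndependent.of_comp (E.val.toLinearMap.restrictScalars K[X]) h1
  have hF2 : F.2 = 0 := by
    rw [hF, Prod.snd_sum]
    exact hrel
  obtain ⟨δ, hδ⟩ := exists_mul_double_le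
    (fun m => Module.finrank k (Submodule.span k (boxSet u m))) n
    (one_le_finrank_span_boxSet u) (finrank_span_boxSet_le u) m₀
  have hd1 := one_le_finrank_span_boxSet (k := k) u δ
  have hfd := fun m => FiniteDimensional.span_of_finite k (finite_boxSet u m)
  obtain ⟨b, hbmem, hbspan, hbli⟩ := Submodule.exists_fun_fin_finrank_span_eq k (boxSet u δ)
  obtain ⟨c, hcmem, hcspan, hcli⟩ := Submodule.exists_fun_fin_finrank_span_eq k (boxSet u (2 * δ))
  generalize Module.finrank k (Submodule.span k (boxSet u δ)) = d at *
  generalize Module.finrank k (Submodule.span k (boxSet u (2 * δ))) = e at *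
  obtain ⟨D, hD0, hD⟩ := exists_common_denominator (A := K[X]) (k := k) c (finite_boxSet u (2 * δ))
    (fun x hx => hcspan ▸ Submodule.subset_span hx)
  have hcoord : ∀ (i : Fin (δ + 1)) (l : Fin d), ∃ v : Fin e → R,
      μ (algebraMap K[X] L₀ D) * (F ^ (i : ℕ) * μ (b l)) = ∑ t, ρ (v t) * μ (c t) := by
    intro i l
    have h1 := pow_mul_mem_closure (T := (E ⊗[k] L₀) × L) ρ μ h u i (hbmem l)
    refine exists_coordinates ρ μ hρμ c hD (AddSubgroup.closure_mono ?_ h1)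
    rintro y ⟨s, x, hx, rfl⟩
    exact ⟨s, x, boxSet_mono u (by omega) hx, rfl⟩
  choose v hv using hcoord
  choose ψ hψ using fun i : Fin (δ + 1) => exists_leftInverse_matrix hcli (pow_ne_zero (i : ℕ) hF1)
  obtain ⟨c₀, hc₀⟩ := exists_X_pow_mul_eq (K := K)
    (fun x : Fin (δ + 1) × Fin e × Fin e => ((ψ x.1 x.2.1 x.2.2 : E) : 𝕃))
  refine ⟨δ, d, e, b, c, D, c₀, hbli, hbmem, hcmem, hD0, fun N => ?_⟩
  obtain ⟨p, hp0, hpN, hpX⟩ := exists_polynomials_vanishing (ι := Fin (δ + 1) × Fin d) (e := e)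
    (fun x t => (v x.1 x.2 t : PowerSeries K)) (N := N) (T := m₀ * N) (by
      simp only [Fintype.card_prod, Fintype.card_fin]
      nlinarith)
  have hex : ∃ i : ℕ, ∃ hi : i < δ + 1, ∃ l, p (⟨i, hi⟩, l) ≠ 0 := by
    obtain ⟨x, hx⟩ := Function.ne_iff.1 hp0
    exact ⟨x.1, x.1.2, x.2, hx⟩
  obtain ⟨i₀, ⟨hi₀, l₀, hl₀⟩, hmin⟩ : ∃ i₀, (∃ hi : i₀ < δ + 1, ∃ l, p (⟨i₀, hi⟩, l) ≠ 0) ∧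
      ∀ i : Fin (δ + 1), (i : ℕ) < i₀ → ∀ l, p (i, l) = 0 :=
    ⟨Nat.find hex, Nat.find_spec hex, fun i hi l => by
      have := Nat.find_min hex hi
      push Not at this
      exact this i.2 l⟩
  let i₁ : Fin (δ + 1) := ⟨i₀, hi₀⟩
  let s : Fin e → R := fun t => ∑ x : Fin (δ + 1) × Fin d,
    if i₀ ≤ (x.1 : ℕ) then algebraMap K[X] R (p x) * v (x.1 - i₁) x.2 t else 0
  let s₀ : Fin e → R := fun t => ∑ x : Fin (δ + 1) × Fin d, algebraMap K[X] R (p x) * v x.1 x.2 t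
  let E₁ : (E ⊗[k] L₀) × L := ∑ x : Fin (δ + 1) × Fin d,
    if i₀ ≤ (x.1 : ℕ) then ρ (algebraMap K[X] R (p x)) * (F ^ ((x.1 : ℕ) - i₀) * μ (b x.2)) else 0
  have hE₁ : μ (algebraMap K[X] L₀ D) * E₁ = ∑ t, ρ (s t) * μ (c t) := by
    simp only [E₁, s, map_sum, Finset.mul_sum, Finset.sum_mul]
    rw [Finset.sum_comm]
    refine Finset.sum_congr rfl fun x _ => ?_
    split_ifs with hx
    · simp only [map_mul, mul_assoc, ← Finset.mul_sum]
      have h1 := hv (x.1 - i₁) x.2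
      rw [Fin.sub_val_of_le (show i₁ ≤ x.1 from hx)] at h1
      rw [← h1]
      ring
    · simp
  have hE₀ : F ^ i₀ * (μ (algebraMap K[X] L₀ D) * E₁) = ∑ t, ρ (s₀ t) * μ (c t) := by
    simp only [E₁, s₀, map_sum, Finset.mul_sum, Finset.sum_mul]
    rw [Finset.sum_comm (s := (Finset.univ : Finset (Fin e)))]
    refine Finset.sum_congr rfl fun x _ => ?_
    split_ifs with hx
    · simp only [map_mul, mul_assoc, ← Finset.mul_sum]
      rw [← hv x.1 x.2]
      have : F ^ (x.1 : ℕ) = F ^ i₀ * F ^ ((x.1 : ℕ) - i₀) := by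
        exact (pow_mul_pow_sub F hx).symm
      rw [this]
      ring
    · rw [show p x = 0 from hmin x.1 (by omega) x.2]
      simp
  refine ⟨fun l => p (i₁, l), fun h0 => hl₀ (congrFun h0 l₀), fun l => hpN _, s, fun t => ?_, ?_⟩
  · have h1 := congrArg Prod.fst hE₀
    rw [hE₁] at h1
    have h1' : F.1 ^ i₀ * (∑ t, ρ (s t) * μ (c t)).1 = (∑ t, ρ (s₀ t) * μ (c t)).1 := h1
    have hfst : ∀ v : Fin e → R, (∑ t, ρ (v t) * μ (c t)).1 = ∑ t, r (v t) ⊗ₜ[k] c t := fun v => by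
      rw [Prod.fst_sum]
      simp only [hρμ1]
    rw [hfst, hfst] at h1'
    have h2 := congrArg (Subtype.val) (hψ i₁ _ _ h1'.symm t)
    choose w hw using fun t' => hc₀ (i₁, t', t)
    have h3 : PowerSeries.X ^ c₀ * (s t : PowerSeries K) = ∑ t', (s₀ t' : PowerSeries K) * w t' := by
      apply algebraMap_series_injective (𝕃 := 𝕃)
      rw [map_mul, ← hr, h2, map_sum]
      simp only [AddSubmonoidClass.coe_finsetSum, MulMemClass.coe_mul, Finset.mul_sum, map_mul, ← hw, hr]
      refine Finset.sum_congr rfl fun t' _ => ?_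
      ring
    rw [h3]
    refine Finset.dvd_sum fun t' _ => Dvd.dvd.mul_right ?_ _
    convert hpX t' using 1
    simp [s₀]
  · have h1 := congrArg Prod.snd hE₁
    rw [Prod.snd_sum] at h1
    simp only [hρμ2] at h1
    rw [← h1, map_mul]
    change _ = j (algebraMap K[X] L₀ D) * E₁.2
    congr 1
    simp only [E₁, Prod.snd_sum]
    rw [Fintype.sum_prod_type, Finset.sum_eq_single i₁, map_sum]
    · refine Finset.sum_congr rfl fun l _ => ?_
      rw [if_pos le_rfl]
      change _ = ev _ * ((F.2) ^ (i₀ - i₀) * j (b l))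
      rw [Nat.sub_self, pow_zero, one_mul, hev, map_mul]
    · intro i _ hi
      refine Finset.sum_eq_zero fun l _ => ?_
      split_ifs with h2
      · change ev _ * ((F.2) ^ ((i : ℕ) - i₀) * j (b l)) = 0
        have : (i : ℕ) ≠ i₀ := fun h => hi (Fin.ext h)
        rw [hF2, zero_pow (by simp only at h2; omega)]
        simp
      · rfl
    · simp

end Auxiliary

section Heights

variable {K : Type*} [Field K]

/-- `x` has denominator dividing `D` and all its conjugates are bounded by `B`. -/
def HtBound (x : K) (D : ℕ) (B : ℝ) : Prop :=
  IsIntegral ℤ ((D : K) * x) ∧ ∀ φ : K →+* ℂ, ‖φ x‖ ≤ B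

lemma HtBound.mono {x : K} {D D' : ℕ} {B B' : ℝ} (h : HtBound x D B) (hD : D ∣ D') (hB : B ≤ B') :
    HtBound x D' B' := by
  obtain ⟨e, rfl⟩ := hD
  refine ⟨?_, fun φ => (h.2 φ).trans hB⟩
  have := (isIntegral_algebraMap (R := ℤ) (A := K) (x := (e : ℤ))).mul h.1
  have h' : ((D * e : ℕ) : K) * x = algebraMap ℤ K e * (D * x) := by
    push_cast
    ring
  rwa [h']

lemma HtBound.mul {x y : K} {D D' : ℕ} {B B' : ℝ} (hx : HtBound x D B) (hy : HtBound y D' B') :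
    HtBound (x * y) (D * D') (B * B') := by
  refine ⟨?_, fun φ => ?_⟩
  · have h' : ((D * D' : ℕ) : K) * (x * y) = D * x * (D' * y) := by
      push_cast
      ring
    rw [h']
    exact hx.1.mul hy.1
  · rw [map_mul, norm_mul]
    exact mul_le_mul (hx.2 φ) (hy.2 φ) (norm_nonneg _) ((norm_nonneg _).trans (hx.2 φ))

lemma HtBound.add {x y : K} {D : ℕ} {B B' : ℝ} (hx : HtBound x D B) (hy : HtBound y D B') :
    HtBound (x + y) D (B + B') := by
  refine ⟨?_, fun φ => ?_⟩
  · rw [mul_add]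
    exact hx.1.add hy.1
  · rw [map_add]
    exact (norm_add_le _ _).trans (add_le_add (hx.2 φ) (hy.2 φ))

lemma htBound_zero (D : ℕ) : HtBound (0 : K) D 0 :=
  ⟨by rw [mul_zero]; exact isIntegral_zero, fun φ => by simp⟩

lemma htBound_one : HtBound (1 : K) 1 1 :=
  ⟨by simpa using isIntegral_one, fun φ => by simp⟩

lemma HtBound.neg {x : K} {D : ℕ} {B : ℝ} (hx : HtBound x D B) : HtBound (-x) D B :=
  ⟨by rw [mul_neg]; exact hx.1.neg, fun φ => by rw [map_neg, norm_neg]; exact hx.2 φ⟩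

lemma HtBound.pow {x : K} {D : ℕ} {B : ℝ} (hx : HtBound x D B) (n : ℕ) :
    HtBound (x ^ n) (D ^ n) (B ^ n) := by
  induction n with
  | zero => simpa using htBound_one
  | succ n ih => simpa only [pow_succ] using ih.mul hx

lemma HtBound.sum {ι : Type*} (s : Finset ι) {x : ι → K} {D : ℕ} {B : ι → ℝ}
    (hx : ∀ i ∈ s, HtBound (x i) D (B i)) : HtBound (∑ i ∈ s, x i) D (∑ i ∈ s, B i) := by
  classical
  induction s using Finset.induction_on with
  | empty => simpa using htBound_zero D
  | insert i s hi ih =>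
    rw [Finset.sum_insert hi, Finset.sum_insert hi]
    exact (hx i (Finset.mem_insert_self i s)).add
      (ih fun j hj => hx j (Finset.mem_insert_of_mem hj))

variable [NumberField K]

lemma exists_htBound (x : K) : ∃ D : ℕ, 1 ≤ D ∧ ∃ B : ℝ, 1 ≤ B ∧ HtBound x D B := by
  have hx : IsAlgebraic ℤ x :=
    (IsFractionRing.isAlgebraic_iff ℤ ℚ K).2 (Algebra.IsAlgebraic.isAlgebraic (R := ℚ) x)
  obtain ⟨D, hD0, hD⟩ := hx.exists_integral_multiple
  refine ⟨D.natAbs, Nat.one_le_iff_ne_zero.2 (Int.natAbs_ne_zero.2 hD0),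
    1 + ∑ φ : K →+* ℂ, ‖φ x‖, ?_, ?_, fun φ => ?_⟩
  · exact le_add_of_nonneg_right (Finset.sum_nonneg fun _ _ => norm_nonneg _)
  · rw [zsmul_eq_mul] at hD
    rcases Int.natAbs_eq D with h | h
    · rw [h] at hD
      simpa using hD
    · rw [h] at hD
      simpa using hD.neg
  · refine (Finset.single_le_sum (f := fun φ : K →+* ℂ => ‖φ x‖) (fun _ _ => norm_nonneg _)
      (Finset.mem_univ φ)).trans (by simp)

/-- Common bounds for finitely many elements. -/
lemma exists_htBound_finite {ι : Type*} [Fintype ι] (x : ι → K) :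
    ∃ D : ℕ, 1 ≤ D ∧ ∃ B : ℝ, 1 ≤ B ∧ ∀ i, HtBound (x i) D B := by
  choose D hD B hB h using fun i => exists_htBound (x i)
  have hBprod : ∀ s : Finset ι, 1 ≤ ∏ i ∈ s, B i := fun s =>
    (Finset.prod_const_one (s := s)).symm.le.trans
      (Finset.prod_le_prod (fun _ _ => zero_le_one) fun i _ => hB i)
  refine ⟨∏ i, D i, Finset.one_le_prod' fun i _ => hD i, ∏ i, B i,
    hBprod _, fun i => (h i).mono (Finset.dvd_prod_of_mem _ (Finset.mem_univ i)) ?_⟩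
  classical
  rw [← Finset.mul_prod_erase _ _ (Finset.mem_univ i)]
  exact le_mul_of_one_le_right (zero_le_one.trans (hB i))
    (hBprod _)

/-- Liouville's inequality. -/
lemma HtBound.one_le {x : K} {D : ℕ} {B : ℝ} (h : HtBound x D B) (hx : x ≠ 0) (hD : 1 ≤ D)
    (hB : 1 ≤ B) (φ : K →+* ℂ) : 1 ≤ ‖φ x‖ * (D * B) ^ Module.finrank ℚ K := by
  classical
  have hinteg := Algebra.isIntegral_norm ℚ h.1
  obtain ⟨m, hm⟩ := IsIntegrallyClosed.isIntegral_iff.1 hinteg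
  have hDx : (D : K) * x ≠ 0 := mul_ne_zero (by simp; omega) hx
  have hn0 := Algebra.norm_ne_zero_iff (R := ℚ).2 hDx
  have hm0 : m ≠ 0 := by
    rintro rfl
    exact hn0 (by simpa using hm.symm)
  have h1 : (1 : ℝ) ≤ ‖algebraMap ℚ ℂ (Algebra.norm ℚ ((D : K) * x))‖ := by
    rw [← hm]
    simp only [algebraMap_int_eq, eq_intCast, map_intCast, Complex.norm_intCast]
    exact_mod_cast Int.one_le_abs hm0
  rw [Algebra.norm_eq_prod_embeddings ℚ ℂ, norm_prod] at h1
  have hD1 : (1 : ℝ) ≤ D := by exact_mod_cast hD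
  have hDB : (1 : ℝ) ≤ D * B := one_le_mul_of_one_le_of_one_le hD1 hB
  have hcard : Fintype.card (K →ₐ[ℚ] ℂ) = Module.finrank ℚ K := AlgHom.card ℚ K ℂ
  let φ' : K →ₐ[ℚ] ℂ := φ.toRatAlgHom
  have h2 : ∏ ψ : K →ₐ[ℚ] ℂ, ‖ψ ((D : K) * x)‖ ≤
      ‖φ' ((D : K) * x)‖ * ∏ ψ ∈ Finset.univ.erase φ', (D * B) := by
    rw [← Finset.mul_prod_erase _ _ (Finset.mem_univ φ')]
    refine mul_le_mul_of_nonneg_left (Finset.prod_le_prod (fun _ _ => norm_nonneg _) fun ψ _ => ?_)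
      (norm_nonneg _)
    rw [map_mul, norm_mul, map_natCast, Complex.norm_natCast]
    exact mul_le_mul_of_nonneg_left (h.2 ψ.toRingHom) (by positivity)
  rw [Finset.prod_const, Finset.card_erase_of_mem (Finset.mem_univ _), Finset.card_univ,
    hcard] at h2
  refine (h1.trans h2).trans ?_
  rw [map_mul, norm_mul, map_natCast, Complex.norm_natCast]
  have hpos : 0 < Module.finrank ℚ K := Module.finrank_pos
  obtain ⟨e, he⟩ : ∃ e, Module.finrank ℚ K = e + 1 := ⟨_, (Nat.succ_pred_eq_of_pos hpos).symm⟩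
  rw [he, Nat.add_sub_cancel, pow_succ]
  have : ‖φ' x‖ = ‖φ x‖ := rfl
  rw [this]
  have h3 : (D : ℝ) ≤ D * B := le_mul_of_one_le_right (by positivity) hB
  calc (D : ℝ) * ‖φ x‖ * (D * B) ^ e = ‖φ x‖ * ((D * B) ^ e * D) := by ring
    _ ≤ _ := by gcongr

end Heights

section GeometricGrowth

variable {K : Type*} [Field K] (q : ℕ)

/-- Sequences whose denominators and conjugates are bounded by `C ^ q ^ k`. -/
def GeomBounded (x : ℕ → K) (D : ℕ) (B : ℝ) : Prop :=
  1 ≤ D ∧ 1 ≤ B ∧ ∀ k, HtBound (x k) (D ^ q ^ k) (B ^ q ^ k)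

variable {q}

lemma GeomBounded.mono {x : ℕ → K} {D D' : ℕ} {B B' : ℝ} (h : GeomBounded q x D B)
    (hD : D ∣ D') (hD' : 1 ≤ D') (hB : B ≤ B') : GeomBounded q x D' B' :=
  ⟨hD', h.2.1.trans hB, fun k => (h.2.2 k).mono (pow_dvd_pow_of_dvd hD _)
    (pow_le_pow_left₀ (zero_le_one.trans h.2.1) hB _)⟩

lemma GeomBounded.mul {x y : ℕ → K} {D D' : ℕ} {B B' : ℝ} (hx : GeomBounded q x D B)
    (hy : GeomBounded q y D' B') : GeomBounded q (x * y) (D * D') (B * B') :=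
  ⟨Nat.mul_pos hx.1 hy.1, one_le_mul_of_one_le_of_one_le hx.2.1 hy.2.1, fun k => by
    rw [mul_pow, mul_pow]
    exact (hx.2.2 k).mul (hy.2.2 k)⟩

lemma pow_add_pow_le_mul {B B' : ℝ} (hB : 1 ≤ B) (hB' : 1 ≤ B') {n : ℕ} (hn : 1 ≤ n) :
    B ^ n + B' ^ n ≤ (2 * (B * B')) ^ n := by
  have h1 : 1 ≤ B ^ n := one_le_pow₀ hB
  have h2 : 1 ≤ B' ^ n := one_le_pow₀ hB'
  have h3 : (2 : ℝ) ≤ 2 ^ n := by simpa using pow_le_pow_right₀ (one_le_two (α := ℝ)) hn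
  rw [mul_pow, mul_pow]
  have h4 : B ^ n + B' ^ n ≤ 2 * (B ^ n * B' ^ n) := by nlinarith
  exact h4.trans (mul_le_mul_of_nonneg_right h3 (by positivity))

lemma GeomBounded.add (hq : 1 ≤ q) {x y : ℕ → K} {D D' : ℕ} {B B' : ℝ} (hx : GeomBounded q x D B)
    (hy : GeomBounded q y D' B') : GeomBounded q (x + y) (D * D') (2 * (B * B')) := by
  have h1 : 1 ≤ B * B' := one_le_mul_of_one_le_of_one_le hx.2.1 hy.2.1
  refine ⟨Nat.mul_pos hx.1 hy.1, by linarith, fun k => ?_⟩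
  refine HtBound.mono (((hx.2.2 k).mono (D' := (D * D') ^ q ^ k) ?_ le_rfl).add
    ((hy.2.2 k).mono (D' := (D * D') ^ q ^ k) ?_ le_rfl)) dvd_rfl
    (pow_add_pow_le_mul hx.2.1 hy.2.1 (Nat.one_le_pow _ _ hq))
  · exact pow_dvd_pow_of_dvd (Dvd.intro _ rfl) _
  · exact pow_dvd_pow_of_dvd (Dvd.intro_left _ rfl) _

lemma GeomBounded.neg {x : ℕ → K} {D : ℕ} {B : ℝ} (hx : GeomBounded q x D B) :
    GeomBounded q (-x) D B := ⟨hx.1, hx.2.1, fun k => (hx.2.2 k).neg⟩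

variable (K) in
/-- The ring of sequences of geometric growth along `q ^ k`. -/
def geomSubring (hq : 1 ≤ q) : Subring (ℕ → K) where
  carrier := {x | ∃ D B, GeomBounded q x D B}
  mul_mem' := fun ⟨_, _, hx⟩ ⟨_, _, hy⟩ => ⟨_, _, hx.mul hy⟩
  add_mem' := fun ⟨_, _, hx⟩ ⟨_, _, hy⟩ => ⟨_, _, hx.add hq hy⟩
  neg_mem' := fun ⟨_, _, hx⟩ => ⟨_, _, hx.neg⟩
  one_mem' := ⟨1, 1, le_rfl, le_rfl, fun k => by simpa using htBound_one⟩
  zero_mem' := ⟨1, 1, le_rfl, le_rfl, fun k => by simpa using (htBound_zero 1).mono dvd_rfl zero_le_one⟩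

lemma exists_geomBounded_finite {hq : 1 ≤ q} {ι : Type*} [Fintype ι] {x : ι → ℕ → K}
    (hx : ∀ i, x i ∈ geomSubring K hq) : ∃ D B, ∀ i, GeomBounded q (x i) D B := by
  choose D B h using hx
  have hBprod : ∀ s : Finset ι, 1 ≤ ∏ i ∈ s, B i := fun s =>
    (Finset.prod_const_one (s := s)).symm.le.trans
      (Finset.prod_le_prod (fun _ _ => zero_le_one) fun i _ => (h i).2.1)
  refine ⟨∏ i, D i, ∏ i, B i, fun i => (h i).mono (Finset.dvd_prod_of_mem _ (Finset.mem_univ i))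
    (Finset.one_le_prod' fun i _ => (h i).1) ?_⟩
  classical
  rw [← Finset.mul_prod_erase _ _ (Finset.mem_univ i)]
  exact le_mul_of_one_le_right (zero_le_one.trans (h i).2.1) (hBprod _)

variable [NumberField K]

lemma const_mem_geomSubring (hq : 1 ≤ q) (a : K) : (fun _ => a) ∈ geomSubring K hq := by
  obtain ⟨D, hD, B, hB, h⟩ := exists_htBound a
  exact ⟨D, B, hD, hB, fun k => h.mono (dvd_pow_self _ (Nat.one_le_iff_ne_zero.1 (Nat.one_le_pow _ _ hq)))
    (le_self_pow₀ hB (Nat.one_le_iff_ne_zero.1 (Nat.one_le_pow _ _ hq)))⟩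

lemma eval_mem_geomSubring (hq : 1 ≤ q) (β : K) (p : K[X]) :
    (fun k => p.eval (β ^ q ^ k)) ∈ geomSubring K hq := by
  induction p using Polynomial.induction_on' with
  | add p r hp hr => simp only [eval_add]; exact add_mem hp hr
  | monomial n a =>
    simp only [eval_monomial]
    obtain ⟨D, hD, B, hB, h⟩ := exists_htBound β
    have h1 : (fun k => β ^ q ^ k) ∈ geomSubring K hq := ⟨D, B, hD, hB, fun k => h.pow _⟩
    exact mul_mem (const_mem_geomSubring hq a) (pow_mem h1 n)

/-- Solutions of a linear recurrence with coefficients of geometric growth. -/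
lemma recurrence_mem_geomSubring (hq : 2 ≤ q) {ι : Type*} [Fintype ι] {A : ι → ι → ℕ → K}
    (hA : ∀ i j, A i j ∈ geomSubring K (one_le_two.trans hq)) {u : ℕ → ι → K}
    (hu : ∀ k j, u (k + 1) j = ∑ i, u k i * A i j k) (i : ι) :
    (fun k => u k i) ∈ geomSubring K (one_le_two.trans hq) := by
  obtain ⟨D, B, hDB⟩ := exists_geomBounded_finite (x := fun s : ι × ι => A s.1 s.2)
    fun s => hA s.1 s.2
  obtain ⟨D₀, hD₀, B₀, hB₀, h₀⟩ := exists_htBound_finite (u 0)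
  have hD1 : 1 ≤ D := (hDB (i, i)).1
  have hB1 : 1 ≤ B := (hDB (i, i)).2.1
  have hcard : (1 : ℝ) ≤ Fintype.card ι := by
    exact_mod_cast (Fintype.card_pos_iff.2 ⟨i⟩ : 0 < Fintype.card ι)
  set C : ℝ := Fintype.card ι * B with hC
  have hC1 : 1 ≤ C := one_le_mul_of_one_le_of_one_le hcard hB1
  have key : ∀ k j, HtBound (u k j) ((D₀ * D) ^ q ^ k) ((B₀ * C) ^ q ^ k) := by
    intro k
    induction k with
    | zero =>
      intro j
      simp only [pow_zero, pow_one]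
      exact (h₀ j).mono (Dvd.intro _ rfl) (le_mul_of_one_le_right (by linarith) hC1)
    | succ k ih =>
      intro j
      rw [hu]
      have hqk : 1 ≤ q ^ k := Nat.one_le_pow _ _ (by omega)
      refine (HtBound.sum Finset.univ (fun i _ => (ih i).mul ((hDB (i, j)).2.2 k))).mono ?_ ?_
      · calc (D₀ * D) ^ q ^ k * D ^ q ^ k ∣ (D₀ * D) ^ q ^ k * (D₀ * D) ^ q ^ k :=
            mul_dvd_mul_left _ (pow_dvd_pow_of_dvd (Dvd.intro_left _ rfl) _)
          _ = (D₀ * D) ^ (2 * q ^ k) := by rw [two_mul, pow_add]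
          _ ∣ _ := pow_dvd_pow _ (by rw [pow_succ']; exact Nat.mul_le_mul_right _ hq)
      · rw [Finset.sum_const, Finset.card_univ, nsmul_eq_mul]
        have h1 : 1 ≤ B₀ * C := one_le_mul_of_one_le_of_one_le hB₀ hC1
        calc (Fintype.card ι : ℝ) * ((B₀ * C) ^ q ^ k * B ^ q ^ k)
            ≤ (Fintype.card ι : ℝ) ^ q ^ k * ((B₀ * C) ^ q ^ k * B ^ q ^ k) := by
              gcongr
              exact le_self_pow₀ hcard (Nat.one_le_iff_ne_zero.1 hqk)
          _ = (B₀ * C) ^ q ^ k * C ^ q ^ k := by rw [hC]; ring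
          _ ≤ (B₀ * C) ^ q ^ k * (B₀ * C) ^ q ^ k := by
              gcongr
              exact le_mul_of_one_le_left (by linarith) hB₀
          _ = (B₀ * C) ^ (2 * q ^ k) := by rw [two_mul, pow_add]
          _ ≤ _ := pow_le_pow_right₀ h1 (by rw [pow_succ']; exact Nat.mul_le_mul_right _ hq)
  exact ⟨D₀ * D, B₀ * C, Nat.mul_pos hD₀ hD1, one_le_mul_of_one_le_of_one_le hB₀ hC1,
    fun k => key k i⟩

/-- Evaluation of a polynomial of degree at most `N` at a power of `β`. -/
lemma exists_htBound_eval {β : K} {D : ℕ} {B : ℝ} (hβ : HtBound β D B) (hB : 1 ≤ B)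
    {N : ℕ} {p : K[X]} (hp : p.natDegree ≤ N) :
    ∃ D₁ : ℕ, 1 ≤ D₁ ∧ ∃ B₁ : ℝ, 1 ≤ B₁ ∧
      ∀ m, HtBound (p.eval (β ^ m)) (D₁ * (D ^ N) ^ m) (B₁ * (B ^ N) ^ m) := by
  obtain ⟨D₁, hD₁, B₁, hB₁, h⟩ := exists_htBound_finite (fun i : Fin (N + 1) => p.coeff i)
  refine ⟨D₁, hD₁, (N + 1) * B₁, ?_, fun m => ?_⟩
  · exact one_le_mul_of_one_le_of_one_le (by norm_cast; omega) hB₁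
  · rw [eval_eq_sum_range' (Nat.lt_succ_of_le hp), ← Fin.sum_univ_eq_sum_range
      (fun i => p.coeff i * (β ^ m) ^ i)]
    refine (HtBound.sum Finset.univ (D := D₁ * (D ^ N) ^ m) (B := fun _ => B₁ * (B ^ N) ^ m)
      fun i _ => ?_).mono dvd_rfl ?_
    · refine ((h i).mul ((hβ.pow m).pow i)).mono (mul_dvd_mul_left _ ?_) ?_
      · rw [← pow_mul, ← pow_mul, mul_comm N]
        exact pow_dvd_pow _ (Nat.mul_le_mul_left _ (Nat.lt_succ_iff.1 i.2))
      · gcongr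
        rw [← pow_mul, ← pow_mul, mul_comm N]
        exact pow_le_pow_right₀ hB (Nat.mul_le_mul_left _ (Nat.lt_succ_iff.1 i.2))
    · simp [mul_assoc]

end GeometricGrowth

section Convergence

variable {K : Type*} [Field K] (φ : K →+* ℂ)

/-- The value at `z` of a power series embedded into `ℂ`. -/
def val (f : PowerSeries K) (z : ℂ) : ℂ := ∑' n, φ (PowerSeries.coeff n f) * z ^ n

/-- The series `f` converges absolutely on the closed disk of radius `r`. -/
def Conv (r : ℝ) (f : PowerSeries K) : Prop :=
  Summable fun n => ‖φ (PowerSeries.coeff n f)‖ * r ^ n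

variable {φ}

lemma Conv.summable_norm {r : ℝ} {f : PowerSeries K} (hf : Conv φ r f) {z : ℂ} (hz : ‖z‖ ≤ r) :
    Summable fun n => ‖φ (PowerSeries.coeff n f) * z ^ n‖ :=
  Summable.of_nonneg_of_le (fun _ => norm_nonneg _) (fun n => by
    rw [norm_mul, norm_pow]
    gcongr) hf

lemma Conv.hasSum {r : ℝ} {f : PowerSeries K} (hf : Conv φ r f) {z : ℂ} (hz : ‖z‖ ≤ r) :
    HasSum (fun n => φ (PowerSeries.coeff n f) * z ^ n) (val φ f z) :=
  (hf.summable_norm hz).of_norm.hasSum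

lemma Conv.mono {r r' : ℝ} {f : PowerSeries K} (hf : Conv φ r f) (h0 : 0 ≤ r') (h : r' ≤ r) :
    Conv φ r' f :=
  Summable.of_nonneg_of_le (fun _ => by positivity) (fun n => by gcongr) hf

lemma Conv.add {r : ℝ} (hr : 0 ≤ r) {f g : PowerSeries K} (hf : Conv φ r f) (hg : Conv φ r g) :
    Conv φ r (f + g) :=
  Summable.of_nonneg_of_le (fun _ => by positivity) (fun n => by
    rw [map_add, map_add, ← add_mul]
    gcongr
    exact norm_add_le _ _) (Summable.add hf hg)

lemma map_coeff_mul_mul_pow (f g : PowerSeries K) (n : ℕ) (z : ℂ) :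
    φ (PowerSeries.coeff n (f * g)) * z ^ n = ∑ kl ∈ Finset.HasAntidiagonal.antidiagonal n,
      φ (PowerSeries.coeff kl.1 f) * z ^ kl.1 * (φ (PowerSeries.coeff kl.2 g) * z ^ kl.2) := by
  rw [PowerSeries.coeff_mul, map_sum, Finset.sum_mul]
  refine Finset.sum_congr rfl fun kl hkl => ?_
  rw [← Finset.HasAntidiagonal.mem_antidiagonal.1 hkl, map_mul, pow_add]
  ring

lemma conv_iff {r : ℝ} (hr : 0 ≤ r) {f : PowerSeries K} :
    Conv φ r f ↔ Summable fun n => ‖φ (PowerSeries.coeff n f) * (r : ℂ) ^ n‖ := by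
  simp [Conv, abs_of_nonneg hr]

lemma Conv.mul {r : ℝ} (hr : 0 ≤ r) {f g : PowerSeries K} (hf : Conv φ r f) (hg : Conv φ r g) :
    Conv φ r (f * g) := by
  have h := summable_norm_sum_mul_antidiagonal_of_summable_norm
    ((conv_iff hr).1 hf) ((conv_iff hr).1 hg)
  refine (conv_iff hr).2 (h.congr fun n => ?_)
  rw [map_coeff_mul_mul_pow]

lemma conv_polynomial (r : ℝ) (p : K[X]) : Conv φ r (algebraMap K[X] (PowerSeries K) p) := by
  refine summable_of_ne_finset_zero (s := Finset.range (p.natDegree + 1)) fun n hn => ?_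
  rw [coeff_algebraMap_polynomial, coeff_eq_zero_of_natDegree_lt (by simpa using hn)]
  simp

variable (φ) in
/-- The algebra of power series converging absolutely on the closed disk of radius `r`. -/
def convSub {r : ℝ} (hr : 0 ≤ r) : Subalgebra K[X] (PowerSeries K) where
  carrier := {f | Conv φ r f}
  mul_mem' := Conv.mul hr
  add_mem' := Conv.add hr
  algebraMap_mem' := conv_polynomial r

lemma val_add {r : ℝ} {f g : PowerSeries K} (hf : Conv φ r f) (hg : Conv φ r g) {z : ℂ}
    (hz : ‖z‖ ≤ r) : val φ (f + g) z = val φ f z + val φ g z := by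
  rw [val, val, val, ← Summable.tsum_add (hf.hasSum hz).summable (hg.hasSum hz).summable]
  simp [add_mul]

lemma val_mul {r : ℝ} {f g : PowerSeries K} (hf : Conv φ r f) (hg : Conv φ r g) {z : ℂ}
    (hz : ‖z‖ ≤ r) : val φ (f * g) z = val φ f z * val φ g z := by
  rw [val, val, val, tsum_mul_tsum_eq_tsum_sum_antidiagonal_of_summable_norm
    (hf.summable_norm hz) (hg.summable_norm hz)]
  simp only [map_coeff_mul_mul_pow]

lemma val_polynomial (p : K[X]) (z : ℂ) :
    val φ (algebraMap K[X] (PowerSeries K) p) z = p.eval₂ φ z := by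
  rw [val, tsum_eq_sum (s := Finset.range (p.natDegree + 1)), eval₂_eq_sum_range]
  · simp
  · intro n hn
    rw [coeff_algebraMap_polynomial, coeff_eq_zero_of_natDegree_lt (by simpa using hn)]
    simp

variable (φ) in
/-- Evaluation at a point of the closed disk of radius `r`. -/
def valHom {r : ℝ} (hr : 0 ≤ r) (z : ℂ) (hz : ‖z‖ ≤ r) : convSub φ hr →+* ℂ where
  toFun f := val φ f z
  map_one' := by
    change val φ 1 z = 1
    rw [← map_one (algebraMap K[X] (PowerSeries K)), val_polynomial, eval₂_one]
  map_zero' := by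
    change val φ 0 z = 0
    rw [← map_zero (algebraMap K[X] (PowerSeries K)), val_polynomial, eval₂_zero]
  map_mul' f g := val_mul f.2 g.2 hz
  map_add' f g := val_add f.2 g.2 hz

lemma val_sum {r : ℝ} (hr : 0 ≤ r) {ι : Type*} (s : Finset ι) {f : ι → PowerSeries K}
    (hf : ∀ i, Conv φ r (f i)) {z : ℂ} (hz : ‖z‖ ≤ r) :
    val φ (∑ i ∈ s, f i) z = ∑ i ∈ s, val φ (f i) z := by
  have := map_sum (valHom φ hr z hz) (fun i => (⟨f i, hf i⟩ : convSub φ hr)) s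
  change val φ ((∑ i ∈ s, (⟨f i, hf i⟩ : convSub φ hr) : convSub φ hr) : PowerSeries K) z = _ at this
  rwa [AddSubmonoidClass.coe_finsetSum] at this

variable (q : ℕ) [NeZero q]

lemma val_sg (f : PowerSeries K) (z : ℂ) : val φ (sg q f) z = val φ f (z ^ q) := by
  have hinj : Function.Injective fun n : ℕ => q * n := fun a b h => Nat.eq_of_mul_eq_mul_left (NeZero.pos q) h
  rw [val, val, ← hinj.tsum_eq]
  · simp only [coeff_sg_mul, pow_mul]
  · intro n hn
    rw [Function.mem_support, coeff_sg] at hn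
    by_cases h : q ∣ n
    · obtain ⟨m, rfl⟩ := h
      exact ⟨m, rfl⟩
    · simp [h] at hn

lemma Conv.sg {r : ℝ} {f : PowerSeries K} (hf : Conv φ (r ^ q) f) : Conv φ r (sg q f) := by
  have hinj : Function.Injective fun n : ℕ => q * n := fun a b h => Nat.eq_of_mul_eq_mul_left (NeZero.pos q) h
  refine (hinj.summable_iff fun n hn => ?_).1 ?_
  · rw [coeff_sg, if_neg, map_zero, norm_zero, zero_mul]
    rintro ⟨m, rfl⟩
    exact hn ⟨m, rfl⟩
  · change Summable fun n => _
    simp only [Function.comp_apply, coeff_sg_mul, pow_mul]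
    exact hf

lemma Conv.of_X_pow_mul {r : ℝ} (hr : 0 < r) {T : ℕ} {g : PowerSeries K}
    (h : Conv φ r (PowerSeries.X ^ T * g)) : Conv φ r g := by
  have h1 := ((summable_nat_add_iff T).2 h).mul_right ((r ^ T)⁻¹)
  refine h1.congr fun n => ?_
  rw [PowerSeries.coeff_X_pow_mul, pow_add]
  field_simp

/-- Schwarz lemma for convergent series. -/
lemma exists_norm_val_le {r : ℝ} (hr : 0 < r) {T c : ℕ} {s : PowerSeries K} (hs : Conv φ r s)
    (h : (PowerSeries.X : PowerSeries K) ^ T ∣ PowerSeries.X ^ c * s) :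
    ∃ M : ℝ, 0 ≤ M ∧ ∀ z : ℂ, ‖z‖ ≤ r → ‖z‖ ^ c * ‖val φ s z‖ ≤ M * ‖z‖ ^ T := by
  have hXpow : ∀ c : ℕ, (PowerSeries.X : PowerSeries K) ^ c =
      algebraMap K[X] (PowerSeries K) (X ^ c) := fun c => by rw [map_pow, algebraMap_X]
  obtain ⟨g, hg⟩ := h
  have hX : ∀ c, Conv φ r ((PowerSeries.X : PowerSeries K) ^ c) := fun c => by
    rw [hXpow]
    exact conv_polynomial _ _
  have hgc : Conv φ r g := Conv.of_X_pow_mul hr (hg ▸ (hX c).mul hr.le hs)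
  refine ⟨∑' n, ‖φ (PowerSeries.coeff n g)‖ * r ^ n, tsum_nonneg fun n => by positivity,
    fun z hz => ?_⟩
  have h1 := congrArg (fun f => val φ f z) hg
  simp only [val_mul (hX c) hs hz, val_mul (hX T) hgc hz] at h1
  rw [hXpow, hXpow, val_polynomial, val_polynomial, eval₂_X_pow, eval₂_X_pow] at h1
  rw [← norm_pow, ← norm_mul, h1, norm_mul, norm_pow, mul_comm]
  gcongr
  refine (norm_tsum_le_tsum_norm (hgc.summable_norm hz)).trans
    (Summable.tsum_le_tsum (fun n => ?_) (hgc.summable_norm hz) hgc)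
  rw [norm_mul, norm_pow]
  gcongr

end Convergence

section Germs

variable {K : Type*} [Field K]

/-- A ring homomorphism acts on germs. -/
def germMap {R S : Type*} [CommRing R] [CommRing S] (l : Filter ℕ) (φ : R →+* S) :
    Filter.Germ l R →+* Filter.Germ l S where
  toFun := Filter.Germ.map φ
  map_one' := congrArg (fun f : ℕ → S => (f : Filter.Germ l S)) (funext fun _ => map_one φ)
  map_zero' := congrArg (fun f : ℕ → S => (f : Filter.Germ l S)) (funext fun _ => map_zero φ)
  map_mul' x y := by
    induction x using Filter.Germ.inductionOn with | _ x
    induction y using Filter.Germ.inductionOn with | _ y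
    exact congrArg (fun f : ℕ → S => (f : Filter.Germ l S)) (funext fun _ => map_mul φ _ _)
  map_add' x y := by
    induction x using Filter.Germ.inductionOn with | _ x
    induction y using Filter.Germ.inductionOn with | _ y
    exact congrArg (fun f : ℕ → S => (f : Filter.Germ l S)) (funext fun _ => map_add φ _ _)

/-- Evaluation of polynomials along a sequence, as a germ. -/
def germEval (l : Filter ℕ) (z : ℕ → K) : K[X] →+* Filter.Germ l K :=
  (Filter.Germ.coeRingHom l).comp (RingHom.pi fun k => evalRingHom (z k))

lemma germEval_apply (l : Filter ℕ) (z : ℕ → K) (p : K[X]) :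
    germEval l z p = ((fun k => p.eval (z k) : ℕ → K) : Filter.Germ l K) := rfl

lemma germEval_injective {z : ℕ → K} (hz : Function.Injective z) :
    Function.Injective (germEval (Filter.hyperfilter ℕ : Filter ℕ) z) := by
  rw [injective_iff_map_eq_zero]
  intro p hp
  by_contra hp0
  rw [germEval_apply, ← Filter.Germ.coe_zero, Filter.Germ.coe_eq] at hp
  have hfin : {k | p.eval (z k) = 0}.Finite := by
    refine Set.Finite.of_finite_image ((Polynomial.finite_setOfPred_isRoot hp0).subset ?_)
      (hz.injOn (s := {k | p.eval (z k) = 0}))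
    rintro _ ⟨k, hk, rfl⟩
    exact hk
  exact Filter.notMem_hyperfilter_of_finite hfin hp

end Germs

section Specialisation

variable {K : Type*} [Field K] {q : ℕ} [NeZero q]

lemma sgFrac_mem_adjoin_of_system {k 𝕃 : Type*} [Field k] [Algebra K[X] k] [IsFractionRing K[X] k]
    [Field 𝕃] [Algebra (PowerSeries K) 𝕃] [IsFractionRing (PowerSeries K) 𝕃] [Algebra k 𝕃]
    [Algebra K[X] 𝕃] [IsScalarTower K[X] k 𝕃] [IsScalarTower K[X] (PowerSeries K) 𝕃]
    {n : ℕ} {h : Fin n → PowerSeries K} {a : K[X]} {A : Matrix (Fin n) (Fin n) K[X]}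
    (hA : A.det ≠ 0)
    (hsys : ∀ i, algebraMap K[X] (PowerSeries K) a * h i =
      ∑ j, algebraMap K[X] (PowerSeries K) (A i j) * sg q (h j)) :
    ∀ x ∈ Set.range (fun i => algebraMap (PowerSeries K) 𝕃 (h i)), sgFrac K q 𝕃 x ∈
      IntermediateField.adjoin k (Set.range fun i => algebraMap (PowerSeries K) 𝕃 (h i)) := by
  set E := IntermediateField.adjoin k (Set.range fun i => algebraMap (PowerSeries K) 𝕃 (h i))
  rintro _ ⟨i, rfl⟩
  have hpoly : ∀ p : K[X], algebraMap (PowerSeries K) 𝕃 (algebraMap K[X] (PowerSeries K) p) ∈ E :=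
    fun p => by
      rw [← IsScalarTower.algebraMap_apply, IsScalarTower.algebraMap_apply K[X] k 𝕃]
      exact E.algebraMap_mem _
  have hmem : ∀ j, algebraMap (PowerSeries K) 𝕃 (h j) ∈ E := fun j =>
    IntermediateField.subset_adjoin _ _ ⟨j, rfl⟩
  have h1 : algebraMap K[X] (PowerSeries K) A.det * sg q (h i) =
      ∑ l, algebraMap K[X] (PowerSeries K) (A.adjugate i l) *
        (algebraMap K[X] (PowerSeries K) a * h l) := by
    simp only [hsys, Finset.mul_sum]
    rw [Finset.sum_comm]
    simp only [← mul_assoc, ← map_mul, ← Finset.sum_mul, ← map_sum]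
    have h2 : ∀ j, ∑ l, A.adjugate i l * A l j = if i = j then A.det else 0 := fun j => by
      rw [← Matrix.mul_apply, Matrix.adjugate_mul, Matrix.smul_apply, Matrix.one_apply]
      simp
    simp only [h2]
    rw [Finset.sum_eq_single i]
    · simp
    · intro j _ hj
      simp [hj.symm]
    · simp
  rw [sgFrac_algebraMap]
  have hdet : algebraMap (PowerSeries K) 𝕃 (algebraMap K[X] (PowerSeries K) A.det) ≠ 0 := by
    rw [← IsScalarTower.algebraMap_apply, IsScalarTower.algebraMap_apply K[X] k 𝕃,
      Ne, map_eq_zero, map_eq_zero_iff _ (IsFractionRing.injective K[X] k)]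
    exact hA
  have h3 := congrArg (algebraMap (PowerSeries K) 𝕃) h1
  rw [map_mul, mul_comm, ← eq_div_iff hdet] at h3
  rw [h3]
  refine div_mem ?_ (hpoly _)
  simp only [map_sum, map_mul]
  exact sum_mem fun l _ => mul_mem (hpoly _) (mul_mem (hpoly _) (hmem l))

variable [CharZero K]

theorem exists_auxiliary_sequences {φ : K →+* ℂ} (hq : 2 ≤ q) {ζ : K} (hζ : IsPrimitiveRoot ζ q)
    {n : ℕ} {h : Fin n → PowerSeries K} {a : K[X]} {A : Matrix (Fin n) (Fin n) K[X]}
    (hh : LinearIndependent K[X] h) (hA : A.det ≠ 0)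
    (hsys : ∀ i, algebraMap K[X] (PowerSeries K) a * h i =
      ∑ j, algebraMap K[X] (PowerSeries K) (A i j) * sg q (h j))
    {r : ℝ} (hr : 0 ≤ r) (hconv : ∀ i, Conv φ r (h i))
    {z : ℕ → K} (hz : Function.Injective z) (hzr : ∀ k, ‖φ (z k)‖ ≤ r)
    (S : Subring (ℕ → K)) {u : Fin n → ℕ → K} (hu : ∀ i, u i ∈ S)
    (hrel : ∀ k, ∑ i, val φ (h i) (φ (z k)) * φ (u i k) = 0) (hu0 : ∀ k, ∃ i, u i k ≠ 0) (m₀ : ℕ) :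
    ∃ (d e : ℕ) (b : Fin d → ℕ → K) (c : Fin e → ℕ → K) (D : K[X]) (c₀ : ℕ),
      (∀ i, b i ∈ S) ∧ (∀ t, c t ∈ S) ∧
      ∀ N : ℕ, ∃ p : Fin d → K[X], (∀ i, (p i).natDegree ≤ N) ∧ ∃ s : Fin e → PowerSeries K,
        (∀ t, Conv φ r (s t)) ∧
        (∀ t, (PowerSeries.X : PowerSeries K) ^ (m₀ * N) ∣ PowerSeries.X ^ c₀ * s t) ∧
        ∀ᶠ k in (Filter.hyperfilter ℕ : Filter ℕ),
          D.eval (z k) * ∑ i, (p i).eval (z k) * b i k ≠ 0 ∧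
          φ (D.eval (z k) * ∑ i, (p i).eval (z k) * b i k) =
            ∑ t, val φ (s t) (φ (z k)) * φ (c t k) := by
  let k := FractionRing K[X]
  let 𝕃 := FractionRing (PowerSeries K)
  have : FaithfulSMul K[X] 𝕃 := by
    rw [faithfulSMul_iff_algebraMap_injective, IsScalarTower.algebraMap_eq K[X] (PowerSeries K) 𝕃]
    refine (IsFractionRing.injective (PowerSeries K) 𝕃).comp fun p p' h => ?_
    change algebraMap K[X] (PowerSeries K) p = algebraMap K[X] (PowerSeries K) p' at h
    rw [algebraMap_eq_coe, algebraMap_eq_coe] at h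
    exact coe_injective K h
  let : Algebra k 𝕃 := FractionRing.liftAlgebra K[X] 𝕃
  have : IsScalarTower K[X] k 𝕃 := FractionRing.isScalarTower_liftAlgebra K[X] 𝕃
  let L₀ := Filter.Germ (Filter.hyperfilter ℕ : Filter ℕ) K
  let L := Filter.Germ (Filter.hyperfilter ℕ : Filter ℕ) ℂ
  let : Field L₀ := Filter.Germ.instField
  let : Algebra K[X] L₀ := (germEval (Filter.hyperfilter ℕ : Filter ℕ) z).toAlgebra
  have halgL₀ : ∀ p : K[X], algebraMap K[X] L₀ p = germEval (Filter.hyperfilter ℕ : Filter ℕ) z p :=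
    fun _ => rfl
  have hinj : Function.Injective (algebraMap K[X] L₀) := germEval_injective hz
  let : Algebra k L₀ := (IsFractionRing.lift hinj).toAlgebra
  have : IsScalarTower K[X] k L₀ := IsScalarTower.of_algebraMap_eq fun p =>
    (IsFractionRing.lift_algebraMap hinj p).symm
  have : CharZero k := charZero_of_injective_algebraMap (IsFractionRing.injective K[X] k)
  let s₀ : Set 𝕃 := Set.range fun i => algebraMap (PowerSeries K) 𝕃 (h i)
  let E := IntermediateField.adjoin k s₀
  have hE : RelClosed k E := relClosed_adjoin q hq hζ (Set.finite_range _)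
    (sgFrac_mem_adjoin_of_system hA hsys)
  have : IsDomain (E ⊗[k] L₀) :=
    have := hE.isDomain_tensor L₀
    (Algebra.TensorProduct.comm k E L₀).toMulEquiv.isDomain
  let R : Subalgebra K[X] (PowerSeries K) := Algebra.adjoin K[X] (Set.range h)
  have hRconv : R ≤ convSub φ hr := Algebra.adjoin_le (by rintro _ ⟨i, rfl⟩; exact hconv i)
  have hRE : ∀ x ∈ R, algebraMap (PowerSeries K) 𝕃 x ∈ E := by
    intro x hx
    induction hx using Algebra.adjoin_induction with
    | mem x hx =>
      obtain ⟨i, rfl⟩ := hx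
      exact IntermediateField.subset_adjoin _ _ ⟨i, rfl⟩
    | algebraMap p =>
      rw [← IsScalarTower.algebraMap_apply, IsScalarTower.algebraMap_apply K[X] k 𝕃]
      exact E.algebraMap_mem _
    | add x y _ _ hx hy => rw [map_add]; exact add_mem hx hy
    | mul x y _ _ hx hy => rw [map_mul]; exact mul_mem hx hy
  let ev : R →+* L := (Filter.Germ.coeRingHom (Filter.hyperfilter ℕ : Filter ℕ)).comp
    (RingHom.pi fun m => (valHom φ hr (φ (z m)) (hzr m)).comp (Subalgebra.inclusion hRconv).toRingHom)
  have hevapply : ∀ x : R, ev x = ((fun m => val φ x (φ (z m)) : ℕ → ℂ) : L) := fun x => rfl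
  let j : L₀ →+* L := germMap (Filter.hyperfilter ℕ : Filter ℕ) φ
  have hjapply : ∀ x : ℕ → K, j (x : L₀) = ((fun m => φ (x m) : ℕ → ℂ) : L) := fun x => rfl
  have hev : ∀ p : K[X], ev (algebraMap K[X] R p) = j (algebraMap K[X] L₀ p) := by
    intro p
    rw [hevapply, halgL₀, germEval_apply, hjapply]
    refine congrArg (fun f : ℕ → ℂ => (f : L)) (funext fun m => ?_)
    change val φ (algebraMap K[X] (PowerSeries K) p) (φ (z m)) = _
    rw [val_polynomial, eval₂_at_apply]
  let h' : Fin n → R := fun i => ⟨h i, Algebra.subset_adjoin ⟨i, rfl⟩⟩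
  let u' : Fin n → L₀ := fun i => (u i : L₀)
  have hu0' : u' ≠ 0 := by
    intro h0
    have h1 : ∀ i, ∀ᶠ m in (Filter.hyperfilter ℕ : Filter ℕ), u i m = 0 := fun i => by
      have := congrFun h0 i
      exact Filter.Germ.coe_eq.1 this
    obtain ⟨m, hm⟩ := (Filter.eventually_all.2 h1).exists
    obtain ⟨i, hi⟩ := hu0 m
    exact hi (hm i)
  have hrel' : ∑ i, ev (h' i) * j (u' i) = 0 := by
    have h1 : ∀ i, ev (h' i) * j (u' i) = Filter.Germ.coeRingHom (Filter.hyperfilter ℕ : Filter ℕ)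
        (fun m => val φ (h i) (φ (z m)) * φ (u i m)) := fun i => rfl
    simp only [h1]
    rw [← map_sum]
    convert map_zero (Filter.Germ.coeRingHom (R := ℂ) (Filter.hyperfilter ℕ : Filter ℕ))
    ext m
    simpa using hrel m
  obtain ⟨δ, d, e, b, c, D, c₀, hbli, hb, hc, hD0, hN⟩ := exists_auxiliary (K := K) (k := k)
    (𝕃 := 𝕃) (L₀ := L₀) (L := L) E R hRE ev j hev h' hh u' hu0' hrel' m₀
  let M : Subring L₀ := S.map (Filter.Germ.coeRingHom (Filter.hyperfilter ℕ : Filter ℕ))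
  have hM : ∀ m, boxSet u' m ⊆ M := boxSet_subset_submonoid M fun i => ⟨u i, hu i, rfl⟩
  choose b' hb'S hb' using fun i => hM _ (hb i)
  choose c' hc'S hc' using fun i => hM _ (hc i)
  refine ⟨d, e, b', c', D, c₀, hb'S, hc'S, fun N => ?_⟩
  obtain ⟨p, hp0, hpN, s, hsX, heq⟩ := hN N
  refine ⟨p, hpN, fun t => s t, fun t => hRconv (s t).2, hsX, ?_⟩
  let x : ℕ → K := fun m => D.eval (z m) * ∑ i, (p i).eval (z m) * b' i m
  have hx : (x : L₀) = algebraMap K[X] L₀ D * ∑ i, algebraMap K[X] L₀ (p i) * b i := by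
    have h1 : x = (fun m => D.eval (z m)) * ∑ i, (fun m => (p i).eval (z m)) * b' i := by
      ext m
      simp [x]
    change Filter.Germ.coeRingHom (Filter.hyperfilter ℕ : Filter ℕ) x = _
    rw [h1, map_mul, map_sum]
    simp only [map_mul, hb']
    rfl
  have hx0 : (x : L₀) ≠ 0 := by
    rw [hx]
    refine mul_ne_zero ((map_ne_zero_iff _ hinj).2 hD0) fun h0 => hp0 ?_
    rw [← LinearIndependent.iff_fractionRing K[X] k, Fintype.linearIndependent_iff] at hbli
    funext i
    refine hbli p ?_ i
    simpa only [Algebra.smul_def] using h0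
  have hne : ∀ᶠ m in (Filter.hyperfilter ℕ : Filter ℕ), x m ≠ 0 := by
    refine Ultrafilter.eventually_not.2 ?_
    intro h0
    exact hx0 (Filter.Germ.coe_eq.2 h0)
  have heq' : ∀ᶠ m in (Filter.hyperfilter ℕ : Filter ℕ),
      φ (x m) = ∑ t, val φ (s t) (φ (z m)) * φ (c' t m) := by
    rw [← hx, hjapply] at heq
    have h1 : ∑ t, ev (s t) * j (c t) = ((fun m => ∑ t, val φ (s t) (φ (z m)) * φ (c' t m) : ℕ → ℂ) : L) := by
      have h2 : ∀ t, ev (s t) * j (c t) = Filter.Germ.coeRingHom (Filter.hyperfilter ℕ : Filter ℕ)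
          (fun m => val φ (s t) (φ (z m)) * φ (c' t m)) := fun t => by
        rw [← hc' t]
        rfl
      simp only [h2]
      rw [← map_sum]
      refine congrArg (Filter.Germ.coeRingHom (R := ℂ) (Filter.hyperfilter ℕ : Filter ℕ)) ?_
      ext m
      simp
    rw [h1] at heq
    exact Filter.Germ.coe_eq.1 heq
  exact hne.and heq'

end Specialisation

section LinearIndependence

variable {K : Type*} [Field K] {q : ℕ} [NeZero q]

lemma not_forall_one_le_mul_pow {M y : ℝ} (hy0 : 0 ≤ y) (hy : y < 1) (hq : 2 ≤ q) :
    ∀ᶠ k : ℕ in Filter.atTop, M * y ^ q ^ k < 1 := by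
  have h1 : Filter.Tendsto (fun k : ℕ => M * y ^ q ^ k) Filter.atTop (nhds (M * 0)) :=
    ((tendsto_pow_atTop_nhds_zero_of_lt_one hy0 hy).comp
      (tendsto_pow_atTop_atTop_of_one_lt (by omega))).const_mul M
  rw [mul_zero] at h1
  exact h1.eventually_lt_const zero_lt_one

lemma val_system {φ : K →+* ℂ} {n : ℕ} {h : Fin n → PowerSeries K} {a : K[X]}
    {A : Matrix (Fin n) (Fin n) K[X]}
    (hsys : ∀ i, algebraMap K[X] (PowerSeries K) a * h i =
      ∑ j, algebraMap K[X] (PowerSeries K) (A i j) * sg q (h j))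
    {r : ℝ} (hr : 0 ≤ r) (hr1 : r ≤ 1) (hconv : ∀ i, Conv φ r (h i)) {z : ℂ} (hz : ‖z‖ ≤ r)
    (i : Fin n) :
    a.eval₂ φ z * val φ (h i) z = ∑ j, (A i j).eval₂ φ z * val φ (h j) (z ^ q) := by
  have hsg : ∀ j, Conv φ r (sg q (h j)) := fun j =>
    ((hconv j).mono (pow_nonneg hr q) (pow_le_of_le_one hr hr1 (NeZero.ne q))).sg q
  have h1 := congrArg (fun f => val φ f z) (hsys i)
  change val φ (algebraMap K[X] (PowerSeries K) a * h i) z =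
    val φ (∑ j, algebraMap K[X] (PowerSeries K) (A i j) * sg q (h j)) z at h1
  rw [val_mul (conv_polynomial r a) (hconv i) hz, val_polynomial,
    val_sum hr _ (fun j => (conv_polynomial r _).mul hr (hsg j)) hz] at h1
  rw [h1]
  refine Finset.sum_congr rfl fun j _ => ?_
  rw [val_mul (conv_polynomial r _) (hsg j) hz, val_polynomial, val_sg]

variable [NumberField K]

/-- Values of linearly independent solutions of a Mahler system at a regular algebraic point
are linearly independent. -/
theorem eq_zero_of_sum_val_eq_zero {φ : K →+* ℂ} (hq : 2 ≤ q) {ζ : K} (hζ : IsPrimitiveRoot ζ q)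
    {n : ℕ} {h : Fin n → PowerSeries K} {a : K[X]} {A : Matrix (Fin n) (Fin n) K[X]}
    (hh : LinearIndependent K[X] h)
    (hsys : ∀ i, algebraMap K[X] (PowerSeries K) a * h i =
      ∑ j, algebraMap K[X] (PowerSeries K) (A i j) * sg q (h j))
    {β : K} (hβ0 : β ≠ 0) (hβ1 : ‖φ β‖ < 1) (hconv : ∀ i, Conv φ ‖φ β‖ (h i))
    (hdet : ∀ k, A.det.eval (β ^ q ^ k) ≠ 0) {τ : Fin n → K}
    (hτ : ∑ i, φ (τ i) * val φ (h i) (φ β) = 0) : τ = 0 := by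
  by_contra hτ0
  set ρ := ‖φ β‖ with hρ
  have hρ0 : 0 < ρ := norm_pos_iff.2 ((map_ne_zero φ).2 hβ0)
  have hq1 : 1 ≤ q := by omega
  let z : ℕ → K := fun k => β ^ q ^ k
  have hznorm : ∀ k, ‖φ (z k)‖ = ρ ^ q ^ k := fun k => by simp [z, hρ]
  have hzr : ∀ k, ‖φ (z k)‖ ≤ ρ := fun k => by
    rw [hznorm]
    exact pow_le_of_le_one hρ0.le hβ1.le (Nat.one_le_iff_ne_zero.1 (Nat.one_le_pow _ _ hq1))
  have hz : Function.Injective z := fun k m hkm => by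
    have h1 := hznorm k
    rw [hkm, hznorm] at h1
    exact (Nat.pow_right_injective hq (pow_right_injective₀ hρ0 hβ1.ne h1)).symm
  let u : ℕ → Fin n → K := fun k => Nat.rec τ
    (fun k v => Matrix.vecMul v (A.map fun p => p.eval (z k))) k
  have husucc : ∀ k, u (k + 1) = Matrix.vecMul (u k) (A.map fun p => p.eval (z k)) := fun k => rfl
  have husucc' : ∀ k j, u (k + 1) j = ∑ i, u k i * (A i j).eval (z k) := fun k j => rfl
  have hu0 : ∀ k, u k ≠ 0 := by
    intro k
    induction k with
    | zero => exact hτ0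
    | succ k ih =>
      intro h0
      refine ih (Matrix.eq_zero_of_vecMul_eq_zero ?_ ((husucc k).symm.trans h0))
      have h1 := RingHom.map_det (evalRingHom (z k)) A
      change ((evalRingHom (z k)).mapMatrix A).det ≠ 0
      rw [← h1]
      exact hdet k
  have hrel : ∀ k, ∑ i, val φ (h i) (φ (z k)) * φ (u k i) = 0 := by
    intro k
    induction k with
    | zero =>
      have h0 : z 0 = β := by simp [z]
      rw [h0, ← hτ]
      exact Finset.sum_congr rfl fun i _ => mul_comm _ _
    | succ k ih =>
      have hzq : φ (z (k + 1)) = φ (z k) ^ q := by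
        rw [← map_pow]
        simp only [z]
        rw [← pow_mul, pow_succ]
      calc ∑ j, val φ (h j) (φ (z (k + 1))) * φ (u (k + 1) j)
          = ∑ j, ∑ i, φ (u k i) * ((A i j).eval₂ φ (φ (z k)) * val φ (h j) (φ (z k) ^ q)) := by
            refine Finset.sum_congr rfl fun j _ => ?_
            rw [husucc', map_sum, Finset.mul_sum, hzq]
            refine Finset.sum_congr rfl fun i _ => ?_
            rw [map_mul, eval₂_at_apply]
            ring
        _ = ∑ i, φ (u k i) * (a.eval₂ φ (φ (z k)) * val φ (h i) (φ (z k))) := by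
            rw [Finset.sum_comm]
            refine Finset.sum_congr rfl fun i _ => ?_
            rw [← Finset.mul_sum, val_system hsys hρ0.le hβ1.le hconv (hzr k)]
        _ = a.eval₂ φ (φ (z k)) * ∑ i, val φ (h i) (φ (z k)) * φ (u k i) := by
            rw [Finset.mul_sum]
            exact Finset.sum_congr rfl fun i _ => by ring
        _ = 0 := by rw [ih, mul_zero]
  have huS : ∀ i, (fun k => u k i) ∈ geomSubring K hq1 :=
    recurrence_mem_geomSubring hq (A := fun i j k => (A i j).eval (z k))
      (fun i j => eval_mem_geomSubring hq1 β (A i j)) husucc'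
  have hdet0 : A.det ≠ 0 := fun h0 => hdet 0 (by simp [h0])
  obtain ⟨Dβ, hDβ, Bβ, hBβ, hβ⟩ := exists_htBound β
  set κ := Module.finrank ℚ K with hκ
  have hDB : (1 : ℝ) ≤ Dβ * Bβ := one_le_mul_of_one_le_of_one_le (by exact_mod_cast hDβ) hBβ
  obtain ⟨m₀, hm₀⟩ : ∃ m₀ : ℕ, ρ ^ m₀ * (Dβ * Bβ) ^ κ < 1 := by
    obtain ⟨m₀, hm⟩ := exists_pow_lt_of_lt_one (inv_pos.2 (pow_pos (zero_lt_one.trans_le hDB) κ)) hβ1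
    refine ⟨m₀, ?_⟩
    rwa [lt_inv_comm₀ (pow_pos hρ0 _) (by positivity), ← one_div, lt_div_iff₀ (pow_pos hρ0 _),
      mul_comm] at hm
  obtain ⟨d, e, b, c, D, c₀, hb, hc, hN⟩ := exists_auxiliary_sequences hq hζ hh hdet0 hsys hρ0.le
    hconv hz hzr (geomSubring K hq1) (u := fun i k => u k i) huS hrel
    (fun k => Function.ne_iff.1 (hu0 k)) m₀
  obtain ⟨D₁, B₁, h₁⟩ := eval_mem_geomSubring hq1 β D
  obtain ⟨D₂, B₂, h₂⟩ : ∃ D B, 1 ≤ D ∧ 1 ≤ B ∧ ∀ i, GeomBounded q (b i) D B := by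
    obtain ⟨D, B, h⟩ := exists_geomBounded_finite (x := fun o : Option (Fin d) => o.elim 1 b)
      (fun o => by cases o; exacts [one_mem (geomSubring K hq1), hb _])
    exact ⟨D, B, (h none).1, (h none).2.1, fun i => h (some i)⟩
  obtain ⟨D₃, B₃, h₃⟩ : ∃ D B, 1 ≤ D ∧ 1 ≤ B ∧ ∀ i, GeomBounded q (c i) D B := by
    obtain ⟨D, B, h⟩ := exists_geomBounded_finite (x := fun o : Option (Fin e) => o.elim 1 c)
      (fun o => by cases o; exacts [one_mem (geomSubring K hq1), hc _])
    exact ⟨D, B, (h none).1, (h none).2.1, fun i => h (some i)⟩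
  have hB₁ : 1 ≤ B₁ := h₁.2.1
  have hB₂ : 1 ≤ B₂ := h₂.2.1
  have hB₃ : 1 ≤ B₃ := h₃.2.1
  set G : ℝ := B₃ * (D₁ * B₁ * (D₂ * B₂)) ^ κ * (ρ ^ c₀)⁻¹ with hG
  have hG0 : 0 ≤ G := by positivity
  set θ : ℝ := ρ ^ m₀ * (Dβ * Bβ) ^ κ with hθ
  have hθ0 : 0 ≤ θ := by positivity
  obtain ⟨N, hNlt⟩ : ∃ N : ℕ, θ ^ N * G < 1 := by
    have h1 := (tendsto_pow_atTop_nhds_zero_of_lt_one hθ0 hm₀).mul_const G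
    rw [zero_mul] at h1
    exact (h1.eventually_lt_const zero_lt_one).exists
  obtain ⟨p, hpN, s, hsconv, hsX, hev⟩ := hN N
  choose Dp hDp Bp hBp hp using fun i => exists_htBound_eval hβ hBβ (hpN i)
  choose M hM0 hM using fun t => exists_norm_val_le hρ0 (hsconv t) (hsX t)
  set P : ℕ := ∏ i, Dp i with hP
  have hP1 : 1 ≤ P := Finset.one_le_prod' fun i _ => hDp i
  set Q : ℝ := 1 + ∑ i, Bp i with hQ
  have hQ1 : 1 ≤ Q := le_add_of_nonneg_right (Finset.sum_nonneg fun i _ => by linarith [hBp i])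
  set M' : ℝ := (∑ t, M t) * (P * Q) ^ κ with hM'
  have hsmall := Nat.hyperfilter_le_atTop (not_forall_one_le_mul_pow (M := M') (by positivity) hNlt hq)
  obtain ⟨k, ⟨hx0, hxeq⟩, hk⟩ := (hev.and hsmall).exists
  refine absurd hk (not_lt.2 ?_)
  set w := q ^ k with hw
  set x : K := D.eval (z k) * ∑ i, (p i).eval (z k) * b i k with hx
  have hD₁0 : 1 ≤ D₁ := h₁.1
  have hxbound : HtBound x (D₁ ^ w * (P * (Dβ ^ N) ^ w * D₂ ^ w))
      (B₁ ^ w * (Q * ((Bβ ^ N) ^ w * B₂ ^ w))) := by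
    refine (h₁.2.2 k).mul ((HtBound.sum Finset.univ (B := fun i => Bp i * (Bβ ^ N) ^ w * B₂ ^ w)
      fun i _ => ?_).mono dvd_rfl ?_)
    · refine ((hp i w).mul ((h₂.2.2 i).2.2 k)).mono ?_ le_rfl
      exact mul_dvd_mul_right (mul_dvd_mul_right (Finset.dvd_prod_of_mem _ (Finset.mem_univ i)) _) _
    · simp only [mul_assoc]
      rw [← Finset.sum_mul]
      gcongr
      linarith
  have hlow := hxbound.one_le hx0
    (Nat.mul_pos (pow_pos hD₁0 _) (Nat.mul_pos (Nat.mul_pos hP1 (pow_pos (pow_pos hDβ _) _))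
      (pow_pos h₂.1 _)))
    (one_le_mul_of_one_le_of_one_le (one_le_pow₀ hB₁) (one_le_mul_of_one_le_of_one_le hQ1
      (one_le_mul_of_one_le_of_one_le (one_le_pow₀ (one_le_pow₀ hBβ)) (one_le_pow₀ hB₂)))) φ
  have hup : ρ ^ (w * c₀) * ‖φ x‖ ≤ (∑ t, M t) * (ρ ^ (w * (m₀ * N)) * B₃ ^ w) := by
    rw [hxeq, Finset.sum_mul]
    calc ρ ^ (w * c₀) * ‖∑ t, val φ (s t) (φ (z k)) * φ (c t k)‖
        ≤ ρ ^ (w * c₀) * ∑ t, ‖val φ (s t) (φ (z k))‖ * ‖φ (c t k)‖ := by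
          gcongr
          refine (norm_sum_le _ _).trans (le_of_eq ?_)
          simp only [norm_mul]
      _ = ∑ t, (ρ ^ (w * c₀) * ‖val φ (s t) (φ (z k))‖) * ‖φ (c t k)‖ := by
          rw [Finset.mul_sum]
          exact Finset.sum_congr rfl fun t _ => by ring
      _ ≤ ∑ t, M t * (ρ ^ (w * (m₀ * N)) * B₃ ^ w) := by
          refine Finset.sum_le_sum fun t _ => ?_
          have h1 := hM t _ (hzr k)
          rw [hznorm, ← pow_mul, ← pow_mul] at h1
          rw [← mul_assoc]
          exact mul_le_mul h1 (((h₃.2.2 t).2.2 k).2 φ) (norm_nonneg _)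
            (mul_nonneg (hM0 t) (by positivity))
  rw [← hκ] at hlow
  have hρw : 0 < ρ ^ (w * c₀) := pow_pos hρ0 _
  calc (1 : ℝ) ≤ ‖φ x‖ * (((D₁ ^ w * (P * (Dβ ^ N) ^ w * D₂ ^ w) : ℕ) : ℝ) *
        (B₁ ^ w * (Q * ((Bβ ^ N) ^ w * B₂ ^ w)))) ^ κ := hlow
    _ ≤ ((∑ t, M t) * (ρ ^ (w * (m₀ * N)) * B₃ ^ w) / ρ ^ (w * c₀)) *
        (((D₁ ^ w * (P * (Dβ ^ N) ^ w * D₂ ^ w) : ℕ) : ℝ) *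
        (B₁ ^ w * (Q * ((Bβ ^ N) ^ w * B₂ ^ w)))) ^ κ := by
        gcongr
        rw [le_div_iff₀ hρw, mul_comm]
        exact hup
    _ = M' * (θ ^ N * G) ^ w := by
        rw [hM', hθ, hG]
        push_cast
        simp only [mul_pow, ← pow_mul, div_eq_mul_inv, inv_pow]
        ring

end LinearIndependence

section BaseChange

variable {k K : Type*} [Field k] [Field K] [Algebra k K] {q : ℕ} [NeZero q]

lemma map_sg (φ : k →+* K) (f : PowerSeries k) :
    PowerSeries.map φ (sg q f) = sg q (PowerSeries.map φ f) := by
  ext n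
  simp only [PowerSeries.coeff_map, coeff_sg]
  split_ifs <;> simp

lemma map_sg_iterate (φ : k →+* K) (f : PowerSeries k) (n : ℕ) :
    PowerSeries.map φ ((sg q)^[n] f) = (sg q)^[n] (PowerSeries.map φ f) :=
  Function.Semiconj.iterate_right (f := PowerSeries.map φ) (fun f => map_sg φ f) n f

/-- Application of a linear form to all the coefficients of a power series. -/
def coeffwise (l : K →ₗ[k] k) : PowerSeries K →+ PowerSeries k where
  toFun f := PowerSeries.mk fun n => l (PowerSeries.coeff n f)
  map_zero' := by ext n; simp
  map_add' f g := by ext n; simp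

@[simp] lemma coeff_coeffwise (l : K →ₗ[k] k) (f : PowerSeries K) (n : ℕ) :
    PowerSeries.coeff n (coeffwise l f) = l (PowerSeries.coeff n f) := by
  simp [coeffwise]

lemma coeffwise_mul_map (l : K →ₗ[k] k) (f : PowerSeries K) (p : PowerSeries k) :
    coeffwise l (f * PowerSeries.map (algebraMap k K) p) = coeffwise l f * p := by
  ext n
  simp only [coeff_coeffwise, PowerSeries.coeff_mul, map_sum, PowerSeries.coeff_map]
  refine Finset.sum_congr rfl fun x _ => ?_
  rw [mul_comm, ← Algebra.smul_def, map_smul, smul_eq_mul, mul_comm]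

lemma coeffwise_sg (l : K →ₗ[k] k) (f : PowerSeries K) :
    coeffwise l (sg q f) = sg q (coeffwise l f) := by
  ext n
  simp only [coeff_coeffwise, coeff_sg]
  split_ifs <;> simp

lemma coeffwise_sg_iterate (l : K →ₗ[k] k) (f : PowerSeries K) (n : ℕ) :
    coeffwise l ((sg q)^[n] f) = (sg q)^[n] (coeffwise l f) :=
  Function.Semiconj.iterate_right (f := coeffwise l) (fun f => coeffwise_sg l f) n f

lemma exists_coeffwise_algebraMap (l : K →ₗ[k] k) (P : K[X]) :
    ∃ p : k[X], (∀ n, p.coeff n = l (P.coeff n)) ∧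
      coeffwise l (algebraMap K[X] (PowerSeries K) P) = algebraMap k[X] (PowerSeries k) p := by
  refine ⟨∑ i ∈ P.support, monomial i (l (P.coeff i)), fun n => ?_, ?_⟩
  · simp only [finsetSum_coeff, coeff_monomial]
    rw [Finset.sum_ite_eq']
    split_ifs with h
    · rfl
    · rw [notMem_support_iff.1 h, map_zero]
  · ext n
    simp only [coeff_coeffwise, coeff_algebraMap_polynomial, finsetSum_coeff, coeff_monomial]
    rw [Finset.sum_ite_eq']
    split_ifs with h
    · rfl
    · rw [notMem_support_iff.1 h, map_zero]

lemma map_algebraMap_polynomial (φ : k →+* K) (p : k[X]) :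
    PowerSeries.map φ (algebraMap k[X] (PowerSeries k) p) =
      algebraMap K[X] (PowerSeries K) (p.map φ) := by
  ext n
  simp

variable (k K) in
lemma linearIndependent_map {ι : Type*} {v : ι → PowerSeries k} (hv : LinearIndependent k[X] v) :
    LinearIndependent K[X] fun i => PowerSeries.map (algebraMap k K) (v i) := by
  rw [linearIndependent_iff'] at hv ⊢
  intro s P hP i hi
  ext n
  rw [coeff_zero, ← Module.forall_dual_apply_eq_zero_iff k]
  intro l
  choose p hp hp' using fun j => exists_coeffwise_algebraMap l (P j)
  have h1 : ∑ j ∈ s, p j • v j = 0 := by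
    have := congrArg (coeffwise l) hP
    rw [map_sum, map_zero] at this
    rw [← this]
    refine Finset.sum_congr rfl fun j _ => ?_
    rw [Algebra.smul_def, Algebra.smul_def, coeffwise_mul_map, hp']
  rw [← hp, hv s p h1 i hi, coeff_zero]

/-- A nonzero polynomial over a finite extension divides a nonzero polynomial over the base. -/
lemma exists_dvd_map [FiniteDimensional k K] {P : K[X]} (hP : P ≠ 0) :
    ∃ D : k[X], D ≠ 0 ∧ P ∣ D.map (algebraMap k K) := by
  have : FiniteDimensional K (AdjoinRoot P) := (AdjoinRoot.powerBasis hP).finite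
  have : FiniteDimensional k (AdjoinRoot P) := FiniteDimensional.trans k K _
  let Φ : k[X] →ₗ[k] AdjoinRoot P :=
    (aeval (AdjoinRoot.root P)).toLinearMap
  have h1 : ¬ Function.Injective Φ := fun h => by
    have := Module.Finite.of_injective Φ h
    exact Polynomial.not_finite (R := k) this
  rw [← LinearMap.ker_eq_bot, ← ne_eq, Submodule.ne_bot_iff] at h1
  obtain ⟨D, hD, hD0⟩ := h1
  refine ⟨D, hD0, ?_⟩
  rw [← AdjoinRoot.mk_eq_zero, ← AdjoinRoot.aeval_eq]
  rw [LinearMap.mem_ker] at hD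
  rw [aeval_map_algebraMap]
  exact hD

variable (q) in
/-- The series `f` satisfies a nontrivial linear Mahler equation. -/
def IsMahler (f : PowerSeries k) : Prop :=
  ¬ LinearIndependent k[X] fun n : ℕ => (sg q)^[n] f

variable (k K) in
lemma IsMahler.of_map {f : PowerSeries k}
    (hf : IsMahler q (PowerSeries.map (algebraMap k K) f)) : IsMahler q f := by
  intro h
  apply hf
  simpa only [map_sg_iterate] using linearIndependent_map k K h

lemma exists_top_relation {f : PowerSeries k} (hf : IsMahler q f) :
    ∃ (r : ℕ) (D : k[X]) (c : ℕ → k[X]), D ≠ 0 ∧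
      D • (sg q)^[r] f = ∑ i ∈ Finset.range r, c i • (sg q)^[i] f := by
  rw [IsMahler, not_linearIndependent_iff] at hf
  obtain ⟨s, g, hg, i, his, hi⟩ := hf
  classical
  let g' : ℕ → k[X] := fun n => if n ∈ s then g n else 0
  let t := s.filter fun n => g n ≠ 0
  have ht : t.Nonempty := ⟨i, by simp [t, his, hi]⟩
  let r := t.max' ht
  have hr : r ∈ t := t.max'_mem ht
  have hr' := Finset.mem_filter.1 hr
  refine ⟨r, g r, fun n => - g' n, hr'.2, ?_⟩
  have h1 : ∑ n ∈ t, g n • (sg q)^[n] f = 0 := by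
    rw [← hg, Finset.sum_filter]
    refine Finset.sum_congr rfl fun n _ => ?_
    split_ifs with h
    · rfl
    · push Not at h
      rw [h, zero_smul]
  rw [← Finset.add_sum_erase _ _ hr, add_eq_zero_iff_eq_neg] at h1
  rw [h1, ← Finset.sum_neg_distrib]
  refine Finset.sum_subset_zero_on_sdiff ?_ ?_ ?_
  · intro n hn
    rw [Finset.mem_erase] at hn
    exact Finset.mem_range.2 (lt_of_le_of_ne (t.le_max' n hn.2) hn.1)
  · intro n hn
    rw [Finset.mem_sdiff, Finset.mem_range] at hn
    have : g' n = 0 := by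
      by_contra h
      have h2 : n ∈ s ∧ g n ≠ 0 := by
        simpa [g'] using h
      exact hn.2 (Finset.mem_erase.2 ⟨hn.1.ne, Finset.mem_filter.2 h2⟩)
    simp [this]
  · intro n hn
    have hn' := (Finset.mem_filter.1 (Finset.mem_of_mem_erase hn)).1
    simp [g', hn']

end BaseChange

section Saturation

variable {k : Type*} [Field k] {q : ℕ} [NeZero q]

/-- The series some nonzero polynomial multiple of which lies in the span of `S`. -/
def satur (S : Set (PowerSeries k)) : Submodule k[X] (PowerSeries k) where
  carrier := {x | ∃ D : k[X], D ≠ 0 ∧ D • x ∈ Submodule.span k[X] S}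
  zero_mem' := ⟨1, one_ne_zero, by simp⟩
  add_mem' := by
    rintro x y ⟨D, hD, hx⟩ ⟨E, hE, hy⟩
    refine ⟨D * E, mul_ne_zero hD hE, ?_⟩
    rw [smul_add]
    refine add_mem ?_ ?_
    · rw [mul_comm, mul_smul]
      exact Submodule.smul_mem _ _ hx
    · rw [mul_smul]
      exact Submodule.smul_mem _ _ hy
  smul_mem' := by
    rintro c x ⟨D, hD, hx⟩
    refine ⟨D, hD, ?_⟩
    rw [smul_comm]
    exact Submodule.smul_mem _ _ hx

lemma mem_satur {S : Set (PowerSeries k)} {x : PowerSeries k} :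
    x ∈ satur S ↔ ∃ D : k[X], D ≠ 0 ∧ D • x ∈ Submodule.span k[X] S := Iff.rfl

lemma subset_satur (S : Set (PowerSeries k)) : S ⊆ satur S := fun x hx =>
  ⟨1, one_ne_zero, by rw [one_smul]; exact Submodule.subset_span hx⟩

lemma mem_satur_of_smul {S : Set (PowerSeries k)} {x : PowerSeries k} {D : k[X]} (hD : D ≠ 0)
    (h : D • x ∈ satur S) : x ∈ satur S := by
  obtain ⟨E, hE, h⟩ := h
  exact ⟨E * D, mul_ne_zero hE hD, by rwa [mul_smul]⟩

lemma satur_le {S T : Set (PowerSeries k)} (h : S ⊆ satur T) : satur S ≤ satur T := by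
  rintro x ⟨D, hD, hx⟩
  exact mem_satur_of_smul hD (Submodule.span_le.2 h hx)

lemma satur_mono {S T : Set (PowerSeries k)} (h : S ⊆ T) : satur S ≤ satur T :=
  satur_le (h.trans (subset_satur T))

lemma sg_smul (p : k[X]) (x : PowerSeries k) :
    sg q (p • x) = Polynomial.expand k q p • sg q x := by
  rw [Algebra.smul_def, Algebra.smul_def, map_mul, sg_algebraMap]

lemma sg_mem_satur_image {S : Set (PowerSeries k)} {x : PowerSeries k} (hx : x ∈ satur S) :
    sg q x ∈ satur (sg q '' S) := by
  obtain ⟨D, hD, hx⟩ := hx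
  refine ⟨Polynomial.expand k q D, (Polynomial.expand_ne_zero (NeZero.pos q)).2 hD, ?_⟩
  rw [← sg_smul]
  refine Submodule.span_induction (p := fun y _ => sg q y ∈ Submodule.span k[X] (sg q '' S))
    ?_ ?_ ?_ ?_ hx
  · exact fun y hy => Submodule.subset_span ⟨y, hy, rfl⟩
  · simp
  · intro y z _ _ hy hz
    rw [map_add]
    exact add_mem hy hz
  · intro c y _ hy
    rw [sg_smul]
    exact Submodule.smul_mem _ _ hy

variable (q) in
/-- A set of series whose span is stable under the Mahler operator, up to denominators. -/
def Stable (S : Set (PowerSeries k)) : Prop := ∀ x ∈ S, sg q x ∈ satur S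

lemma Stable.iUnion {ι : Type*} {S : ι → Set (PowerSeries k)} (h : ∀ i, Stable q (S i)) :
    Stable q (⋃ i, S i) := by
  intro x hx
  obtain ⟨i, hi⟩ := Set.mem_iUnion.1 hx
  exact satur_mono (Set.subset_iUnion S i) (h i x hi)

lemma Stable.sg_mem {S : Set (PowerSeries k)} (h : Stable q S) {x : PowerSeries k}
    (hx : x ∈ satur S) : sg q x ∈ satur S :=
  satur_le (by rintro _ ⟨y, hy, rfl⟩; exact h y hy) (sg_mem_satur_image hx)

lemma Stable.sg_iterate_mem {S : Set (PowerSeries k)} (h : Stable q S) {x : PowerSeries k}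
    (hx : x ∈ satur S) (n : ℕ) : (sg q)^[n] x ∈ satur S := by
  induction n with
  | zero => exact hx
  | succ n ih =>
    rw [Function.iterate_succ_apply']
    exact h.sg_mem ih

lemma Stable.isMahler {S : Set (PowerSeries k)} (h : Stable q S) (hS : S.Finite)
    {x : PowerSeries k} (hx : x ∈ satur S) : IsMahler q x := by
  intro hli
  choose D hD hmem using fun n => h.sg_iterate_mem hx n
  have h1 : LinearIndependent k[X] fun n => D n • (sg q)^[n] x := by
    rw [linearIndependent_iff'] at hli ⊢
    intro s g hg i hi
    have := hli s (fun n => g n * D n) (by simpa only [mul_smul] using hg) i hi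
    exact (mul_eq_zero.1 this).resolve_right (hD i)
  have : Finite S := hS
  have h2 := h1.finite_of_le_span_finite _ S (by rintro _ ⟨n, rfl⟩; exact hmem n)
  exact not_finite ℕ

/-- Coordinates of a Mahler series in a finite extension span a stable space. -/
lemma exists_stable {K : Type*} [Field K] [Algebra k K] {d : ℕ} (b : Module.Basis (Fin d) k K)
    {f : PowerSeries K} (hf : IsMahler q f) :
    ∃ S : Set (PowerSeries k), S.Finite ∧ Stable q S ∧ ∀ m, coeffwise (b.coord m) f ∈ S := by
  have : FiniteDimensional k K := b.finiteDimensional_of_finite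
  obtain ⟨r, D, c, hD, hr⟩ := exists_top_relation hf
  obtain ⟨E, hE, Q, hQ⟩ := exists_dvd_map (k := k) hD
  have key : ∀ (l : K →ₗ[k] k) (P : K[X]) (g : PowerSeries K), coeffwise l (P • g) ∈
      Submodule.span k[X] (Set.range fun m => coeffwise (b.coord m) g) := by
    intro l P g
    have hg : g = ∑ m, PowerSeries.C (b m) *
        PowerSeries.map (algebraMap k K) (coeffwise (b.coord m) g) := by
      ext n
      simp only [map_sum, PowerSeries.coeff_C_mul, PowerSeries.coeff_map, coeff_coeffwise,
        Module.Basis.coord_apply]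
      conv_lhs => rw [← b.sum_repr (PowerSeries.coeff n g)]
      exact Finset.sum_congr rfl fun m _ => by rw [Algebra.smul_def, mul_comm]
    have h1 : P • g = ∑ m, algebraMap K[X] (PowerSeries K) (P * C (b m)) *
        PowerSeries.map (algebraMap k K) (coeffwise (b.coord m) g) := by
      conv_lhs => rw [hg]
      rw [Finset.smul_sum]
      refine Finset.sum_congr rfl fun m _ => ?_
      rw [Algebra.smul_def, map_mul, mul_assoc, algebraMap_eq_coe (C (b m)), Polynomial.coe_C]
    rw [h1, map_sum]
    refine sum_mem fun m _ => ?_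
    obtain ⟨p, -, hp⟩ := exists_coeffwise_algebraMap l (P * C (b m))
    rw [coeffwise_mul_map, hp, ← Algebra.smul_def]
    exact Submodule.smul_mem _ _ (Submodule.subset_span ⟨m, rfl⟩)
  let S : Set (PowerSeries k) :=
    Set.range fun x : Fin (r + 1) × Fin d => (sg q)^[x.1.1] (coeffwise (b.coord x.2) f)
  have hmem : ∀ i ≤ r, ∀ m, (sg q)^[i] (coeffwise (b.coord m) f) ∈ S := fun i hi m =>
    ⟨(⟨i, by omega⟩, m), rfl⟩
  refine ⟨S, Set.finite_range _, ?_, fun m => hmem 0 (Nat.zero_le _) m⟩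
  rintro _ ⟨⟨i, m⟩, rfl⟩
  change sg q ((sg q)^[i.1] (coeffwise (b.coord m) f)) ∈ satur S
  rw [← Function.iterate_succ_apply' (sg q)]
  by_cases hi : i.1 < r
  · exact subset_satur S (hmem _ hi m)
  have hir : i.1 = r := by have := i.2; omega
  rw [hir]
  refine ⟨Polynomial.expand k q E, (Polynomial.expand_ne_zero (NeZero.pos q)).2 hE, ?_⟩
  have h1 : PowerSeries.map (algebraMap k K) (algebraMap k[X] (PowerSeries k) E) * (sg q)^[r] f =
      ∑ j ∈ Finset.range r, (Q * c j) • (sg q)^[j] f := by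
    rw [map_algebraMap_polynomial, hQ, mul_comm D, ← Algebra.smul_def, mul_smul, hr,
      Finset.smul_sum]
    simp only [mul_smul]
  have h2 := congrArg (fun x => coeffwise (b.coord m) (sg q x)) h1
  simp only [map_mul, map_sum, sg_smul, ← map_sg, sg_algebraMap,
    ← Function.iterate_succ_apply' (sg q)] at h2
  rw [mul_comm, coeffwise_mul_map, coeffwise_sg_iterate, mul_comm, ← Algebra.smul_def] at h2
  rw [h2]
  refine sum_mem fun j hj => ?_
  rw [Finset.mem_range] at hj
  refine Submodule.span_mono ?_ (key _ _ _)
  rintro _ ⟨m', rfl⟩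
  simp only [coeffwise_sg_iterate]
  exact hmem _ hj m'

lemma IsMahler.coeffwise {K : Type*} [Field K] [Algebra k K] {d : ℕ}
    (b : Module.Basis (Fin d) k K) {f : PowerSeries K} (hf : IsMahler q f) (m : Fin d) :
    IsMahler q (coeffwise (b.coord m) f) := by
  obtain ⟨S, hS, hst, hm⟩ := exists_stable b hf
  exact hst.isMahler hS (subset_satur S (hm m))

lemma exists_stable_of_family {ι : Type*} [Finite ι] {g : ι → PowerSeries k}
    (hg : ∀ i, IsMahler q (g i)) :
    ∃ S : Set (PowerSeries k), S.Finite ∧ Stable q S ∧ ∀ i, g i ∈ S := by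
  choose S hS hst hmem using fun i => exists_stable (Module.Basis.singleton (Fin 1) k) (hg i)
  refine ⟨⋃ i, S i, Set.finite_iUnion hS, Stable.iUnion hst, fun i => Set.mem_iUnion.2 ⟨i, ?_⟩⟩
  convert hmem i 0
  ext n
  simp

end Saturation

section Structure

variable {k : Type*} [Field k] {q : ℕ} [NeZero q]

lemma exists_linearIndependent_satur {S : Set (PowerSeries k)} (hS : S.Finite) :
    ∃ (n : ℕ) (h : Fin n → PowerSeries k), (∀ i, h i ∈ S) ∧ LinearIndependent k[X] h ∧
      S ⊆ satur (Set.range h) := by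
  have : Finite S := hS
  obtain ⟨s, hs, hmax⟩ := exists_maximal_linearIndepOn k[X] (fun x : S => (x : PowerSeries k))
  obtain ⟨n, ⟨e⟩⟩ := Finite.exists_equiv_fin s
  have hr : Set.range (fun i => ((e.symm i : S) : PowerSeries k)) =
      (fun x : S => (x : PowerSeries k)) '' s := by
    ext x
    constructor
    · rintro ⟨i, rfl⟩
      exact ⟨_, (e.symm i).2, rfl⟩
    · rintro ⟨y, hy, rfl⟩
      exact ⟨e ⟨y, hy⟩, by simp⟩
  refine ⟨n, fun i => ((e.symm i : S) : PowerSeries k), fun i => (e.symm i : S).2, ?_, ?_⟩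
  · exact LinearIndependent.comp hs e.symm e.symm.injective
  · intro x hx
    rw [hr]
    by_cases hxs : (⟨x, hx⟩ : S) ∈ s
    · exact subset_satur _ ⟨_, hxs, rfl⟩
    · obtain ⟨a, ha, hmem⟩ := hmax _ hxs
      exact ⟨a, ha, hmem⟩

lemma exists_inverse_relation {R M : Type*} [CommRing R] [IsDomain R] [AddCommGroup M] [Module R M]
    {n : ℕ} {x y : Fin n → M} (hy : LinearIndependent R y) {D : Fin n → R} (hD : ∀ i, D i ≠ 0)
    {C : Matrix (Fin n) (Fin n) R} (hC : ∀ i, D i • y i = ∑ j, C i j • x j) :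
    ∃ (a : R) (A : Matrix (Fin n) (Fin n) R), a ≠ 0 ∧ A.det ≠ 0 ∧
      ∀ i, a • x i = ∑ j, A i j • y j := by
  have hdet : C.det ≠ 0 := by
    intro h0
    obtain ⟨v, hv0, hv⟩ := Matrix.exists_vecMul_eq_zero_iff.2 h0
    apply hv0
    have h1 : ∑ i, (v i * D i) • y i = 0 := by
      simp only [mul_smul, hC, Finset.smul_sum]
      simp only [smul_smul]
      rw [Finset.sum_comm]
      refine Finset.sum_eq_zero fun j _ => ?_
      rw [← Finset.sum_smul]
      have : ∑ i, v i * C i j = 0 := congrFun hv j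
      rw [this, zero_smul]
    ext1 i
    have := Fintype.linearIndependent_iff.1 hy _ h1 i
    exact (mul_eq_zero.1 this).resolve_right (hD i)
  refine ⟨C.det, C.adjugate * Matrix.diagonal D, hdet, ?_, fun i => ?_⟩
  · rw [Matrix.det_mul, Matrix.det_adjugate, Matrix.det_diagonal]
    exact mul_ne_zero (pow_ne_zero _ hdet) (Finset.prod_ne_zero_iff.2 fun i _ => hD i)
  · simp only [Matrix.mul_diagonal, mul_smul, hC, Finset.smul_sum]
    simp only [smul_smul]
    rw [Finset.sum_comm]
    simp only [← Finset.sum_smul]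
    have h2 : ∀ j, ∑ l, C.adjugate i l * C l j = if i = j then C.det else 0 := fun j => by
      rw [← Matrix.mul_apply, Matrix.adjugate_mul, Matrix.smul_apply, Matrix.one_apply]
      simp
    simp only [h2, ite_smul, zero_smul]
    simp

lemma exists_system {n : ℕ} {h : Fin n → PowerSeries k} (hh : LinearIndependent k[X] h)
    (hst : Stable q (Set.range h)) :
    ∃ (a : k[X]) (A : Matrix (Fin n) (Fin n) k[X]), a ≠ 0 ∧ A.det ≠ 0 ∧
      ∀ i, algebraMap k[X] (PowerSeries k) a * h i =
        ∑ j, algebraMap k[X] (PowerSeries k) (A i j) * sg q (h j) := by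
  have hmem : ∀ i, ∃ D : k[X], D ≠ 0 ∧ ∃ c : Fin n → k[X], D • sg q (h i) = ∑ j, c j • h j := by
    intro i
    obtain ⟨D, hD, hmem⟩ := mem_satur.1 (hst (h i) ⟨i, rfl⟩)
    obtain ⟨c, hc⟩ := (Submodule.mem_span_range_iff_exists_fun _).1 hmem
    exact ⟨D, hD, c, hc.symm⟩
  choose D hD c hc using hmem
  obtain ⟨a, A, ha, hA, h1⟩ :=
    exists_inverse_relation (x := h) (C := c) (sg_linearIndependent q hh) hD hc
  refine ⟨a, A, ha, hA, fun i => ?_⟩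
  rw [← Algebra.smul_def, h1]
  exact Finset.sum_congr rfl fun j _ => Algebra.smul_def _ _

lemma mem_satur_sg_iterate {n : ℕ} {h : Fin n → PowerSeries k} {a : k[X]}
    {A : Matrix (Fin n) (Fin n) k[X]} (ha : a ≠ 0)
    (hsys : ∀ i, algebraMap k[X] (PowerSeries k) a * h i =
        ∑ j, algebraMap k[X] (PowerSeries k) (A i j) * sg q (h j)) {x : PowerSeries k}
    (hx : x ∈ satur (Set.range h)) (l : ℕ) :
    x ∈ satur (Set.range fun i => (sg q)^[l] (h i)) := by
  have h0 : Set.range h ⊆ satur (Set.range fun i => sg q (h i)) := by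
    rintro _ ⟨i, rfl⟩
    refine ⟨a, ha, ?_⟩
    rw [Algebra.smul_def, hsys]
    refine sum_mem fun j _ => ?_
    rw [← Algebra.smul_def]
    exact Submodule.smul_mem _ _ (Submodule.subset_span ⟨j, rfl⟩)
  induction l with
  | zero => exact hx
  | succ l ih =>
    refine satur_le ?_ ih
    rintro _ ⟨i, rfl⟩
    have h1 : ∀ m : ℕ, (sg q)^[m] (h i) ∈
        satur (Set.range fun i => (sg q)^[m + 1] (h i)) := by
      intro m
      induction m with
      | zero => exact h0 ⟨i, rfl⟩
      | succ m ih =>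
        have := sg_mem_satur_image (q := q) ih
        rw [← Set.range_comp] at this
        simpa only [Function.comp_def, ← Function.iterate_succ_apply' (sg q)] using this
    exact h1 l

end Structure

section Convergence

variable {k : Type*} [Field k] {q : ℕ} [NeZero q]

lemma exists_norm_coeff_mul_le (φ : k →+* ℂ) (p : k[X]) :
    ∃ L : ℝ, 0 ≤ L ∧ ∀ (f : PowerSeries k) (N : ℕ) (B : ℝ), 0 ≤ B →
      (∀ n ≤ N, ‖φ (PowerSeries.coeff n f)‖ ≤ B) →
      ‖φ (PowerSeries.coeff N (algebraMap k[X] (PowerSeries k) p * f))‖ ≤ L * B := by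
  induction p using Polynomial.induction_on' with
  | add p r hp hr =>
    obtain ⟨L, hL, hp⟩ := hp
    obtain ⟨M, hM, hr⟩ := hr
    refine ⟨L + M, add_nonneg hL hM, fun f N B hB hf => ?_⟩
    rw [map_add, add_mul, map_add, map_add, add_mul]
    exact (norm_add_le _ _).trans (add_le_add (hp f N B hB hf) (hr f N B hB hf))
  | monomial e c =>
    refine ⟨‖φ c‖, norm_nonneg _, fun f N B hB hf => ?_⟩
    rw [← C_mul_X_pow_eq_monomial, map_mul (algebraMap k[X] (PowerSeries k)), map_pow, algebraMap_X, algebraMap_eq_coe,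
      Polynomial.coe_C, mul_comm (PowerSeries.C c), mul_assoc, PowerSeries.coeff_X_pow_mul']
    split_ifs with h
    · rw [PowerSeries.coeff_C_mul, map_mul, norm_mul]
      exact mul_le_mul_of_nonneg_left (hf _ (Nat.sub_le _ _)) (norm_nonneg _)
    · rw [map_zero, norm_zero]
      exact mul_nonneg (norm_nonneg _) hB

lemma exists_norm_coeff_le (φ : k →+* ℂ) {D : k[X]} (hD : D ≠ 0) :
    ∃ (v : ℕ) (L : ℝ), 0 ≤ L ∧ ∀ (f : PowerSeries k) (N : ℕ) (B : ℝ), 0 ≤ B →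
      (∀ n < N, ‖φ (PowerSeries.coeff n f)‖ ≤ B) →
      ‖φ (PowerSeries.coeff (N + v) (algebraMap k[X] (PowerSeries k) D * f))‖ ≤ B →
      ‖φ (PowerSeries.coeff N f)‖ ≤ L * B := by
  obtain ⟨E, hE, hdvd⟩ := Polynomial.exists_eq_pow_rootMultiplicity_mul_and_not_dvd D hD 0
  set v := D.rootMultiplicity 0
  rw [map_zero, sub_zero] at hE hdvd
  have hE0 : φ (E.coeff 0) ≠ 0 := by
    rw [ne_eq, map_eq_zero, ← X_dvd_iff]
    exact hdvd
  obtain ⟨M, hM, hE1⟩ := exists_norm_coeff_mul_le φ E.divX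
  refine ⟨v, ‖φ (E.coeff 0)‖⁻¹ * (1 + M), by positivity, fun f N B hB hf hD => ?_⟩
  have h1 : algebraMap k[X] (PowerSeries k) D * f = PowerSeries.X ^ v *
      (PowerSeries.C (E.coeff 0) * f +
        PowerSeries.X * (algebraMap k[X] (PowerSeries k) E.divX * f)) := by
    conv_lhs => rw [hE, ← divX_mul_X_add E]
    simp only [map_mul, map_add, map_pow, algebraMap_X]
    rw [algebraMap_eq_coe (C _), Polynomial.coe_C]
    ring
  rw [h1, PowerSeries.coeff_X_pow_mul, map_add, PowerSeries.coeff_C_mul, map_add, map_mul] at hD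
  have h2 : ‖φ (PowerSeries.coeff N
      (PowerSeries.X * (algebraMap k[X] (PowerSeries k) E.divX * f)))‖ ≤ M * B := by
    cases N with
    | zero => simp; positivity
    | succ N =>
      rw [PowerSeries.coeff_succ_X_mul]
      exact hE1 f N B hB fun n hn => hf n (by omega)
  have h3 : ‖φ (E.coeff 0)‖ * ‖φ (PowerSeries.coeff N f)‖ ≤ B + M * B := by
    rw [← norm_mul]
    calc _ = ‖(φ (E.coeff 0) * φ (PowerSeries.coeff N f) + φ (PowerSeries.coeff N
            (PowerSeries.X * (algebraMap k[X] (PowerSeries k) E.divX * f)))) -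
          φ (PowerSeries.coeff N
            (PowerSeries.X * (algebraMap k[X] (PowerSeries k) E.divX * f)))‖ := by
            rw [add_sub_cancel_right]
      _ ≤ _ := (norm_sub_le _ _).trans (add_le_add hD h2)
  rw [mul_assoc, ← div_eq_inv_mul, le_div_iff₀' (norm_pos_iff.2 hE0)]
  linarith

lemma exists_conv (φ : k →+* ℂ) (hq : 2 ≤ q) {ι : Type*} [Fintype ι] {s : ι → PowerSeries k}
    (hs : ∀ i, s i ∈ satur (Set.range fun j => sg q (s j))) :
    ∃ ρ : ℝ, 0 < ρ ∧ ρ < 1 ∧ ∀ i, Conv φ ρ (s i) := by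
  choose D hD hmem using hs
  simp only [Submodule.mem_span_range_iff_exists_fun] at hmem
  choose c hc using hmem
  choose v L hL hbd using fun i => exists_norm_coeff_le φ (hD i)
  choose M hM hcM using fun i j => exists_norm_coeff_mul_le φ (c i j)
  let V := ∑ i, v i
  have hV : ∀ i, v i ≤ V := fun i => Finset.single_le_sum (f := v) (by simp) (Finset.mem_univ i)
  let R : ℝ := 1 + ∑ i, L i * (1 + ∑ j, M i j)
  have hterm : ∀ i, 0 ≤ L i * (1 + ∑ j, M i j) := fun i =>
    mul_nonneg (hL i) (add_nonneg zero_le_one (Finset.sum_nonneg fun j _ => hM i j))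
  have hR1 : 1 ≤ R := le_add_of_nonneg_right (Finset.sum_nonneg fun i _ => hterm i)
  have hR : ∀ i, L i * (1 + ∑ j, M i j) ≤ R := fun i =>
    (Finset.single_le_sum (f := fun i => L i * (1 + ∑ j, M i j)) (fun i _ => hterm i)
      (Finset.mem_univ i)).trans (le_add_of_nonneg_left zero_le_one)
  let C : ℝ := ∑ i, ∑ n ∈ Finset.range (V + 1), ‖φ (PowerSeries.coeff n (s i))‖
  have hC : 0 ≤ C := Finset.sum_nonneg fun i _ => Finset.sum_nonneg fun n _ => norm_nonneg _
  have key : ∀ N i, ‖φ (PowerSeries.coeff N (s i))‖ ≤ C * R ^ N := by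
    intro N
    induction N using Nat.strong_induction_on with
    | _ N ih =>
      intro i
      by_cases hN : N ≤ V
      · calc ‖φ (PowerSeries.coeff N (s i))‖
            ≤ ∑ n ∈ Finset.range (V + 1), ‖φ (PowerSeries.coeff n (s i))‖ :=
              Finset.single_le_sum (f := fun n => ‖φ (PowerSeries.coeff n (s i))‖)
                (fun _ _ => norm_nonneg _) (Finset.mem_range.2 (by omega))
          _ ≤ C := Finset.single_le_sum
              (f := fun i => ∑ n ∈ Finset.range (V + 1), ‖φ (PowerSeries.coeff n (s i))‖)
              (fun _ _ => Finset.sum_nonneg fun n _ => norm_nonneg _) (Finset.mem_univ i)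
          _ ≤ C * R ^ N := le_mul_of_one_le_right hC (one_le_pow₀ hR1)
      · push Not at hN
        obtain ⟨N, rfl⟩ : ∃ m, N = m + 1 := ⟨N - 1, by omega⟩
        set B := C * R ^ N with hB
        have hB0 : 0 ≤ B := by positivity
        have hsmall : ∀ n ≤ N, ∀ j, ‖φ (PowerSeries.coeff n (s j))‖ ≤ B := fun n hn j =>
          (ih n (by omega) j).trans (mul_le_mul_of_nonneg_left (pow_le_pow_right₀ hR1 hn) hC)
        have hM1 : 1 ≤ 1 + ∑ j, M i j :=
          le_add_of_nonneg_right (Finset.sum_nonneg fun j _ => hM i j)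
        have h1 : ‖φ (PowerSeries.coeff (N + 1) (s i))‖ ≤ L i * ((1 + ∑ j, M i j) * B) := by
          refine hbd i (s i) (N + 1) _ (by positivity) (fun n hn => ?_) ?_
          · exact (hsmall n (by omega) i).trans (le_mul_of_one_le_left hB0 hM1)
          · rw [← Algebra.smul_def, ← hc, map_sum, map_sum]
            refine (norm_sum_le _ _).trans ?_
            rw [add_mul, one_mul, Finset.sum_mul]
            refine le_trans (Finset.sum_le_sum fun j _ => ?_) (le_add_of_nonneg_left hB0)
            rw [Algebra.smul_def]
            refine hcM i j _ _ B hB0 fun n hn => ?_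
            rw [coeff_sg]
            split_ifs with hdiv
            · refine hsmall _ ?_ j
              have h2 : n / q ≤ n / 2 := Nat.div_le_div_left hq (by norm_num)
              have h3 := hV i
              omega
            · rw [map_zero, norm_zero]
              exact hB0
        calc _ ≤ L i * ((1 + ∑ j, M i j) * B) := h1
          _ = (L i * (1 + ∑ j, M i j)) * B := by ring
          _ ≤ R * B := mul_le_mul_of_nonneg_right (hR i) hB0
          _ = C * R ^ (N + 1) := by rw [hB]; ring
  have hR0 : 0 < R := by linarith
  refine ⟨(2 * R)⁻¹, by positivity, inv_lt_one_of_one_lt₀ (by linarith), fun i => ?_⟩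
  refine Summable.of_nonneg_of_le (fun n => by positivity) (fun n => ?_)
    ((summable_geometric_of_lt_one (r := (1 / 2 : ℝ)) (by norm_num) (by norm_num)).mul_left C)
  calc _ ≤ C * R ^ n * (2 * R)⁻¹ ^ n :=
        mul_le_mul_of_nonneg_right (key n i) (by positivity)
    _ = C * (1 / 2) ^ n := by
      rw [mul_assoc, ← mul_pow]
      congr 2
      field_simp

/-- A finite family of Mahler series is governed by an invertible convergent Mahler system. -/
theorem exists_mahler_structure (φ : k →+* ℂ) (hq : 2 ≤ q) {ι : Type*} [Finite ι]
    {g : ι → PowerSeries k} (hg : ∀ i, IsMahler q (g i)) :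
    ∃ (n : ℕ) (h : Fin n → PowerSeries k) (a : k[X]) (A : Matrix (Fin n) (Fin n) k[X]) (ρ : ℝ),
      LinearIndependent k[X] h ∧ a ≠ 0 ∧ A.det ≠ 0 ∧
      (∀ i, algebraMap k[X] (PowerSeries k) a * h i =
        ∑ j, algebraMap k[X] (PowerSeries k) (A i j) * sg q (h j)) ∧
      0 < ρ ∧ ρ < 1 ∧ (∀ i, Conv φ ρ (h i)) ∧ (∀ m, Conv φ ρ (g m)) ∧
      ∀ m l, g m ∈ satur (Set.range fun i => (sg q)^[l] (h i)) := by
  obtain ⟨S, hS, hst, hgS⟩ := exists_stable_of_family hg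
  obtain ⟨n, h, hhS, hh, hsat⟩ := exists_linearIndependent_satur hS
  have hrange : Set.range h ⊆ S := by rintro _ ⟨i, rfl⟩; exact hhS i
  have hsth : Stable q (Set.range h) := by
    rintro _ ⟨i, rfl⟩
    exact satur_le hsat (hst _ (hhS i))
  obtain ⟨a, A, ha, hA, hsys⟩ := exists_system hh hsth
  have hmem : ∀ x ∈ S, ∀ l, x ∈ satur (Set.range fun i => (sg q)^[l] (h i)) := fun x hx l =>
    mem_satur_sg_iterate ha hsys (hsat hx) l
  have : Fintype S := hS.fintype
  obtain ⟨ρ, hρ0, hρ1, hρ⟩ := exists_conv (q := q) φ hq (s := fun x : S => (x : PowerSeries k)) (by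
    intro x
    refine satur_mono ?_ (hmem x x.2 1)
    rintro _ ⟨i, rfl⟩
    exact ⟨⟨h i, hhS i⟩, rfl⟩)
  exact ⟨n, h, a, A, ρ, hh, ha, hA, hsys, hρ0, hρ1, fun i => hρ ⟨_, hhS i⟩,
    fun m => hρ ⟨_, hgS m⟩, fun m l => hmem _ (hgS m) l⟩

end Convergence

section Descent

variable {k K : Type*} [Field k] [Field K] {q : ℕ} [NeZero q]

lemma val_map (φ : K →+* ℂ) (i : k →+* K) (f : PowerSeries k) (z : ℂ) :
    val φ (PowerSeries.map i f) z = val (φ.comp i) f z := by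
  simp [val]

lemma conv_map {φ : K →+* ℂ} {i : k →+* K} {r : ℝ} {f : PowerSeries k} :
    Conv φ r (PowerSeries.map i f) ↔ Conv (φ.comp i) r f := by
  simp [Conv]

variable [Algebra k K]

lemma map_system {n : ℕ} {h : Fin n → PowerSeries k} {a : k[X]} {A : Matrix (Fin n) (Fin n) k[X]}
    (hsys : ∀ i, algebraMap k[X] (PowerSeries k) a * h i =
      ∑ j, algebraMap k[X] (PowerSeries k) (A i j) * sg q (h j)) (φ : k →+* K) (i : Fin n) :
    algebraMap K[X] (PowerSeries K) (a.map φ) * PowerSeries.map φ (h i) =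
      ∑ j, algebraMap K[X] (PowerSeries K) ((mapRingHom φ).mapMatrix A i j) *
        sg q (PowerSeries.map φ (h j)) := by
  have := congrArg (PowerSeries.map φ) (hsys i)
  simp only [map_mul, map_sum, map_algebraMap_polynomial, map_sg] at this
  exact this

/-- Linear independence of values over a number field containing the base field. -/
theorem eq_zero_of_sum_val_eq_zero_of_algebra [NumberField K] {φ : K →+* ℂ} (hq : 2 ≤ q)
    {n : ℕ} {h : Fin n → PowerSeries k} {a : k[X]} {A : Matrix (Fin n) (Fin n) k[X]}
    (hh : LinearIndependent k[X] h)
    (hsys : ∀ i, algebraMap k[X] (PowerSeries k) a * h i =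
      ∑ j, algebraMap k[X] (PowerSeries k) (A i j) * sg q (h j))
    {β : k} (hβ0 : β ≠ 0) (hβ1 : ‖φ (algebraMap k K β)‖ < 1)
    (hconv : ∀ i, Conv (φ.comp (algebraMap k K)) ‖φ (algebraMap k K β)‖ (h i))
    (hdet : ∀ m, A.det.eval (β ^ q ^ m) ≠ 0) {τ : Fin n → K}
    (hτ : ∑ i, φ (τ i) * val (φ.comp (algebraMap k K)) (h i) (φ (algebraMap k K β)) = 0) :
    τ = 0 := by
  have hq0 : NeZero ((q : ℕ) : K) := ⟨Nat.cast_ne_zero.2 (NeZero.ne q)⟩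
  let L := CyclotomicField q K
  have : NumberField L := IsCyclotomicExtension.numberField {q} K L
  have hζ := IsCyclotomicExtension.zeta_spec q K L
  let : Algebra K ℂ := φ.toAlgebra
  let Φ : L →ₐ[K] ℂ := IsAlgClosed.lift
  let j : k →+* L := (algebraMap K L).comp (algebraMap k K)
  have hΦK : ∀ x : K, Φ (algebraMap K L x) = φ x := fun x => Φ.commutes x
  have hΦ : (Φ : L →+* ℂ).comp j = φ.comp (algebraMap k K) := RingHom.ext fun x => hΦK _
  have hβ : (Φ : L →+* ℂ) (j β) = φ (algebraMap k K β) := hΦK _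
  have hmap : ∀ f : PowerSeries k, PowerSeries.map j f =
      PowerSeries.map (algebraMap K L) (PowerSeries.map (algebraMap k K) f) := fun f => by
    ext n
    simp [j]
  have hli : LinearIndependent L[X] fun i => PowerSeries.map j (h i) := by
    simp only [hmap]
    exact linearIndependent_map K L (linearIndependent_map k K hh)
  have h0 := eq_zero_of_sum_val_eq_zero (φ := (Φ : L →+* ℂ)) hq hζ hli (map_system hsys j)
    (β := j β) ((map_ne_zero j).2 hβ0) (by rw [hβ]; exact hβ1)
    (fun i => by rw [hβ, conv_map, hΦ]; exact hconv i)
    (fun m => by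
      rw [← RingHom.map_det, coe_mapRingHom, ← map_pow, eval_map_apply]
      exact (map_ne_zero j).2 (hdet m))
    (τ := fun i => algebraMap K L (τ i))
    (by
      rw [← hτ]
      refine Finset.sum_congr rfl fun i _ => ?_
      rw [val_map, hΦ, hβ]
      congr 1
      exact hΦK _)
  ext i
  exact (map_eq_zero (algebraMap K L)).1 (congrFun h0 i)

end Descent

section Continuation

variable {k : Type*} [Field k] {q : ℕ} [NeZero q] {ψ : k →+* ℂ}

lemma analyticAt_val {ρ : ℝ} {f : PowerSeries k} (hf : Conv ψ ρ f) {z : ℂ} (hz : ‖z‖ < ρ) :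
    AnalyticAt ℂ (val ψ f) z := by
  have h1 : DifferentiableOn ℂ (fun z => ∑' n, ψ (PowerSeries.coeff n f) * z ^ n)
      (Metric.ball 0 ρ) := by
    refine Complex.differentiableOn_tsum_of_summable_norm hf (fun n => ?_) Metric.isOpen_ball
      fun n w hw => ?_
    · fun_prop
    · rw [norm_mul, norm_pow]
      refine mul_le_mul_of_nonneg_left (pow_le_pow_left₀ (norm_nonneg _) ?_ n) (norm_nonneg _)
      exact (mem_ball_zero_iff.1 hw).le
  exact h1.analyticAt (Metric.isOpen_ball.mem_nhds (mem_ball_zero_iff.2 hz))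

lemma analyticAt_eval₂ (p : k[X]) (z : ℂ) : AnalyticAt ℂ (fun z => p.eval₂ ψ z) z := by
  simp only [eval₂_eq_eval_map]
  exact (Polynomial.differentiable (p.map ψ)).analyticAt z

lemma eventually_eval₂_ne_zero {p : k[X]} (hp : p ≠ 0) (z : ℂ) :
    ∀ᶠ w in nhdsWithin z {z}ᶜ, p.eval₂ ψ w ≠ 0 := by
  have hp' : p.map ψ ≠ 0 := (Polynomial.map_ne_zero_iff ψ.injective).2 hp
  have h1 : {w | (p.map ψ).IsRoot w}.Finite := Polynomial.finite_setOfPred_isRoot hp'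
  have h2 : ({w | (p.map ψ).IsRoot w} \ {z})ᶜ ∈ nhds z :=
    (h1.subset Set.sdiff_subset).isClosed.isOpen_compl.mem_nhds (by simp)
  filter_upwards [mem_nhdsWithin_of_mem_nhds h2, self_mem_nhdsWithin] with w hw hw' h0
  exact hw ⟨by simpa [IsRoot, eval₂_eq_eval_map] using h0, hw'⟩

variable (q ψ) in
/-- The analytic function represented by `∑ bᵢ(z) hᵢ(z^{q^l})`. -/
def combVal {n : ℕ} (h : Fin n → PowerSeries k) (l : ℕ) (b : Fin n → k[X]) (z : ℂ) : ℂ :=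
  ∑ i, (b i).eval₂ ψ z * val ψ (h i) (z ^ q ^ l)

lemma analyticAt_combVal {n : ℕ} {h : Fin n → PowerSeries k} {ρ : ℝ}
    (hconv : ∀ i, Conv ψ ρ (h i)) (l : ℕ) (b : Fin n → k[X]) {z : ℂ} (hz : ‖z‖ ^ q ^ l < ρ) :
    AnalyticAt ℂ (combVal q ψ h l b) z := by
  unfold combVal
  refine Finset.analyticAt_fun_sum _ fun i _ => (analyticAt_eval₂ (b i) z).mul ?_
  refine AnalyticAt.fun_comp (f := fun z : ℂ => z ^ q ^ l) ?_ (by fun_prop)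
  exact analyticAt_val (hconv i) (by rwa [norm_pow])

lemma Conv.sg_iterate {f : PowerSeries k} {r : ℝ} (l : ℕ) (hf : Conv ψ (r ^ q ^ l) f) :
    Conv ψ r ((MahlerLift.sg q)^[l] f) := by
  induction l generalizing r with
  | zero => simpa using hf
  | succ l ih =>
    rw [Function.iterate_succ_apply']
    refine Conv.sg q (ih ?_)
    rwa [← pow_mul, ← pow_succ']

lemma val_sg_iterate (f : PowerSeries k) (l : ℕ) (z : ℂ) :
    val ψ ((sg q)^[l] f) z = val ψ f (z ^ q ^ l) := by
  induction l generalizing z with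
  | zero => simp
  | succ l ih => rw [Function.iterate_succ_apply', val_sg, ih, ← pow_mul, ← pow_succ']

lemma conv_comb {n : ℕ} {h : Fin n → PowerSeries k} {ρ : ℝ} (hconv : ∀ i, Conv ψ ρ (h i))
    (l : ℕ) (b : Fin n → k[X]) {r : ℝ} (hr : 0 ≤ r) (hrl : r ^ q ^ l ≤ ρ) :
    Conv ψ r (∑ i, b i • (sg q)^[l] (h i)) := by
  have h1 : ∑ i, b i • (sg q)^[l] (h i) ∈ convSub ψ hr :=
    sum_mem fun i _ => Subalgebra.smul_mem _
      (show Conv ψ r _ from ((hconv i).mono (by positivity) hrl).sg_iterate l) _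
  exact h1

lemma val_comb {n : ℕ} {h : Fin n → PowerSeries k} {ρ : ℝ} (hconv : ∀ i, Conv ψ ρ (h i))
    (l : ℕ) (b : Fin n → k[X]) {z : ℂ} (hz : ‖z‖ ^ q ^ l ≤ ρ) :
    val ψ (∑ i, b i • (sg q)^[l] (h i)) z = combVal q ψ h l b z := by
  have h1 : ∀ i, Conv ψ ‖z‖ ((sg q)^[l] (h i)) := fun i =>
    ((hconv i).mono (by positivity) hz).sg_iterate l
  simp only [Algebra.smul_def]
  rw [val_sum (norm_nonneg z) _ (fun i => (conv_polynomial _ _).mul (norm_nonneg z) (h1 i)) le_rfl]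
  refine Finset.sum_congr rfl fun i _ => ?_
  rw [val_mul (conv_polynomial _ _) (h1 i) le_rfl, val_polynomial, val_sg_iterate]

lemma eval₂_mul_val {ρ : ℝ} {n : ℕ} {h : Fin n → PowerSeries k} (hconv : ∀ i, Conv ψ ρ (h i))
    {g : PowerSeries k} {l : ℕ} {D : k[X]} {b : Fin n → k[X]}
    (hD : D • g = ∑ i, b i • (sg q)^[l] (h i)) {z : ℂ} (hz : ‖z‖ ^ q ^ l ≤ ρ)
    (hg : Conv ψ ‖z‖ g) : D.eval₂ ψ z * val ψ g z = combVal q ψ h l b z := by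
  rw [← val_comb hconv l b hz, ← hD, Algebra.smul_def,
    val_mul (conv_polynomial _ _) hg le_rfl, val_polynomial]

lemma eval₂_mul_combVal_comm {ρ : ℝ} {n : ℕ} {h : Fin n → PowerSeries k}
    (hconv : ∀ i, Conv ψ ρ (h i)) {g : PowerSeries k} {l l' : ℕ} {D D' : k[X]}
    {b b' : Fin n → k[X]} (hD : D • g = ∑ i, b i • (sg q)^[l] (h i))
    (hD' : D' • g = ∑ i, b' i • (sg q)^[l'] (h i)) {z : ℂ} (hz : ‖z‖ ^ q ^ l ≤ ρ)
    (hz' : ‖z‖ ^ q ^ l' ≤ ρ) :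
    D'.eval₂ ψ z * combVal q ψ h l b z = D.eval₂ ψ z * combVal q ψ h l' b' z := by
  rw [← val_comb hconv l b hz, ← val_comb hconv l' b' hz', ← val_polynomial, ← val_polynomial,
    ← val_mul (conv_polynomial _ _) (conv_comb hconv l b (norm_nonneg z) hz) le_rfl,
    ← val_mul (conv_polynomial _ _) (conv_comb hconv l' b' (norm_nonneg z) hz') le_rfl,
    ← Algebra.smul_def, ← Algebra.smul_def, ← hD, ← hD', smul_comm]

/-- Meromorphic continuation of a Mahler series to the unit disk, given by its expressions. -/
lemma exists_continuation (hq : 2 ≤ q) {ρ : ℝ} (hρ0 : 0 < ρ) {n : ℕ}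
    {h : Fin n → PowerSeries k} (hconv : ∀ i, Conv ψ ρ (h i)) {g : PowerSeries k}
    (hg : Conv ψ ρ g) (hmem : ∀ l, g ∈ satur (Set.range fun i => (sg q)^[l] (h i))) :
    ∃ F : ℂ → ℂ, MeromorphicOn F (Metric.ball 0 1) ∧ (∀ z, ‖z‖ < ρ → F z = val ψ g z) ∧
      ∀ (l : ℕ) (D : k[X]) (b : Fin n → k[X]), D • g = ∑ i, b i • (sg q)^[l] (h i) →
        ∀ z, ‖z‖ ^ q ^ l < ρ → D.eval₂ ψ z ≠ 0 → F z = combVal q ψ h l b z / D.eval₂ ψ z := by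
  classical
  let P : ℂ → ℂ → Prop := fun z v => ∃ (l : ℕ) (D : k[X]) (b : Fin n → k[X]),
    D • g = ∑ i, b i • (sg q)^[l] (h i) ∧ ‖z‖ ^ q ^ l < ρ ∧ D.eval₂ ψ z ≠ 0 ∧
      v = combVal q ψ h l b z / D.eval₂ ψ z
  let F : ℂ → ℂ := fun z => if ‖z‖ < ρ then val ψ g z else
    if hv : ∃ v, P z v then hv.choose else 0
  have hF : ∀ (l : ℕ) (D : k[X]) (b : Fin n → k[X]), D • g = ∑ i, b i • (sg q)^[l] (h i) →
        ∀ z, ‖z‖ ^ q ^ l < ρ → D.eval₂ ψ z ≠ 0 →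
          F z = combVal q ψ h l b z / D.eval₂ ψ z := by
    intro l D b hD z hz hDz
    by_cases hzρ : ‖z‖ < ρ
    · have : F z = val ψ g z := if_pos hzρ
      rw [this, eq_div_iff hDz, mul_comm]
      exact eval₂_mul_val hconv hD hz.le (hg.mono (norm_nonneg z) hzρ.le)
    · have hv : ∃ v, P z v := ⟨_, l, D, b, hD, hz, hDz, rfl⟩
      have h1 : F z = hv.choose := by
        simp only [F, if_neg hzρ, dif_pos hv]
      obtain ⟨l', D', b', hD', hz', hDz', hval⟩ := hv.choose_spec
      rw [h1, hval, div_eq_div_iff hDz' hDz, mul_comm,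
        eval₂_mul_combVal_comm hconv hD' hD hz'.le hz.le, mul_comm]
  refine ⟨F, fun z hz => ?_, fun z hz => if_pos hz, hF⟩
  rw [mem_ball_zero_iff] at hz
  have h1 : ∀ᶠ l : ℕ in Filter.atTop, ‖z‖ ^ q ^ l < ρ :=
    ((tendsto_pow_atTop_nhds_zero_of_lt_one (norm_nonneg z) hz).comp
      (tendsto_pow_atTop_atTop_of_one_lt (by omega))).eventually_lt_const hρ0
  obtain ⟨l, hl⟩ := h1.exists
  obtain ⟨D, hD0, hD⟩ := mem_satur.1 (hmem l)
  obtain ⟨b, hb⟩ := (Submodule.mem_span_range_iff_exists_fun _).1 hD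
  have h2 : MeromorphicAt (fun w => combVal q ψ h l b w / D.eval₂ ψ w) z :=
    (analyticAt_combVal hconv l b hl).meromorphicAt.div (analyticAt_eval₂ D z).meromorphicAt
  refine h2.congr ?_
  have h3 : ∀ᶠ w in nhds z, ‖w‖ ^ q ^ l < ρ :=
    ((continuous_norm.pow (q ^ l)).tendsto z).eventually_lt_const hl
  filter_upwards [eventually_eval₂_ne_zero hD0 z, mem_nhdsWithin_of_mem_nhds h3] with w hw hw'
  exact (hF l D b hb.symm w hw' hw).symm

/-- Identity theorem: an identity `P F = H` valid near `0` persists at a point of analyticity. -/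
lemma eval₂_mul_eq_of_eventually {R : ℝ} (hR1 : R ≤ 1) {F H : ℂ → ℂ} {P : k[X]} {α : ℂ}
    (hα : ‖α‖ < R) (hF : MeromorphicOn F (Metric.ball 0 1)) (hFα : AnalyticAt ℂ F α)
    (hH : ∀ z, ‖z‖ < R → AnalyticAt ℂ H z)
    (h0 : ∀ᶠ z in nhds 0, P.eval₂ ψ z * F z = H z) : P.eval₂ ψ α * F α = H α := by
  let E : ℂ → ℂ := fun z => P.eval₂ ψ z * F z - H z
  have hE : MeromorphicOn E (Metric.ball 0 R) := fun z hz => by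
    refine MeromorphicAt.fun_sub (MeromorphicAt.fun_mul (analyticAt_eval₂ P z).meromorphicAt ?_) ?_
    · exact hF z (Metric.ball_subset_ball hR1 hz)
    · exact (hH z (mem_ball_zero_iff.1 hz)).meromorphicAt
  have hR0 : 0 < R := (norm_nonneg α).trans_lt hα
  have h1 : meromorphicOrderAt E α = ⊤ := by
    by_contra h
    have h2 := hE.meromorphicOrderAt_ne_top_of_isPreconnected
      (convex_ball (0 : ℂ) R).isPreconnected (mem_ball_zero_iff.2 hα)
      (Metric.mem_ball_self hR0) h
    apply h2
    rw [meromorphicOrderAt_eq_top_iff]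
    exact mem_nhdsWithin_of_mem_nhds (h0.mono fun z hz => sub_eq_zero.2 hz)
  rw [meromorphicOrderAt_eq_top_iff] at h1
  have hEα : AnalyticAt ℂ E α := ((analyticAt_eval₂ P α).mul hFα).sub (hH α hα)
  have h3 := hEα.continuousAt.tendsto.mono_left (nhdsWithin_le_nhds (s := {α}ᶜ))
  have h4 : Filter.Tendsto E (nhdsWithin α {α}ᶜ) (nhds 0) :=
    tendsto_const_nhds.congr' (h1.mono fun z hz => hz.symm)
  exact sub_eq_zero.1 (tendsto_nhds_unique h3 h4)

end Continuation

section Values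

variable {k K : Type*} [Field k] [Field K] [Algebra k K] {q : ℕ} [NeZero q]

lemma IsMahler.sub {f g : PowerSeries k} (hf : IsMahler q f) (hg : IsMahler q g) :
    IsMahler q (f - g) := by
  obtain ⟨S, hS, hst, hmem⟩ := exists_stable_of_family (q := q) (g := ![f, g])
    (by intro i; fin_cases i <;> assumption)
  exact hst.isMahler hS (sub_mem (subset_satur S (hmem 0)) (subset_satur S (hmem 1)))

lemma exists_common_relation {d n : ℕ} {v : Fin n → PowerSeries k} {g : Fin d → PowerSeries k}
    (hg : ∀ m, g m ∈ satur (Set.range v)) :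
    ∃ (D : k[X]) (b : Fin d → Fin n → k[X]), D ≠ 0 ∧ ∀ m, D • g m = ∑ i, b m i • v i := by
  have hrel : ∀ m, ∃ D : k[X], D ≠ 0 ∧ ∃ c : Fin n → k[X], D • g m = ∑ j, c j • v j := by
    intro m
    obtain ⟨D, hD, hmem⟩ := mem_satur.1 (hg m)
    obtain ⟨c, hc⟩ := (Submodule.mem_span_range_iff_exists_fun _).1 hmem
    exact ⟨D, hD, c, hc.symm⟩
  choose D hD c hc using hrel
  refine ⟨∏ m, D m, fun m i => (∏ m' ∈ Finset.univ.erase m, D m') * c m i,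
    Finset.prod_ne_zero_iff.2 fun m _ => hD m, fun m => ?_⟩
  simp only [mul_smul]
  rw [← Finset.smul_sum, ← hc, smul_smul, Finset.prod_erase_mul _ _ (Finset.mem_univ m)]

lemma exists_regular_index (hq : 2 ≤ q) {p : k[X]} (hp : p ≠ 0) {ψ : k →+* ℂ} {β : k}
    (hβ0 : β ≠ 0) (hβ1 : ‖ψ β‖ < 1) {ρ : ℝ} (hρ : 0 < ρ) :
    ∃ l : ℕ, ‖ψ β‖ ^ q ^ l < ρ ∧ ∀ m, p.eval ((β ^ q ^ l) ^ q ^ m) ≠ 0 := by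
  have hinj : Function.Injective fun j : ℕ => β ^ q ^ j := fun i j hij => by
    have h1 : ‖ψ β‖ ^ q ^ i = ‖ψ β‖ ^ q ^ j := by
      rw [← norm_pow, ← norm_pow, ← map_pow, ← map_pow]
      exact congrArg (fun x => ‖ψ x‖) hij
    exact Nat.pow_right_injective hq (pow_right_injective₀
      (norm_pos_iff.2 ((map_ne_zero ψ).2 hβ0)) hβ1.ne h1)
  have hfin : {j : ℕ | p.IsRoot (β ^ q ^ j)}.Finite :=
    (Polynomial.finite_setOfPred_isRoot hp).preimage hinj.injOn
  obtain ⟨N, hN⟩ := hfin.bddAbove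
  have h1 : ∀ᶠ l : ℕ in Filter.atTop, ‖ψ β‖ ^ q ^ l < ρ :=
    ((tendsto_pow_atTop_nhds_zero_of_lt_one (norm_nonneg _) hβ1).comp
      (tendsto_pow_atTop_atTop_of_one_lt (by omega))).eventually_lt_const hρ
  obtain ⟨l, hl, hlN⟩ := (h1.and (Filter.eventually_gt_atTop N)).exists
  refine ⟨l, hl, fun m h0 => ?_⟩
  rw [← pow_mul, ← pow_add] at h0
  have := hN (show l + m ∈ {j : ℕ | p.IsRoot (β ^ q ^ j)} from h0)
  omega

lemma eval₂_mul_eq_sum_combVal {ψ : k →+* ℂ} {ρ : ℝ} (hρ0 : 0 < ρ) (hρ1 : ρ < 1) {n : ℕ}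
    {h : Fin n → PowerSeries k} (hconv : ∀ i, Conv ψ ρ (h i)) {d : ℕ} {g : Fin d → PowerSeries k}
    (hg : ∀ m, Conv ψ ρ (g m)) {l : ℕ} {D : k[X]} {b : Fin d → Fin n → k[X]}
    (hD : ∀ m, D • g m = ∑ i, b m i • (sg q)^[l] (h i)) {α : ℂ} (hα : ‖α‖ ^ q ^ l < ρ)
    {c : Fin d → ℂ} {F : ℂ → ℂ} (hF : MeromorphicOn F (Metric.ball 0 1)) (hFα : AnalyticAt ℂ F α)
    (hF0 : ∀ᶠ z in nhds 0, F z = ∑ m, c m * val ψ (g m) z) :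
    D.eval₂ ψ α * F α = ∑ m, c m * combVal q ψ h l (b m) α := by
  have hN : q ^ l ≠ 0 := pow_ne_zero _ (NeZero.ne q)
  let R : ℝ := ρ ^ ((q ^ l : ℕ) : ℝ)⁻¹
  have hR : R ^ q ^ l = ρ := Real.rpow_inv_natCast_pow hρ0.le hN
  have hR0 : 0 ≤ R := Real.rpow_nonneg hρ0.le _
  have hR1 : R ≤ 1 := Real.rpow_le_one hρ0.le hρ1.le (by positivity)
  have hRz : ∀ z : ℂ, ‖z‖ < R → ‖z‖ ^ q ^ l < ρ := fun z hz => by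
    rw [← hR]
    exact pow_lt_pow_left₀ hz (norm_nonneg z) hN
  refine eval₂_mul_eq_of_eventually (H := fun z => ∑ m, c m * combVal q ψ h l (b m) z) hR1
    (lt_of_pow_lt_pow_left₀ (q ^ l) hR0 (by rwa [hR])) hF hFα
    (fun z hz => Finset.analyticAt_fun_sum _ fun m _ =>
      analyticAt_const.mul (analyticAt_combVal hconv l (b m) (hRz z hz))) ?_
  have hball : ∀ᶠ z : ℂ in nhds 0, ‖z‖ < ρ :=
    (continuous_norm.tendsto' (0 : ℂ) 0 norm_zero).eventually_lt_const hρ0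
  filter_upwards [hF0, hball] with z hz hzρ
  rw [hz, Finset.mul_sum]
  refine Finset.sum_congr rfl fun m _ => ?_
  have hz1 : ‖z‖ ^ q ^ l ≤ ρ :=
    (pow_le_of_le_one (norm_nonneg z) (hzρ.trans hρ1).le hN).trans hzρ.le
  rw [← eval₂_mul_val hconv (hD m) hz1 ((hg m).mono (norm_nonneg z) hzρ.le)]
  ring

variable {φ : K →+* ℂ}

lemma sum_mul_combVal {n : ℕ} (h : Fin n → PowerSeries k) {d : ℕ} (w : Fin d → K) (l : ℕ)
    (b : Fin d → Fin n → k[X]) (β : k) :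
    ∑ m, φ (w m) * combVal q (φ.comp (algebraMap k K)) h l (b m) (φ (algebraMap k K β)) =
      ∑ i, φ (∑ m, (b m i).eval β • w m) *
        val (φ.comp (algebraMap k K)) (h i) (φ (algebraMap k K (β ^ q ^ l))) := by
  simp only [combVal, Finset.mul_sum, map_sum, Finset.sum_mul]
  rw [Finset.sum_comm]
  refine Finset.sum_congr rfl fun i _ => Finset.sum_congr rfl fun m _ => ?_
  have h1 : (b m i).eval₂ (φ.comp (algebraMap k K)) (φ (algebraMap k K β)) =
      φ (algebraMap k K ((b m i).eval β)) :=
    Polynomial.eval₂_at_apply (φ.comp (algebraMap k K)) β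
  rw [h1, Algebra.smul_def, map_mul, map_pow, map_pow]
  ring

/-- The denominator of the family can be chosen not to vanish at a point where the combination
of the family with a basis is analytic. -/
lemma exists_relation_eval_ne_zero {ρ : ℝ} (hρ0 : 0 < ρ) (hρ1 : ρ < 1) {n : ℕ}
    {h : Fin n → PowerSeries k} (hconv : ∀ i, Conv (φ.comp (algebraMap k K)) ρ (h i))
    {d : ℕ} {w : Fin d → K} (hw : LinearIndependent k w) {g : Fin d → PowerSeries k}
    (hg : ∀ m, Conv (φ.comp (algebraMap k K)) ρ (g m)) {l : ℕ} {β : k}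
    (hβ : ‖φ (algebraMap k K β)‖ ^ q ^ l < ρ)
    (hLT : ∀ τ : Fin n → K, ∑ i, φ (τ i) *
      val (φ.comp (algebraMap k K)) (h i) (φ (algebraMap k K (β ^ q ^ l))) = 0 → τ = 0)
    (hmem : ∀ m, g m ∈ satur (Set.range fun i => (sg q)^[l] (h i)))
    {F : ℂ → ℂ} (hF : MeromorphicOn F (Metric.ball 0 1))
    (hFα : AnalyticAt ℂ F (φ (algebraMap k K β)))
    (hF0 : ∀ᶠ z in nhds 0, F z = ∑ m, φ (w m) * val (φ.comp (algebraMap k K)) (g m) z) :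
    ∃ (D : k[X]) (b : Fin d → Fin n → k[X]), D.eval β ≠ 0 ∧
      ∀ m, D • g m = ∑ i, b m i • (sg q)^[l] (h i) := by
  obtain ⟨D, b, hD0, hD⟩ := exists_common_relation hmem
  induction hN : D.natDegree using Nat.strong_induction_on generalizing D b with
  | _ N ih =>
    by_cases hDβ : D.eval β = 0
    swap
    · exact ⟨D, b, hDβ, hD⟩
    have h1 := eval₂_mul_eq_sum_combVal hρ0 hρ1 hconv hg hD hβ hF hFα hF0
    rw [sum_mul_combVal h w l b β] at h1
    have h2 : D.eval₂ (φ.comp (algebraMap k K)) (φ (algebraMap k K β)) = 0 := by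
      have := Polynomial.eval₂_at_apply (p := D) (φ.comp (algebraMap k K)) β
      rw [hDβ, map_zero] at this
      exact this
    rw [h2, zero_mul] at h1
    have h3 := hLT _ h1.symm
    have hb0 : ∀ m i, (b m i).IsRoot β := fun m i =>
      Fintype.linearIndependent_iff.1 hw _ (congrFun h3 i) m
    choose b' hb' using fun m i => dvd_iff_isRoot.2 (hb0 m i)
    obtain ⟨D', hD'⟩ := dvd_iff_isRoot.2 hDβ
    have hD'0 : D' ≠ 0 := by
      rintro rfl
      exact hD0 (by rw [hD', mul_zero])
    refine ih D'.natDegree ?_ D' b' hD'0 (fun m => ?_) rfl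
    · rw [← hN, hD', natDegree_mul (X_sub_C_ne_zero β) hD'0, natDegree_X_sub_C]
      omega
    · have h4 := hD m
      rw [hD', mul_smul] at h4
      simp only [hb', mul_smul] at h4
      rw [← Finset.smul_sum] at h4
      have h5 : algebraMap k[X] (PowerSeries k) (X - C β) ≠ 0 := by
        rw [algebraMap_eq_coe, ne_eq, Polynomial.coe_eq_zero_iff]
        exact X_sub_C_ne_zero β
      rw [Algebra.smul_def, Algebra.smul_def (X - C β)] at h4
      exact mul_left_cancel₀ h5 h4

variable [NumberField K]

lemma exists_regular_structure (hq : 2 ≤ q) {d : ℕ} {g : Fin d → PowerSeries k}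
    (hg : ∀ m, IsMahler q (g m)) {β : k} (hβ0 : β ≠ 0) (hβ1 : ‖φ (algebraMap k K β)‖ < 1) :
    ∃ (n : ℕ) (h : Fin n → PowerSeries k) (ρ : ℝ) (l : ℕ), 0 < ρ ∧ ρ < 1 ∧
      (∀ i, Conv (φ.comp (algebraMap k K)) ρ (h i)) ∧
      (∀ m, Conv (φ.comp (algebraMap k K)) ρ (g m)) ∧
      (∀ m l, g m ∈ satur (Set.range fun i => (sg q)^[l] (h i))) ∧
      ‖φ (algebraMap k K β)‖ ^ q ^ l < ρ ∧
      ∀ τ : Fin n → K, ∑ i, φ (τ i) *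
        val (φ.comp (algebraMap k K)) (h i) (φ (algebraMap k K (β ^ q ^ l))) = 0 → τ = 0 := by
  obtain ⟨n, h, a, A, ρ, hh, ha, hA, hsys, hρ0, hρ1, hconv, hgconv, hmem⟩ :=
    exists_mahler_structure (φ.comp (algebraMap k K)) hq hg
  obtain ⟨l, hl, hdet⟩ := exists_regular_index hq hA (ψ := φ.comp (algebraMap k K)) hβ0 hβ1 hρ0
  have hnorm : ‖φ (algebraMap k K (β ^ q ^ l))‖ = ‖φ (algebraMap k K β)‖ ^ q ^ l := by
    rw [map_pow, map_pow, norm_pow]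
  refine ⟨n, h, ρ, l, hρ0, hρ1, hconv, hgconv, hmem, hl, fun τ hτ => ?_⟩
  refine eq_zero_of_sum_val_eq_zero_of_algebra hq hh hsys (pow_ne_zero _ hβ0) ?_ (fun i => ?_)
    hdet hτ
  · rw [hnorm]
    exact hl.trans hρ1
  · refine (hconv i).mono (norm_nonneg _) ?_
    rw [hnorm]
    exact hl.le

/-- If a combination of Mahler functions with linearly independent coefficients is analytic
at an algebraic point, then so is every one of them. -/
theorem exists_analytic_continuations (hq : 2 ≤ q) {d : ℕ} {w : Fin d → K}
    (hw : LinearIndependent k w) {g : Fin d → PowerSeries k} (hg : ∀ m, IsMahler q (g m)) {β : k}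
    (hβ0 : β ≠ 0) (hβ1 : ‖φ (algebraMap k K β)‖ < 1) {F : ℂ → ℂ}
    (hF : MeromorphicOn F (Metric.ball 0 1)) (hFα : AnalyticAt ℂ F (φ (algebraMap k K β)))
    (hF0 : ∀ r : ℝ, 0 < r → (∀ m, Conv (φ.comp (algebraMap k K)) r (g m)) →
      ∀ᶠ z in nhds 0, F z = ∑ m, φ (w m) * val (φ.comp (algebraMap k K)) (g m) z) :
    ∃ G : Fin d → ℂ → ℂ, (∀ m, MeromorphicOn (G m) (Metric.ball 0 1)) ∧
      (∀ m, AnalyticAt ℂ (G m) (φ (algebraMap k K β))) ∧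
      (∀ m, ∀ᶠ z in nhds 0,
        HasSum (fun n => φ (algebraMap k K (PowerSeries.coeff n (g m))) * z ^ n) (G m z)) ∧
      F (φ (algebraMap k K β)) = ∑ m, φ (w m) * G m (φ (algebraMap k K β)) := by
  obtain ⟨n, h, ρ, l, hρ0, hρ1, hconv, hgconv, hmem, hl, hLT⟩ :=
    exists_regular_structure (K := K) (φ := φ) hq hg hβ0 hβ1
  have hF0' := hF0 ρ hρ0 hgconv
  obtain ⟨D, b, hDβ, hD⟩ := exists_relation_eval_ne_zero hρ0 hρ1 hconv hw hgconv hl hLT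
    (fun m => hmem m l) hF hFα hF0'
  choose G hGm hG0 hG using fun m => exists_continuation hq hρ0 hconv (hgconv m) (hmem m)
  have hDα : D.eval₂ (φ.comp (algebraMap k K)) (φ (algebraMap k K β)) ≠ 0 := by
    have := Polynomial.eval₂_at_apply (p := D) (φ.comp (algebraMap k K)) β
    rw [RingHom.comp_apply] at this
    rw [this]
    exact (_root_.map_ne_zero _).2 hDβ
  refine ⟨G, hGm, fun m => ?_, fun m => ?_, ?_⟩
  · have h1 : AnalyticAt ℂ (fun z => combVal q (φ.comp (algebraMap k K)) h l (b m) z /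
        D.eval₂ (φ.comp (algebraMap k K)) z) (φ (algebraMap k K β)) :=
      (analyticAt_combVal hconv l (b m) hl).fun_div (analyticAt_eval₂ D _) hDα
    refine h1.congr ?_
    have h2 : ∀ᶠ z in nhds (φ (algebraMap k K β)), ‖z‖ ^ q ^ l < ρ :=
      ((continuous_norm.pow (q ^ l)).tendsto _).eventually_lt_const hl
    filter_upwards [h2, (analyticAt_eval₂ D _).continuousAt.eventually_ne hDα] with z hz hz'
    exact (hG m l D (b m) (hD m) z hz hz').symm
  · have hball : ∀ᶠ z : ℂ in nhds 0, ‖z‖ < ρ :=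
      (continuous_norm.tendsto' (0 : ℂ) 0 norm_zero).eventually_lt_const hρ0
    filter_upwards [hball] with z hz
    rw [hG0 m z hz]
    exact (hgconv m).hasSum hz.le
  · have h1 := eval₂_mul_eq_sum_combVal hρ0 hρ1 hconv hgconv hD hl hF hFα hF0'
    apply mul_left_cancel₀ hDα
    rw [h1, Finset.mul_sum]
    refine Finset.sum_congr rfl fun m _ => ?_
    rw [hG m l D (b m) (hD m) _ hl hDα]
    field_simp

/-- Values of Mahler functions at an algebraic point satisfy no linear relation with coefficients
linearly independent over the field of coefficients, other than the trivial one. -/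
theorem eq_zero_of_sum_mul_eq_zero (hq : 2 ≤ q) {d : ℕ} {w : Fin d → K}
    (hw : LinearIndependent k w) {g : Fin d → PowerSeries k} (hg : ∀ m, IsMahler q (g m)) {β : k}
    (hβ0 : β ≠ 0) (hβ1 : ‖φ (algebraMap k K β)‖ < 1) {G : Fin d → ℂ → ℂ}
    (hG : ∀ m, MeromorphicOn (G m) (Metric.ball 0 1))
    (hGα : ∀ m, AnalyticAt ℂ (G m) (φ (algebraMap k K β)))
    (hG0 : ∀ m, ∀ᶠ z in nhds 0,
        HasSum (fun n => φ (algebraMap k K (PowerSeries.coeff n (g m))) * z ^ n) (G m z))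
    (h0 : ∑ m, φ (w m) * G m (φ (algebraMap k K β)) = 0) (m : Fin d) :
    G m (φ (algebraMap k K β)) = 0 := by
  obtain ⟨n, h, ρ, l, hρ0, hρ1, hconv, hgconv, hmem, hl, hLT⟩ :=
    exists_regular_structure (K := K) (φ := φ) hq hg hβ0 hβ1
  have hG0' : ∀ m, ∀ᶠ z in nhds 0, G m z = val (φ.comp (algebraMap k K)) (g m) z := fun m =>
    (hG0 m).mono fun z hz => hz.tsum_eq.symm
  let F : ℂ → ℂ := fun z => ∑ m, φ (w m) * G m z
  have hF : MeromorphicOn F (Metric.ball 0 1) := fun z hz =>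
    MeromorphicAt.fun_sum fun m _ => (MeromorphicAt.const _ z).fun_mul (hG m z hz)
  have hFα : AnalyticAt ℂ F (φ (algebraMap k K β)) :=
    Finset.analyticAt_fun_sum _ fun m _ => analyticAt_const.mul (hGα m)
  have hF0 : ∀ᶠ z in nhds 0, F z = ∑ m, φ (w m) * val (φ.comp (algebraMap k K)) (g m) z := by
    filter_upwards [Filter.eventually_all.2 hG0'] with z hz
    exact Finset.sum_congr rfl fun m _ => by rw [hz m]
  obtain ⟨D, b, hDβ, hD⟩ := exists_relation_eval_ne_zero hρ0 hρ1 hconv hw hgconv hl hLT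
    (fun m => hmem m l) hF hFα hF0
  have hDα : D.eval₂ (φ.comp (algebraMap k K)) (φ (algebraMap k K β)) ≠ 0 := by
    have := Polynomial.eval₂_at_apply (p := D) (φ.comp (algebraMap k K)) β
    rw [RingHom.comp_apply] at this
    rw [this]
    exact (_root_.map_ne_zero _).2 hDβ
  have h1 := eval₂_mul_eq_sum_combVal hρ0 hρ1 hconv hgconv hD hl hF hFα hF0
  rw [sum_mul_combVal h w l b β, show F (φ (algebraMap k K β)) = 0 from h0, mul_zero] at h1
  have h3 := hLT _ h1.symm
  have hb0 : ∀ m i, (b m i).eval β = 0 := fun m i =>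
    Fintype.linearIndependent_iff.1 hw _ (congrFun h3 i) m
  have h4 := eval₂_mul_eq_sum_combVal (c := fun _ : Fin 1 => 1) hρ0 hρ1 hconv
    (fun _ : Fin 1 => hgconv m) (fun _ => hD m) hl (hG m) (hGα m)
    ((hG0' m).mono fun z hz => by simpa using hz)
  have h5 : combVal q (φ.comp (algebraMap k K)) h l (b m) (φ (algebraMap k K β)) = 0 := by
    refine Finset.sum_eq_zero fun i _ => ?_
    have := Polynomial.eval₂_at_apply (p := b m i) (φ.comp (algebraMap k K)) β
    rw [RingHom.comp_apply, hb0, map_zero] at this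
    rw [this, zero_mul]
  simp only [h5, mul_zero, Finset.sum_const_zero] at h4
  exact (mul_eq_zero.1 h4).resolve_left hDα

end Values

section Subfields

variable {q : ℕ} [NeZero q]

lemma psSigma_eq_sg : psSigma q = sg q := by
  funext f
  ext n
  rw [coeff_sg, psSigma, PowerSeries.coeff_mk]

lemma polyPS_eq_algebraMap (p : ℂ[X]) : polyPS p = algebraMap ℂ[X] (PowerSeries ℂ) p := by
  rw [algebraMap_eq_coe]
  rfl

lemma exists_isMahler_of_isM (L : Subfield ℂ) {f : PowerSeries ℂ} (hf : IsM q f)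
    (hL : ∀ n, PowerSeries.coeff n f ∈ L) :
    ∃ g : PowerSeries L, (∀ n, ((PowerSeries.coeff n g : L) : ℂ) = PowerSeries.coeff n f) ∧
      IsMahler q g := by
  let g : PowerSeries L := PowerSeries.mk fun n => ⟨PowerSeries.coeff n f, hL n⟩
  have hg : ∀ n, ((PowerSeries.coeff n g : L) : ℂ) = PowerSeries.coeff n f := fun n => by simp [g]
  refine ⟨g, hg, IsMahler.of_map L ℂ ?_⟩
  have hmap : PowerSeries.map (algebraMap L ℂ) g = f := by
    ext n
    rw [PowerSeries.coeff_map]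
    exact hg n
  rw [hmap, IsMahler, not_linearIndependent_iff]
  obtain ⟨-, m, p, -, ⟨i, him, hi⟩, hp⟩ := hf
  refine ⟨Finset.range (m + 1), p, ?_, i, Finset.mem_range.2 (by omega), hi⟩
  rw [← hp, psSigma_eq_sg]
  exact Finset.sum_congr rfl fun j _ => by rw [Algebra.smul_def, polyPS_eq_algebraMap]

lemma isM_map_subtype {L : Subfield ℂ} (hL : ∀ x ∈ L, IsAlgebraic ℚ x) {g : PowerSeries L}
    (hg : IsMahler q g) : IsM q (PowerSeries.map L.subtype g) := by
  obtain ⟨r, D, c, hD, h⟩ := exists_top_relation hg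
  refine ⟨fun n => ?_, r, fun i => if i = r then D.map L.subtype else -(c i).map L.subtype,
    fun i j => ?_, ⟨r, le_rfl, ?_⟩, ?_⟩
  · rw [PowerSeries.coeff_map]
    exact hL _ (Subtype.prop _)
  · dsimp only
    split_ifs
    · rw [coeff_map]
      exact hL _ (Subtype.prop _)
    · rw [coeff_neg, coeff_map]
      exact (hL _ (Subtype.prop _)).neg
  · beta_reduce
    rw [if_pos rfl]
    exact (Polynomial.map_ne_zero_iff L.subtype.injective).2 hD
  · have h1 := congrArg (PowerSeries.map L.subtype) h
    simp only [Algebra.smul_def, map_mul, map_sum, map_algebraMap_polynomial,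
      map_sg_iterate] at h1
    beta_reduce
    rw [psSigma_eq_sg, Finset.sum_range_succ, if_pos rfl, polyPS_eq_algebraMap, h1,
      ← Finset.sum_add_distrib]
    refine Finset.sum_eq_zero fun i hi => ?_
    rw [if_neg (Finset.mem_range.1 hi).ne, polyPS_eq_algebraMap, map_neg, neg_mul,
      neg_add_cancel]

end Subfields

end MahlerLift

open MahlerLift

/-- If `K` is a number field, `α ∈ K` with `0 < |α| < 1`, and `w₁, …, w_d`
is a basis of `K` as a `ℚ(α)`-vector space, then
`M_{q,α,K} = w₁ M_{q,α,ℚ(α)} ⊕ ⋯ ⊕ w_d M_{q,α,ℚ(α)}`: every `ξ ∈ M_{q,α,K}` is uniquely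
`ξ = w₁ ξ₁ + ⋯ + w_d ξ_d` with `ξ₁, …, ξ_d ∈ M_{q,α,ℚ(α)}`. -/
theorem M_field_decomposition
    (q : ℕ) (hq : 2 ≤ q)
    (K : Subfield ℂ) [FiniteDimensional ℚ K] (hKalg : ∀ x ∈ K, IsAlgebraic ℚ x)
    (α : ℂ) (hαK : α ∈ K) (hα0 : 0 < ‖α‖) (hα1 : ‖α‖ < 1)
    (d : ℕ) (w : Fin d → ℂ) (hwK : ∀ i, w i ∈ K)
    (hbasis : ∀ x ∈ K, ∃! c : Fin d → ℂ,
      (∀ i, c i ∈ Subfield.closure ({α} : Set ℂ)) ∧ x = ∑ i, c i * w i)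
    (ξ : ℂ) (hξ : ξ ∈ Mset q α (K : Set ℂ)) :
    ∃! c : Fin d → ℂ,
      (∀ i, c i ∈ Mset q α ((Subfield.closure ({α} : Set ℂ) : Subfield ℂ) : Set ℂ)) ∧
      ξ = ∑ i, w i * c i := by
  have : NeZero q := ⟨by omega⟩
  have : NumberField K := { to_charZero := inferInstance, to_finiteDimensional := inferInstance }
  set k : Subfield ℂ := Subfield.closure ({α} : Set ℂ) with hk
  have hkK : k ≤ K := Subfield.closure_le.2 (Set.singleton_subset_iff.2 hαK)
  have hαk : α ∈ k := Subfield.subset_closure rfl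
  have hkalg : ∀ x ∈ k, IsAlgebraic ℚ x := fun x hx => hKalg x (hkK hx)
  let : Algebra k K := (Subfield.inclusion hkK).toAlgebra
  have hsmul : ∀ (x : k) (y : K), ((x • y : K) : ℂ) = (x : ℂ) * (y : ℂ) := fun x y => by
    rw [Algebra.smul_def]
    rfl
  let w' : Fin d → K := fun i => ⟨w i, hwK i⟩
  have hli : LinearIndependent k w' := by
    rw [Fintype.linearIndependent_iff]
    intro c hc i
    have h1 : ∑ i, (c i : ℂ) * w i = 0 := by
      have := congrArg (fun x : K => (x : ℂ)) hc
      simpa only [AddSubmonoidClass.coe_finsetSum, hsmul, ZeroMemClass.coe_zero] using this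
    have h2 := (hbasis 0 K.zero_mem).unique (y₁ := fun i => (c i : ℂ)) (y₂ := fun _ => 0)
      ⟨fun i => (c i).2, h1.symm⟩ ⟨fun _ => k.zero_mem, by simp⟩
    exact Subtype.ext (congrFun h2 i)
  have hspan : ⊤ ≤ Submodule.span k (Set.range w') := by
    rintro x -
    obtain ⟨c, ⟨hc, hx⟩, -⟩ := hbasis x x.2
    rw [Submodule.mem_span_range_iff_exists_fun]
    refine ⟨fun i => ⟨c i, hc i⟩, Subtype.ext ?_⟩
    simp only [AddSubmonoidClass.coe_finsetSum, hsmul]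
    exact hx.symm
  let B := Module.Basis.mk hli hspan
  let β : k := ⟨α, hαk⟩
  have hβ : K.subtype (algebraMap k K β) = α := rfl
  have hβ0 : β ≠ 0 := fun h => by
    have : α = 0 := congrArg Subtype.val h
    rw [this, norm_zero] at hα0
    exact lt_irrefl _ hα0
  have hβ1 : ‖K.subtype (algebraMap k K β)‖ < 1 := hα1
  have huniq : ∀ c c' : Fin d → ℂ, (∀ i, c i ∈ Mset q α (k : Set ℂ)) →
      (∀ i, c' i ∈ Mset q α (k : Set ℂ)) → ∑ i, w i * c i = ∑ i, w i * c' i → c = c' := by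
    intro c c' hc hc' hcc
    choose f hfM hfk F hF hF0 hFα hFv using hc
    choose f' hfM' hfk' F' hF' hF0' hFα' hFv' using hc'
    choose g hg hgM using fun m => exists_isMahler_of_isM k (hfM m) (hfk m)
    choose g' hg' hgM' using fun m => exists_isMahler_of_isM k (hfM' m) (hfk' m)
    funext m
    have h1 := eq_zero_of_sum_mul_eq_zero (φ := K.subtype) hq hli
      (fun m => (hgM m).sub (hgM' m)) hβ0 hβ1 (G := fun m z => F m z - F' m z)
      (fun m z hz => (hF m z hz).fun_sub (hF' m z hz)) (fun m => (hFα m).sub (hFα' m))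
      (fun m => by
        filter_upwards [hF0 m, hF0' m] with z hz hz'
        refine (hz.sub hz').congr_fun fun n => ?_
        rw [← hg, ← hg', ← sub_mul, map_sub]
        rfl)
      (by
        simp only [hβ, hFv, hFv', mul_sub, Finset.sum_sub_distrib]
        exact sub_eq_zero.2 hcc) m
    simp only [hβ, hFv, hFv'] at h1
    exact sub_eq_zero.1 h1
  obtain ⟨f, hfM, hfK, F, hF, hF0, hFα, rfl⟩ := hξ
  obtain ⟨f₀, hf₀, hf₀M⟩ := exists_isMahler_of_isM K hfM hfK
  let g : Fin d → PowerSeries k := fun m => coeffwise (B.coord m) f₀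
  have hg : ∀ m, IsMahler q (g m) := fun m => hf₀M.coeffwise B m
  have hcoeff : ∀ n, PowerSeries.coeff n f = ∑ m, w m * ((PowerSeries.coeff n (g m) : k) : ℂ) := by
    intro n
    rw [← hf₀]
    conv_lhs => rw [← B.sum_repr (PowerSeries.coeff n f₀)]
    simp only [AddSubmonoidClass.coe_finsetSum, hsmul]
    refine Finset.sum_congr rfl fun m _ => ?_
    rw [mul_comm, Module.Basis.mk_apply, coeff_coeffwise, Module.Basis.coord_apply]
  obtain ⟨G, hGm, hGα, hG0, hsum⟩ := exists_analytic_continuations (φ := K.subtype) hq hli hg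
    hβ0 hβ1 hF hFα (by
      intro r hr hconv
      have hball : ∀ᶠ z : ℂ in nhds 0, ‖z‖ < r :=
        (continuous_norm.tendsto' (0 : ℂ) 0 norm_zero).eventually_lt_const hr
      filter_upwards [hF0, hball] with z hz hzr
      refine hz.unique ?_
      refine (hasSum_sum fun m _ => ((hconv m).hasSum hzr.le).mul_left (w m)).congr_fun fun n => ?_
      rw [hcoeff, Finset.sum_mul]
      exact Finset.sum_congr rfl fun m _ => mul_assoc _ _ _)
  have hmem : ∀ m, G m α ∈ Mset q α (k : Set ℂ) := fun m =>
    ⟨PowerSeries.map k.subtype (g m), isM_map_subtype hkalg (hg m),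
      fun n => by rw [PowerSeries.coeff_map]; exact Subtype.prop _,
      G m, hGm m, by simp only [PowerSeries.coeff_map]; exact hG0 m, hGα m, rfl⟩
  refine ⟨fun m => G m α, ⟨hmem, hsum⟩, fun c hc => ?_⟩
  exact huniq c _ hc.1 hmem (hc.2.symm.trans hsum)
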